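/- Let q be a prime power and let d be a positive integer not coprime to q. Then for every positive integer n, the proportion of irreducible complex characters of GL(n, F_q) whose degree is divisible by d is at most 1/q; that is, #{χ ∈ Irr(GL(n,q)) : d divides χ(1)} / |Irr(GL(n,q))| ≤ 1/q. -/

import Mathlib

open Matrix

noncomputable def blockOneHom (F : Type*) [Field F] (n₀ n : ℕ) (h : n₀ ≤ n) :
    Matrix (Fin n₀) (Fin n₀) F →* Matrix (Fin n) (Fin n) F :=
  (Matrix.reindexAlgEquiv F F
      ((finSumFinEquiv (m := n₀) (n := n - n₀)).trans
        (finCongr (Nat.add_sub_cancel' h)))).toAlgHom.toMonoidHom.comp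
    { toFun := fun A => Matrix.fromBlocks A 0 0 (1 : Matrix (Fin (n - n₀)) (Fin (n - n₀)) F)
      map_one' := by simp [Matrix.fromBlocks_one]
      map_mul' := fun A B => by
        simp [Matrix.fromBlocks_multiply] }

noncomputable def glEmbed {F : Type*} [Field F] {n₀ n : ℕ} (h : n₀ ≤ n) :
    GL (Fin n₀) F →* GL (Fin n) F :=
  Units.map (blockOneHom F n₀ n h)

def IsIrrChar (G : Type) [Group G] (f : G → ℂ) : Prop :=
  ∃ V : FDRep ℂ G, CategoryTheory.Simple V ∧ FDRep.character V = f

/-- `d` divides the algebraic number `z`, i.e. `z / d` is an algebraic integer. -/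
def NatDvdAlg (d : ℕ) (z : ℂ) : Prop := IsIntegral ℤ (z / (d : ℂ))


open ComplexConjugate ComplexOrder
set_option linter.unusedSectionVars false

section PartA
variable {G : Type} [Group G] [Fintype G]

noncomputable def cip (f h : G → ℂ) : ℂ := (Nat.card G : ℂ)⁻¹ * ∑ g, f g * conj (h g)

noncomputable instance instInvG : Invertible (Nat.card G : ℂ) :=
  invertibleOfNonzero (by exact_mod_cast Nat.card_pos.ne')

lemma exists_irr_sub {V : Type} [AddCommGroup V] [Module ℂ V] [FiniteDimensional ℂ V]
    (ρ : Representation ℂ G V) (C : Submodule ℂ V) (hC : C ≠ ⊥)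
    (hCi : ∀ g, ∀ v ∈ C, ρ g v ∈ C) :
    ∃ W : Subrepresentation ρ, W.toSubmodule ≤ C ∧ W.toSubmodule ≠ ⊥ ∧
      Representation.IsIrreducible W.toRepresentation := by
  have hex : ∃ n : ℕ, ∃ W : Subrepresentation ρ, W.toSubmodule ≤ C ∧ W.toSubmodule ≠ ⊥ ∧
      Module.finrank ℂ W.toSubmodule = n := ⟨_, ⟨C, fun g v hv => hCi g v hv⟩, le_rfl, hC, rfl⟩
  classical
  obtain ⟨W, h1, h2, h3⟩ := Nat.find_spec hex
  refine ⟨W, h1, h2, ?_⟩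
  have : Nontrivial (Subrepresentation W.toRepresentation) := by
    refine ⟨⊥, ⊤, fun h => h2 ?_⟩
    have h4 : (⊥ : Submodule ℂ W.toSubmodule) = ⊤ :=
      congrArg (fun X : Subrepresentation W.toRepresentation => X.toSubmodule) h
    rw [eq_bot_iff]
    intro x hx
    have : (⟨x, hx⟩ : W.toSubmodule) ∈ (⊥ : Submodule ℂ W.toSubmodule) := h4 ▸ trivial
    simpa using this
  refine ⟨fun A => ?_⟩
  by_cases hA : A.toSubmodule = ⊥
  · left; exact Subrepresentation.toSubmodule_injective hA
  right
  apply Subrepresentation.toSubmodule_injective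
  change A.toSubmodule = ⊤
  let B : Subrepresentation ρ := ⟨A.toSubmodule.map W.toSubmodule.subtype, by
    rintro g v ⟨w, hw, rfl⟩
    exact ⟨_, A.apply_mem_toSubmodule g hw, rfl⟩⟩
  have hB : Module.finrank ℂ B.toSubmodule = Module.finrank ℂ A.toSubmodule :=
    Submodule.finrank_map_subtype_eq _ _
  have h5 : Nat.find hex ≤ Module.finrank ℂ B.toSubmodule := by
    apply Nat.find_min' hex
    refine ⟨B, (Submodule.map_subtype_le _ _).trans h1, ?_, rfl⟩
    change Submodule.map _ _ ≠ ⊥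
    intro hb
    apply hA
    have h6 : Module.finrank ℂ A.toSubmodule = 0 := by
      rw [← hB]; change Module.finrank ℂ (Submodule.map _ _ : Submodule ℂ V) = 0; rw [hb]; simp
    exact Submodule.finrank_eq_zero.1 h6
  apply Submodule.eq_top_of_finrank_eq
  apply le_antisymm (Submodule.finrank_le _)
  omega

lemma simple_of_irr {V : Type} [AddCommGroup V] [Module ℂ V] [FiniteDimensional ℂ V]
    (ρ : Representation ℂ G V) (h : ρ.IsIrreducible) : CategoryTheory.Simple (FDRep.of ρ) := by
  rw [FDRep.simple_iff_char_is_norm_one]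
  have := Representation.char_orthonormal ρ ρ
  rw [if_pos ⟨Representation.Equiv.refl ρ⟩, inv_mul_eq_one₀ (by exact_mod_cast Nat.card_pos.ne')] at this
  exact this.symm

lemma isIrrChar_iff (f : G → ℂ) : IsIrrChar G f ↔
    ∃ (V : Type) (_ : AddCommGroup V) (_ : Module ℂ V) (_ : FiniteDimensional ℂ V)
      (ρ : Representation ℂ G V), ρ.IsIrreducible ∧ ρ.character = f := by
  constructor
  · rintro ⟨V, hV, rfl⟩
    have hne : (⊤ : Submodule ℂ V) ≠ ⊥ := by
      intro h
      have hs := (FDRep.simple_iff_char_is_norm_one V).1 hV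
      have h0 : ∀ g, V.character g = 0 := by
        intro g
        have : V.ρ g = 0 := by
          ext x
          have : x ∈ (⊥ : Submodule ℂ V) := h ▸ trivial
          simp only [Submodule.mem_bot] at this
          simp [this]
        simp [FDRep.character, this]
      simp [h0] at hs
      exact Fintype.card_ne_zero (α := G) (by exact_mod_cast hs.symm)
    obtain ⟨W, -, h2, h3⟩ := exists_irr_sub V.ρ ⊤ hne (by simp)
    refine ⟨_, _, _, inferInstance, W.toRepresentation, h3, ?_⟩
    have hW := simple_of_irr _ h3
    have key := FDRep.char_orthonormal V (FDRep.of W.toRepresentation)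
    have key2 := Representation.card_inv_mul_sum_char_mul_char_eq_finrank W.toRepresentation V.ρ
    have e1 : ∑ g, V.character g * (FDRep.of W.toRepresentation).character g⁻¹ =
      ∑ g, Representation.character V.ρ g * W.toRepresentation.character g⁻¹ := rfl
    rw [e1, key2] at key
    split_ifs at key with hi
    · exact (FDRep.char_iso hi.some).symm
    · exfalso
      have : Module.finrank ℂ (Representation.IntertwiningMap W.toRepresentation V.ρ) = 0 := by
        exact_mod_cast key
      have hfd : Module.Finite ℂ (Representation.IntertwiningMap W.toRepresentation V.ρ) :=
        Module.Finite.equiv (Representation.invariantsEquivIntertwiningMap W.toRepresentation V.ρ)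
      have hsub := Module.finrank_zero_iff.1 this
      let i : Representation.IntertwiningMap W.toRepresentation V.ρ :=
        ⟨W.toSubmodule.subtype, fun g => by ext; rfl⟩
      have hi : i = 0 := Subsingleton.elim _ _
      apply h2
      rw [eq_bot_iff]
      intro x hx
      have : i ⟨x, hx⟩ = 0 := by rw [hi]; rfl
      exact this
  · rintro ⟨V, _, _, _, ρ, h, rfl⟩
    exact ⟨FDRep.of ρ, simple_of_irr ρ h, rfl⟩

lemma char_inv_eq_conj {V : Type} [AddCommGroup V] [Module ℂ V] [FiniteDimensional ℂ V]
    (ρ : Representation ℂ G V) (g : G) : ρ.character g⁻¹ = conj (ρ.character g) := by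
  classical
  let b := Module.finBasis ℂ V
  let A : G →* Matrix _ _ ℂ := (LinearMap.toMatrixAlgEquiv b).toMulEquiv.toMonoidHom.comp ρ
  have htr : ∀ h, ρ.character h = (A h).trace := fun h => by
    simp only [Representation.character]
    rw [LinearMap.trace_eq_matrix_trace ℂ b]; rfl
  let P := ∑ h, (A h)ᴴ * A h
  have hP : P.PosDef := by
    have : P = (1 : Matrix _ _ ℂ) + ∑ h ∈ Finset.univ.erase 1, (A h)ᴴ * A h := by
      simp only [P]
      rw [← Finset.add_sum_erase _ _ (Finset.mem_univ (1:G))]; simp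
    rw [this]
    exact Matrix.PosDef.one.add_posSemidef (Matrix.posSemidef_sum _ fun h _ => Matrix.posSemidef_conjTranspose_mul_self _)
  have hinv : (A g)ᴴ * P * A g = P := by
    simp only [P, Finset.mul_sum, Finset.sum_mul]
    rw [← Equiv.sum_comp (Equiv.mulRight g) (fun h => (A h)ᴴ * A h)]
    refine Finset.sum_congr rfl fun h _ => ?_
    simp [Matrix.mul_assoc, Matrix.conjTranspose_mul]
  have hAg : A g * A g⁻¹ = 1 := by rw [← map_mul]; simp
  have h1 : (A g)ᴴ * P = P * A g⁻¹ := by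
    calc (A g)ᴴ * P = (A g)ᴴ * P * (A g * A g⁻¹) := by rw [hAg, mul_one]
      _ = P * A g⁻¹ := by rw [← mul_assoc, hinv]
  have hu : IsUnit P.det := (Matrix.isUnit_iff_isUnit_det _).1 hP.isUnit
  have h2 : A g⁻¹ = P⁻¹ * (A g)ᴴ * P := by
    rw [mul_assoc, h1, ← mul_assoc, Matrix.nonsing_inv_mul _ hu, one_mul]
  rw [htr, htr, h2, Matrix.trace_mul_comm, ← mul_assoc, Matrix.mul_nonsing_inv _ hu, one_mul,
    Matrix.trace_conjTranspose]
  rfl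

lemma cip_char {V W : Type} [AddCommGroup V] [Module ℂ V] [FiniteDimensional ℂ V]
    [AddCommGroup W] [Module ℂ W] [FiniteDimensional ℂ W]
    (ρ : Representation ℂ G V) (σ : Representation ℂ G W) :
    ∃ n : ℕ, cip ρ.character σ.character = n := by
  unfold cip
  simp_rw [← char_inv_eq_conj]
  exact ⟨_, Representation.card_inv_mul_sum_char_mul_char_eq_finrank σ ρ⟩

lemma irr_ortho [DecidableEq (G → ℂ)] {f h : G → ℂ} (hf : IsIrrChar G f) (hh : IsIrrChar G h) :
    cip f h = if f = h then 1 else 0 := by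
  obtain ⟨V, hV, rfl⟩ := hf
  obtain ⟨W, hW, rfl⟩ := hh
  have h1 := FDRep.char_orthonormal V W
  have h2 : ∀ g, W.character g⁻¹ = conj (W.character g) := fun g => char_inv_eq_conj W.ρ g
  simp_rw [h2] at h1
  unfold cip
  by_cases hi : Nonempty (V ≅ W)
  · rw [h1, if_pos hi, if_pos (FDRep.char_iso hi.some)]
  · rw [if_neg hi] at h1
    rw [if_neg, h1]
    intro he
    have h3 := FDRep.char_orthonormal V V
    rw [if_pos ⟨CategoryTheory.Iso.refl V⟩] at h3
    have h4 : ∀ g, V.character g⁻¹ = conj (V.character g) := fun g => char_inv_eq_conj V.ρ g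
    simp only [h4] at h3
    rw [← he, h3] at h1
    simp at h1

lemma irr_class {f : G → ℂ} (hf : IsIrrChar G f) (g h : G) : f (h * g * h⁻¹) = f g := by
  obtain ⟨V, hV, rfl⟩ := hf
  simp

lemma irr_complete0 (f : G → ℂ) (hcl : ∀ g h, f (h * g * h⁻¹) = f g)
    (h0 : ∀ χ, IsIrrChar G χ → cip f χ = 0) : f = 0 := by
  classical
  have hT : ∀ (V : Type) [AddCommGroup V] [Module ℂ V] [FiniteDimensional ℂ V]
    (ρ : Representation ℂ G V) (x : G), (∑ g, f g • ρ g⁻¹) ∘ₗ ρ x = ρ x ∘ₗ (∑ g, f g • ρ g⁻¹) := by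
    intro V _ _ _ ρ x
    change (∑ g, f g • ρ g⁻¹) * ρ x = ρ x * (∑ g, f g • ρ g⁻¹)
    rw [Finset.sum_mul, Finset.mul_sum]
    rw [← Equiv.sum_comp (MulAut.conj x).toEquiv]
    refine Finset.sum_congr rfl fun g _ => ?_
    have : (MulAut.conj x).toEquiv g = x * g * x⁻¹ := rfl
    rw [this, hcl, smul_mul_assoc, mul_smul_comm, ← map_mul, ← map_mul]
    simp [mul_assoc]
  have hirr : ∀ (V : Type) [AddCommGroup V] [Module ℂ V] [FiniteDimensional ℂ V]
    (ρ : Representation ℂ G V), ρ.IsIrreducible → ∑ g, f g • ρ g⁻¹ = 0 := by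
    intro V _ _ _ ρ hρ
    let T : Representation.IntertwiningMap ρ ρ := ⟨∑ g, f g • ρ g⁻¹, hT V ρ⟩
    obtain ⟨c, hc⟩ := (Representation.IsIrreducible.algebraMap_intertwiningMap_bijective_of_isAlgClosed (ρ := ρ)).2 T
    have h1 : ∑ g, f g • ρ g⁻¹ = c • (1 : V →ₗ[ℂ] V) :=
      (congrArg Representation.IntertwiningMap.toLinearMap hc).symm
    have h2 := h0 _ ((isIrrChar_iff _).2 ⟨V, _, _, inferInstance, ρ, hρ, rfl⟩)
    have h3 : (LinearMap.trace ℂ V) (∑ g, f g • ρ g⁻¹) = 0 := by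
      unfold cip at h2
      simp_rw [← char_inv_eq_conj] at h2
      rw [map_sum]
      have : (Nat.card G : ℂ)⁻¹ ≠ 0 := inv_ne_zero (by exact_mod_cast Nat.card_pos.ne')
      simpa [this, Representation.character] using h2
    rw [h1] at h3
    rw [h1]
    have hn : Nontrivial V := by
      by_contra hn
      rw [not_nontrivial_iff_subsingleton] at hn
      obtain ⟨x, y, hxy⟩ := hρ.toNontrivial
      exact hxy (Subrepresentation.toSubmodule_injective (Subsingleton.elim _ _))
    have : c = 0 := by simpa [Module.finrank_pos.ne'] using h3
    simp [this]
  have hreg : ∑ g, f g • (Representation.leftRegular ℂ G) g⁻¹ = 0 := by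
    set ρ := Representation.leftRegular ℂ G
    by_contra hne
    let K : Subrepresentation ρ := ⟨LinearMap.ker (∑ g, f g • ρ g⁻¹), fun x v hv => by
      have := LinearMap.congr_fun (hT _ ρ x) v
      simp only [LinearMap.comp_apply, LinearMap.mem_ker] at *
      rw [this, hv, map_zero]⟩
    have hss : Representation.IsSemisimpleRepresentation ρ := inferInstance
    obtain ⟨C, hC⟩ := hss.exists_isCompl K
    have hCb : C.toSubmodule ≠ ⊥ := by
      intro hb
      have : C = ⊥ := Subrepresentation.toSubmodule_injective hb
      rw [this] at hC
      have h5 : K = ⊤ := by simpa using hC.sup_eq_top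
      have h6 : K.toSubmodule = ⊤ := by rw [h5]; rfl
      exact hne (LinearMap.ker_eq_top.1 h6)
    obtain ⟨W, hW1, hW2, hW3⟩ := exists_irr_sub ρ C.toSubmodule hCb
      (fun g v hv => C.apply_mem_toSubmodule g hv)
    have hW := hirr _ _ hW3
    apply hW2
    rw [eq_bot_iff]
    intro x hx
    have hxK : x ∈ K.toSubmodule := by
      have := congrArg W.toSubmodule.subtype (LinearMap.congr_fun hW ⟨x, hx⟩)
      simp only [LinearMap.sum_apply, LinearMap.smul_apply, map_sum, map_smul, LinearMap.zero_apply, map_zero] at this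
      change (∑ g, f g • ρ g⁻¹) x = 0
      rw [LinearMap.sum_apply]
      exact this
    have h7 := hC.inf_eq_bot
    have h8 : K.toSubmodule ⊓ C.toSubmodule = ⊥ := congrArg Subrepresentation.toSubmodule h7
    rw [← h8]
    exact ⟨hxK, hW1 hx⟩
  ext x
  have h9 := congrArg (fun T => T.coeff x⁻¹) (LinearMap.congr_fun hreg (MonoidAlgebra.single 1 1))
  simpa [Representation.leftRegular, Representation.ofMulAction_single, Finsupp.single_apply] using h9

abbrev Irr (G : Type) [Group G] := {χ : G → ℂ // IsIrrChar G χ}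

lemma cip_sum_left {ι : Type*} (s : Finset ι) (c : ι → ℂ) (f : ι → G → ℂ) (h : G → ℂ) :
    cip (fun x => ∑ i ∈ s, c i * f i x) h = ∑ i ∈ s, c i * cip (f i) h := by
  unfold cip
  simp_rw [Finset.sum_mul, Finset.mul_sum]
  rw [Finset.sum_comm]
  refine Finset.sum_congr rfl fun i _ => Finset.sum_congr rfl fun g _ => by ring

lemma irr_linindep : LinearIndependent ℂ
    (fun (χ : Irr G) (c : ConjClasses G) => χ.1 (Quotient.out c)) := by
  classical
  rw [linearIndependent_iff']
  intro s a h χ hχ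
  have h1 : ∀ g : G, ∑ i ∈ s, a i * i.1 g = 0 := by
    intro g
    have := congrFun h (ConjClasses.mk g)
    simp only [Finset.sum_apply, Pi.smul_apply, smul_eq_mul, Pi.zero_apply] at this
    rw [← this]
    refine Finset.sum_congr rfl fun i _ => ?_
    have hc : IsConj (Quotient.out (ConjClasses.mk g)) g :=
      ConjClasses.mk_eq_mk_iff_isConj.1 (Quotient.out_eq (ConjClasses.mk g))
    obtain ⟨x, hx⟩ := isConj_iff.1 hc
    rw [← irr_class i.2 (Quotient.out (ConjClasses.mk g)) x, hx]
  have h2 := cip_sum_left s a (fun i => i.1) χ.1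
  simp_rw [h1] at h2
  have h3 : ∀ i ∈ s, a i * cip i.1 χ.1 = if i = χ then a i else 0 := by
    intro i _
    rw [irr_ortho i.2 χ.2]
    simp [Subtype.ext_iff]
  rw [Finset.sum_congr rfl h3] at h2
  simpa [cip, hχ] using h2.symm

instance irr_finite : Finite (Irr G) := by
  classical
  exact (irr_linindep (G := G)).finite

lemma card_irr_le : Nat.card (Irr G) ≤ Nat.card (ConjClasses G) := by
  classical
  have := Fintype.ofFinite (Irr G)
  have h := (irr_linindep (G := G)).fintype_card_le_finrank
  rw [Module.finrank_fintype_fun_eq_card] at h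
  simpa [Nat.card_eq_fintype_card] using h

noncomputable instance : Fintype (Irr G) := Fintype.ofFinite _

lemma irr_expand (f : G → ℂ) (hcl : ∀ g h, f (h * g * h⁻¹) = f g) (g : G) :
    f g = ∑ χ : Irr G, cip f χ.1 * χ.1 g := by
  classical
  have key := irr_complete0 (fun g => f g - ∑ χ : Irr G, cip f χ.1 * χ.1 g) (by
    intro g h
    simp_rw [hcl]
    congr 1
    refine Finset.sum_congr rfl fun χ _ => ?_
    rw [irr_class χ.2]) (by
    intro χ hχ
    have h1 := cip_sum_left Finset.univ (fun i : Irr G => cip f i.1) (fun i => i.1) χ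
    have h2 : ∀ i : Irr G, cip f i.1 * cip i.1 χ = if i = ⟨χ, hχ⟩ then cip f i.1 else 0 := by
      intro i
      rw [irr_ortho i.2 hχ]
      simp [Subtype.ext_iff]
    simp_rw [h2] at h1
    simp only [Finset.sum_ite_eq', Finset.mem_univ, if_true] at h1
    unfold cip at h1 ⊢
    simp_rw [sub_mul, Finset.sum_sub_distrib, mul_sub]
    rw [h1, sub_self])
  have := congrFun key g
  simpa [sub_eq_zero] using this

lemma col_ortho (g : G) :
    ∑ χ : Irr G, χ.1 g * conj (χ.1 g) = Nat.card (Subgroup.centralizer {g}) := by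
  classical
  have h := irr_expand (fun x => if IsConj g x then (1:ℂ) else 0) (by
    intro x y
    have : IsConj g (y * x * y⁻¹) ↔ IsConj g x :=
      ⟨fun h => h.trans (isConj_iff.2 ⟨y⁻¹, by group⟩), fun h => h.trans (isConj_iff.2 ⟨y, rfl⟩)⟩
    simp only [this]) g
  rw [if_pos (IsConj.refl g)] at h
  have h1 : ∀ χ : Irr G, cip (fun x => if IsConj g x then (1:ℂ) else 0) χ.1 =
      (Nat.card (Subgroup.centralizer {g}) : ℂ)⁻¹ * conj (χ.1 g) := by
    intro χ
    unfold cip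
    have h2 : ∀ x, (if IsConj g x then (1:ℂ) else 0) * conj (χ.1 x) =
        if IsConj g x then conj (χ.1 g) else 0 := by
      intro x
      split_ifs with hx
      · obtain ⟨y, rfl⟩ := isConj_iff.1 hx
        rw [irr_class χ.2, one_mul]
      · simp
    simp_rw [h2]
    rw [← Finset.sum_filter, Finset.sum_const, nsmul_eq_mul, ← mul_assoc]
    congr 1
    have h3 := MulAction.card_orbit_mul_card_stabilizer_eq_card_group (ConjAct G) g
    simp only [← Nat.card_eq_fintype_card] at h3
    rw [← Subgroup.nat_card_centralizer_nat_card_stabilizer] at h3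
    have h4 : Nat.card (MulAction.orbit (ConjAct G) g) =
        (Finset.univ.filter fun x => IsConj g x).card := by
      rw [Nat.card_eq_fintype_card, ← Set.toFinset_card]
      congr 1
      ext x
      simp only [Set.mem_toFinset, Finset.mem_filter, Finset.mem_univ, true_and,
        ConjAct.mem_orbit_conjAct]
      exact isConj_comm
    have h5 : Nat.card (ConjAct G) = Nat.card G := rfl
    rw [h4, h5] at h3
    have h6 : (Nat.card (Subgroup.centralizer {g}) : ℂ) ≠ 0 := by exact_mod_cast Nat.card_pos.ne'
    have h7 : (Nat.card G : ℂ) ≠ 0 := by exact_mod_cast Nat.card_pos.ne'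
    rw [inv_mul_eq_iff_eq_mul₀ h7, eq_mul_inv_iff_mul_eq₀ h6]
    exact_mod_cast h3
  simp_rw [h1] at h
  have h4 : (Nat.card (Subgroup.centralizer {g}) : ℂ) ≠ 0 := by exact_mod_cast Nat.card_pos.ne'
  have h5 : (1:ℂ) = (Nat.card (Subgroup.centralizer {g}) : ℂ)⁻¹ * ∑ χ : Irr G, χ.1 g * conj (χ.1 g) := by
    rw [Finset.mul_sum, h]
    exact Finset.sum_congr rfl fun χ _ => by ring
  field_simp at h5
  exact h5.symm

end PartA


set_option linter.unusedSectionVars false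
section PartB
attribute [local instance 10] Fintype.ofFinite
attribute [local instance] Classical.propDecidable

structure FObj (F : Type) [Field F] where
  V : Type
  [acg : AddCommGroup V]
  [mod : Module F V]
  [fin : Finite V]
  f : V →ₗ[F] V

attribute [instance] FObj.acg FObj.mod FObj.fin

instance FObj.setoid (F : Type) [Field F] : Setoid (FObj F) where
  r A B := ∃ e : A.V ≃ₗ[F] B.V, ∀ x, e (A.f x) = B.f (e x)
  iseqv := ⟨fun A => ⟨LinearEquiv.refl _ _, fun x => rfl⟩,
    fun {A B} ⟨e, h⟩ => ⟨e.symm, fun x => by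
      rw [LinearEquiv.symm_apply_eq, h, e.apply_symm_apply]⟩,
    fun {A B C} ⟨e, h⟩ ⟨e', h'⟩ => ⟨e.trans e', fun x => by simp [h, h']⟩⟩

def Cls (F : Type) [Field F] := Quotient (FObj.setoid F)

variable {F : Type} [Field F]

section basics
variable {V V' : Type} [AddCommGroup V] [Module F V] [Finite V]
  [AddCommGroup V'] [Module F V'] [Finite V']

instance : Finite (V' →ₗ[F] V) := Finite.of_injective (fun f => (f : V' → V)) DFunLike.coe_injective

def cl (f : V →ₗ[F] V) : Cls F := Quotient.mk _ ⟨V, f⟩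

lemma cl_eq {f : V →ₗ[F] V} {f' : V' →ₗ[F] V'} (e : V ≃ₗ[F] V') (h : ∀ x, e (f x) = f' (e x)) :
    cl f = cl f' := Quotient.sound ⟨e, h⟩

lemma cl_eq_iff {f : V →ₗ[F] V} {f' : V' →ₗ[F] V'} :
    cl f = cl f' ↔ ∃ e : V ≃ₗ[F] V', ∀ x, e (f x) = f' (e x) := Quotient.eq (r := FObj.setoid F)

lemma cl_ind {P : Cls F → Prop}
    (h : ∀ (V : Type) [AddCommGroup V] [Module F V] [Finite V] (f : V →ₗ[F] V), P (cl f))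
    (c : Cls F) : P c :=
  Quotient.inductionOn c fun A => h A.V A.f

noncomputable def Cls.dim (c : Cls F) : ℕ :=
  Quotient.lift (fun A : FObj F => Module.finrank F A.V) (by rintro A B ⟨e, h⟩; exact e.finrank_eq) c

@[simp] lemma dim_cl (f : V →ₗ[F] V) : (cl f).dim = Module.finrank F V := rfl

def IsInv (f : V →ₗ[F] V) (W : Submodule F V) : Prop := W ≤ W.comap f

noncomputable def cR (f : V →ₗ[F] V) (W : Submodule F V) : Cls F :=
  cl (if h : IsInv f W then f.restrict h else 0)
noncomputable def cQ (f : V →ₗ[F] V) (W : Submodule F V) : Cls F :=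
  cl (if h : IsInv f W then W.mapQ W f h else 0)

@[simp] lemma dim_cR (f : V →ₗ[F] V) (W : Submodule F V) : (cR f W).dim = Module.finrank F W := rfl
@[simp] lemma dim_cQ (f : V →ₗ[F] V) (W : Submodule F V) :
    (cQ f W).dim = Module.finrank F (V ⧸ W) := rfl

lemma cR_eq {f : V →ₗ[F] V} {W : Submodule F V} (hW : IsInv f W) {f' : V' →ₗ[F] V'}
    (g : V' →ₗ[F] V) (hg : Function.Injective g) (hr : LinearMap.range g = W)
    (h : ∀ x, g (f' x) = f (g x)) : cR f W = cl f' := by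
  subst hr
  symm
  unfold cR
  rw [dif_pos hW]
  refine cl_eq (LinearEquiv.ofInjective g hg) fun x => ?_
  apply Subtype.ext
  exact h x

lemma cQ_eq {f : V →ₗ[F] V} {W : Submodule F V} (hW : IsInv f W) {f' : V' →ₗ[F] V'}
    (g : V →ₗ[F] V') (hg : Function.Surjective g) (hr : LinearMap.ker g = W)
    (h : ∀ x, g (f x) = f' (g x)) : cQ f W = cl f' := by
  subst hr
  unfold cQ
  rw [dif_pos hW]
  refine cl_eq (g.quotKerEquivOfSurjective hg) fun x => ?_
  obtain ⟨x, rfl⟩ := Submodule.mkQ_surjective _ x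
  exact h x

lemma cR_def {f : V →ₗ[F] V} {W : Submodule F V} (hW : IsInv f W) :
    cR f W = cl (f.restrict hW) := by unfold cR; rw [dif_pos hW]
lemma cQ_def {f : V →ₗ[F] V} {W : Submodule F V} (hW : IsInv f W) :
    cQ f W = cl (W.mapQ W f hW) := by unfold cQ; rw [dif_pos hW]

noncomputable def sext (f1 : V →ₗ[F] V) (f2 : V' →ₗ[F] V') (h : V' →ₗ[F] V) :
    (V × V') →ₗ[F] (V × V') :=
  (f1.comp (LinearMap.fst F V V') + h.comp (LinearMap.snd F V V')).prod
    (f2.comp (LinearMap.snd F V V'))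

@[simp] lemma sext_apply (f1 : V →ₗ[F] V) (f2 : V' →ₗ[F] V') (h : V' →ₗ[F] V) (x : V × V') :
    sext f1 f2 h x = (f1 x.1 + h x.2, f2 x.2) := rfl

noncomputable def hmRaw (Φ : Cls F → Cls F → ℂ) (f : V →ₗ[F] V) : ℂ :=
  ∑ W : Submodule F V, if IsInv f W then Φ (cR f W) (cQ f W) else 0

noncomputable def hdRaw (φ : Cls F → ℂ) (f1 : V →ₗ[F] V) (f2 : V' →ₗ[F] V') : ℂ :=
  (Nat.card (V' →ₗ[F] V) : ℂ)⁻¹ * ∑ h : V' →ₗ[F] V, φ (cl (sext f1 f2 h))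

lemma term_map (Φ : Cls F → Cls F → ℂ) {f : V →ₗ[F] V} {f' : V' →ₗ[F] V'}
    (e : V ≃ₗ[F] V') (h : ∀ x, e (f x) = f' (e x)) (W : Submodule F V) :
    (if IsInv f W then Φ (cR f W) (cQ f W) else 0) = if IsInv f' (W.map (e : V →ₗ[F] V')) then
      Φ (cR f' (W.map (e : V →ₗ[F] V'))) (cQ f' (W.map (e : V →ₗ[F] V'))) else 0 := by
  have h2 : IsInv f W ↔ IsInv f' (W.map (e : V →ₗ[F] V')) := by
    constructor
    · rintro hW _ ⟨x, hx, rfl⟩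
      exact ⟨f x, hW hx, h x⟩
    · intro hW x hx
      obtain ⟨y, hy, hy'⟩ := hW (⟨x, hx, rfl⟩ : e x ∈ W.map (e : V →ₗ[F] V'))
      have : e y = e (f x) := by rw [h]; exact hy'
      rwa [e.injective this] at hy
  by_cases hW : IsInv f W
  · have hW' := h2.1 hW
    rw [if_pos hW, if_pos hW']
    congr 1
    · rw [cR_def hW]
      symm
      refine cR_eq hW' ((e : V →ₗ[F] V').comp W.subtype) (e.injective.comp W.injective_subtype) ?_ ?_
      · rw [LinearMap.range_comp, Submodule.range_subtype]
      · intro x; exact h x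
    · rw [cQ_def hW']
      refine cQ_eq hW ((Submodule.mkQ _).comp (e : V →ₗ[F] V'))
        ((Submodule.mkQ_surjective _).comp e.surjective) ?_ ?_
      · rw [LinearMap.ker_comp, Submodule.ker_mkQ]
        exact Submodule.comap_map_eq_of_injective e.injective W
      · intro x; simp [h]; rfl
  · rw [if_neg hW, if_neg (fun hh => hW (h2.2 hh))]

lemma hmRaw_congr (Φ : Cls F → Cls F → ℂ) {f : V →ₗ[F] V} {f' : V' →ₗ[F] V'}
    (e : V ≃ₗ[F] V') (h : ∀ x, e (f x) = f' (e x)) : hmRaw Φ f = hmRaw Φ f' :=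
  Fintype.sum_equiv (Submodule.orderIsoMapComap e).toEquiv _ _ fun W => term_map Φ e h W

end basics

noncomputable def hm (Φ : Cls F → Cls F → ℂ) (c : Cls F) : ℂ :=
  Quotient.lift (fun A : FObj F => hmRaw Φ A.f) (by rintro A B ⟨e, h⟩; exact hmRaw_congr Φ e h) c

noncomputable def hd (φ : Cls F → ℂ) (c1 c2 : Cls F) : ℂ :=
  Quotient.lift₂ (fun A B : FObj F => hdRaw φ A.f B.f) (by
    rintro A B A' B' ⟨e, h⟩ ⟨e', h'⟩
    let E : (B.V →ₗ[F] A.V) ≃ (B'.V →ₗ[F] A'.V) := (LinearEquiv.arrowCongr e' e).toEquiv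
    unfold hdRaw
    rw [Nat.card_congr E]
    congr 1
    refine Fintype.sum_equiv E _ _ fun g => ?_
    congr 1
    refine cl_eq (e.prodCongr e') fun x => ?_
    simp [E, h, h', LinearEquiv.arrowCongr_apply]) c1 c2

section basics2
variable {V V' : Type} [AddCommGroup V] [Module F V] [Finite V]
  [AddCommGroup V'] [Module F V'] [Finite V']

lemma sum_ite_sub {α : Type*} [Fintype α] (p : α → Prop) [Fintype {x // p x}] (g : α → ℂ) :
    (∑ x, if p x then g x else 0) = ∑ x : {x // p x}, g x := by
  rw [← Finset.sum_filter]
  exact (Finset.sum_subtype _ (by simp) g)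

lemma hm_cl [inst : Fintype (Submodule F V)] (Φ : Cls F → Cls F → ℂ) (f : V →ₗ[F] V) : hm Φ (cl f) =
    ∑ W : Submodule F V, if IsInv f W then Φ (cR f W) (cQ f W) else 0 := by
  have : hm Φ (cl f) = hmRaw Φ f := rfl
  rw [this]; unfold hmRaw; congr!

lemma hd_cl [inst : Fintype (V' →ₗ[F] V)] (φ : Cls F → ℂ) (f1 : V →ₗ[F] V) (f2 : V' →ₗ[F] V') : hd φ (cl f1) (cl f2) =
    (Nat.card (V' →ₗ[F] V) : ℂ)⁻¹ * ∑ h : V' →ₗ[F] V, φ (cl (sext f1 f2 h)) := by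
  have : hd φ (cl f1) (cl f2) = hdRaw φ f1 f2 := rfl
  rw [this]; unfold hdRaw; congr!

lemma isInv_top (f : V →ₗ[F] V) : IsInv f ⊤ := fun _ _ => trivial
lemma isInv_bot (f : V →ₗ[F] V) : IsInv f ⊥ := bot_le

lemma cR_top (f : V →ₗ[F] V) : cR f ⊤ = cl f :=
  cR_eq (isInv_top f) LinearMap.id (fun _ _ h => h) LinearMap.range_id fun _ => rfl
lemma cQ_bot (f : V →ₗ[F] V) : cQ f ⊥ = cl f :=
  cQ_eq (isInv_bot f) LinearMap.id (fun x => ⟨x, rfl⟩) LinearMap.ker_id fun _ => rfl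

lemma cls_dim0 {c c' : Cls F} (h : c.dim = 0) (h' : c'.dim = 0) : c = c' := by
  induction c using cl_ind with | h V f
  induction c' using cl_ind with | h V' f'
  simp only [dim_cl] at h h'
  have := Module.finrank_zero_iff.1 h
  have := Module.finrank_zero_iff.1 h'
  exact cl_eq 0 fun x => Subsingleton.elim _ _

lemma dim_add (f : V →ₗ[F] V) (W : Submodule F V) : (cR f W).dim + (cQ f W).dim = (cl f).dim := by
  simp only [dim_cR, dim_cQ, dim_cl]
  rw [add_comm]; exact Submodule.finrank_quotient_add_finrank W

lemma hm_congr' {Φ Φ' : Cls F → Cls F → ℂ} (c : Cls F)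
    (h : ∀ a b, a.dim + b.dim = c.dim → Φ a b = Φ' a b) : hm Φ c = hm Φ' c := by
  induction c using cl_ind with | h V f
  rw [hm_cl, hm_cl]
  refine Finset.sum_congr rfl fun W _ => ?_
  rw [h _ _ (dim_add f W)]

lemma hm_linear (c : Cls F) : ∃ T : (Cls F → Cls F → ℂ) →ₗ[ℂ] ℂ, ∀ Φ, T Φ = hm Φ c := by
  induction c using cl_ind with | h V f
  refine ⟨∑ W : Submodule F V, if IsInv f W then
    (LinearMap.proj (cQ f W) : (Cls F → ℂ) →ₗ[ℂ] ℂ).comp (LinearMap.proj (cR f W)) else 0, fun Φ => ?_⟩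
  rw [hm_cl, LinearMap.sum_apply]
  refine Finset.sum_congr rfl fun W _ => ?_
  split_ifs <;> rfl

lemma hm_add (Φ Φ' : Cls F → Cls F → ℂ) (c) : hm (fun a b => Φ a b + Φ' a b) c = hm Φ c + hm Φ' c := by
  obtain ⟨T, hT⟩ := hm_linear c
  rw [← hT, ← hT, ← hT, ← map_add]; rfl
lemma hm_smul (r : ℂ) (Φ : Cls F → Cls F → ℂ) (c) : hm (fun a b => r * Φ a b) c = r * hm Φ c := by
  obtain ⟨T, hT⟩ := hm_linear c
  rw [← hT, ← hT, ← smul_eq_mul, ← map_smul]; rfl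
lemma hm_sub (Φ Φ' : Cls F → Cls F → ℂ) (c) : hm (fun a b => Φ a b - Φ' a b) c = hm Φ c - hm Φ' c := by
  obtain ⟨T, hT⟩ := hm_linear c
  rw [← hT, ← hT, ← hT, ← map_sub]; rfl
lemma hm_sum {ι : Type*} (s : Finset ι) (Φ : ι → Cls F → Cls F → ℂ) (c) :
    hm (fun a b => ∑ i ∈ s, Φ i a b) c = ∑ i ∈ s, hm (Φ i) c := by
  obtain ⟨T, hT⟩ := hm_linear c
  simp_rw [← hT]
  rw [← map_sum]; congr 1; ext a b; simp

/-- a functional written as a finite combination of evaluations -/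
lemma hm_eval (c : Cls F) : ∃ s : Finset (Cls F × Cls F), ∃ w : Cls F × Cls F → ℂ,
    (∀ p ∈ s, p.1.dim + p.2.dim = c.dim) ∧ ∀ Φ, hm Φ c = ∑ p ∈ s, w p * Φ p.1 p.2 := by
  induction c using cl_ind with | h V f
  refine ⟨Finset.univ.image fun W : Submodule F V => (cR f W, cQ f W),
    fun p => ∑ W : Submodule F V, if (cR f W, cQ f W) = p ∧ IsInv f W then 1 else 0, ?_, ?_⟩
  · simp only [Finset.mem_image]
    rintro p ⟨W, -, rfl⟩
    exact dim_add f W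
  · intro Φ
    rw [hm_cl]
    simp_rw [Finset.sum_mul]
    rw [Finset.sum_comm]
    refine Finset.sum_congr rfl fun W _ => ?_
    simp_rw [ite_mul, zero_mul, one_mul, ite_and]
    rw [Finset.sum_ite_eq, if_pos (Finset.mem_image_of_mem _ (Finset.mem_univ _))]

lemma hm_swap (c d : Cls F) (Ψ : Cls F → Cls F → Cls F → Cls F → ℂ) :
    hm (fun a b => hm (fun a' b' => Ψ a b a' b') d) c = hm (fun a' b' => hm (fun a b => Ψ a b a' b') c) d := by
  obtain ⟨s, w, -, h⟩ := hm_eval c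
  obtain ⟨s', w', -, h'⟩ := hm_eval d
  simp_rw [h, h', Finset.mul_sum]
  rw [Finset.sum_comm]
  refine Finset.sum_congr rfl fun _ _ => Finset.sum_congr rfl fun _ _ => by ring

lemma hm_unit_left (g : Cls F → ℂ) (c : Cls F) :
    hm (fun a b => if a.dim = 0 then g b else 0) c = g c := by
  induction c using cl_ind with | h V f
  rw [hm_cl, Finset.sum_eq_single ⊥]
  · simp [isInv_bot, cQ_bot]
  · intro W _ hW
    have : Module.finrank F W ≠ 0 := by rwa [Ne, Submodule.finrank_eq_zero]
    simp [this]
  · simp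

lemma hm_unit_right (g : Cls F → ℂ) (c : Cls F) :
    hm (fun a b => if b.dim = 0 then g a else 0) c = g c := by
  induction c using cl_ind with | h V f
  rw [hm_cl, Finset.sum_eq_single ⊤]
  · have : Module.finrank F (V ⧸ (⊤ : Submodule F V)) = 0 := Module.finrank_zero_of_subsingleton
    simp [isInv_top, cR_top, this]
  · intro W _ hW
    have : Module.finrank F (V ⧸ W) ≠ 0 := fun h => hW <| by
      apply Submodule.eq_top_of_finrank_eq
      have := Submodule.finrank_quotient_add_finrank W; omega
    simp [this]
  · simp


lemma hm_cR {f : V →ₗ[F] V} {W : Submodule F V} (hW : IsInv f W) (Φ : Cls F → Cls F → ℂ) :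
    hm Φ (cR f W) = ∑ U : Submodule F V, if U ≤ W ∧ IsInv f U then
      Φ (cR f U) (cQ (f.restrict hW) (U.comap W.subtype)) else 0 := by
  rw [cR_def hW, hm_cl]
  simp_rw [ite_and]
  rw [sum_ite_sub (fun U => U ≤ W)]
  refine Fintype.sum_equiv (Submodule.mapIic W).toEquiv _ _ fun U => ?_
  have h1 : ((Submodule.mapIic W).toEquiv U : Submodule F V) = U.map W.subtype := rfl
  rw [h1, Submodule.comap_map_eq_of_injective W.injective_subtype]
  have h2 : IsInv (f.restrict hW) U ↔ IsInv f (U.map W.subtype) := by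
    constructor
    · rintro hU _ ⟨x, hx, rfl⟩
      exact ⟨_, hU hx, rfl⟩
    · intro hU x hx
      obtain ⟨y, hy, hy'⟩ := hU ⟨x, hx, rfl⟩
      have : y = f.restrict hW x := Subtype.ext hy'
      rwa [this] at hy
  by_cases hU : IsInv (f.restrict hW) U
  · rw [if_pos hU, if_pos (h2.1 hU), cR_def hU,
      cR_eq (h2.1 hU) (f' := (f.restrict hW).restrict hU) (W.subtype.comp U.subtype) (W.injective_subtype.comp U.injective_subtype)
        (by rw [LinearMap.range_comp, Submodule.range_subtype]) (fun x => rfl)]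
  · rw [if_neg hU, if_neg (fun h => hU (h2.2 h))]

lemma hm_cQ {f : V →ₗ[F] V} {U : Submodule F V} (hU : IsInv f U) (Φ : Cls F → Cls F → ℂ) :
    hm Φ (cQ f U) = ∑ W : Submodule F V, if U ≤ W ∧ IsInv f W then
      Φ (cR (U.mapQ U f hU) (W.map U.mkQ)) (cQ f W) else 0 := by
  rw [cQ_def hU, hm_cl]
  simp_rw [ite_and]
  rw [sum_ite_sub (fun W => U ≤ W)]
  refine Fintype.sum_equiv (Submodule.comapMkQRelIso U).toEquiv _ _ fun W => ?_
  have h1 : ((Submodule.comapMkQRelIso U).toEquiv W : Submodule F V) = W.comap U.mkQ := rfl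
  rw [h1, Submodule.map_comap_eq_of_surjective U.mkQ_surjective]
  have h2 : IsInv (U.mapQ U f hU) W ↔ IsInv f (W.comap U.mkQ) := by
    constructor
    · intro hW x hx
      exact hW hx
    · intro hW x hx
      obtain ⟨x, rfl⟩ := U.mkQ_surjective x
      exact hW hx
  by_cases hW : IsInv (U.mapQ U f hU) W
  · rw [if_pos hW, if_pos (h2.1 hW), cQ_def hW,
      cQ_eq (h2.1 hW) (f' := W.mapQ W _ hW) (W.mkQ.comp U.mkQ) (W.mkQ_surjective.comp U.mkQ_surjective)
        (by rw [LinearMap.ker_comp, Submodule.ker_mkQ]) (fun x => rfl)]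
  · rw [if_neg hW, if_neg (fun h => hW (h2.2 h))]

lemma mid_eq {f : V →ₗ[F] V} {U W : Submodule F V} (hU : IsInv f U) (hW : IsInv f W) :
    cQ (f.restrict hW) (U.comap W.subtype) = cR (U.mapQ U f hU) (W.map U.mkQ) := by
  have h1 : IsInv (U.mapQ U f hU) (W.map U.mkQ) := by
    rintro _ ⟨x, hx, rfl⟩
    exact ⟨f x, hW hx, rfl⟩
  have h2 : IsInv (f.restrict hW) (U.comap W.subtype) := fun x hx => hU hx
  rw [cR_def h1]
  refine cQ_eq h2 ((U.mkQ.comp W.subtype).codRestrict (W.map U.mkQ) fun x => ⟨x, x.2, rfl⟩) ?_ ?_ ?_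
  · rintro ⟨_, x, hx, rfl⟩
    exact ⟨⟨x, hx⟩, rfl⟩
  · refine (LinearMap.ker_codRestrict _ _ _).trans ?_
    rw [LinearMap.ker_comp, Submodule.ker_mkQ]
  · intro x; rfl

lemma hm_assoc (Ψ : Cls F → Cls F → Cls F → ℂ) (d : Cls F) :
    hm (fun a c => hm (fun a1 a2 => Ψ a1 a2 c) a) d = hm (fun a c => hm (fun c1 c2 => Ψ a c1 c2) c) d := by
  induction d using cl_ind with | h V f
  rw [hm_cl, hm_cl]
  have h1 : ∀ W : Submodule F V, (if IsInv f W then hm (fun a1 a2 => Ψ a1 a2 (cQ f W)) (cR f W) else 0) =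
      ∑ U : Submodule F V, if hh : U ≤ W ∧ IsInv f U ∧ IsInv f W then
        Ψ (cR f U) (cR (U.mapQ U f hh.2.1) (W.map U.mkQ)) (cQ f W) else 0 := by
    intro W
    split_ifs with hW
    · rw [hm_cR hW]
      refine Finset.sum_congr rfl fun U _ => ?_
      by_cases hU : U ≤ W ∧ IsInv f U
      · rw [if_pos hU, dif_pos ⟨hU.1, hU.2, hW⟩, mid_eq hU.2 hW]
      · rw [if_neg hU, dif_neg (fun h => hU ⟨h.1, h.2.1⟩)]
    · rw [Finset.sum_eq_zero]
      intro U _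
      rw [dif_neg (fun h => hW h.2.2)]
  have h2 : ∀ U : Submodule F V, (if IsInv f U then hm (fun a1 a2 => Ψ (cR f U) a1 a2) (cQ f U) else 0) =
      ∑ W : Submodule F V, if hh : U ≤ W ∧ IsInv f U ∧ IsInv f W then
        Ψ (cR f U) (cR (U.mapQ U f hh.2.1) (W.map U.mkQ)) (cQ f W) else 0 := by
    intro U
    split_ifs with hU
    · rw [hm_cQ hU]
      refine Finset.sum_congr rfl fun W _ => ?_
      by_cases hW : U ≤ W ∧ IsInv f W
      · rw [if_pos hW, dif_pos ⟨hW.1, hU, hW.2⟩]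
      · rw [if_neg hW, dif_neg (fun h => hW ⟨h.1, h.2.2⟩)]
    · rw [Finset.sum_eq_zero]
      intro W _
      rw [dif_neg (fun h => hU h.2.1)]
  simp_rw [h1, h2]
  exact Finset.sum_comm
end basics2
end PartB

set_option linter.unusedSectionVars false
section PartB2
attribute [local instance 10] Fintype.ofFinite
attribute [local instance] Classical.propDecidable
variable {F : Type} [Field F]

lemma hd_eval (c1 c2 : Cls F) : ∃ s : Finset (Cls F), ∃ w : Cls F → ℂ,
    (∀ p ∈ s, p.dim = c1.dim + c2.dim) ∧ ∀ φ, hd φ c1 c2 = ∑ p ∈ s, w p * φ p := by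
  induction c1 using cl_ind with | h V f
  induction c2 using cl_ind with | h V' f'
  refine ⟨Finset.univ.image fun h : V' →ₗ[F] V => cl (sext f f' h),
    fun p => (Nat.card (V' →ₗ[F] V) : ℂ)⁻¹ * ∑ h : V' →ₗ[F] V, if cl (sext f f' h) = p then 1 else 0, ?_, ?_⟩
  · simp only [Finset.mem_image]
    rintro p ⟨W, -, rfl⟩
    simp
  · intro Φ
    rw [hd_cl]
    simp_rw [mul_assoc]
    rw [← Finset.mul_sum]
    congr 1
    simp_rw [Finset.sum_mul]
    rw [Finset.sum_comm]
    refine Finset.sum_congr rfl fun W _ => ?_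
    simp_rw [ite_mul, zero_mul, one_mul]
    rw [Finset.sum_ite_eq, if_pos (Finset.mem_image_of_mem _ (Finset.mem_univ _))]

lemma hd_congr {φ ψ : Cls F → ℂ} (c1 c2 : Cls F) (h : ∀ c, c.dim = c1.dim + c2.dim → φ c = ψ c) :
    hd φ c1 c2 = hd ψ c1 c2 := by
  obtain ⟨s, w, hs, hw⟩ := hd_eval c1 c2
  rw [hw, hw]
  exact Finset.sum_congr rfl fun p hp => by rw [h p (hs p hp)]

lemma hd_sum {ι : Type*} (s : Finset ι) (w : ι → ℂ) (φ : ι → Cls F → ℂ) (c1 c2 : Cls F) :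
    hd (fun c => ∑ i ∈ s, w i * φ i c) c1 c2 = ∑ i ∈ s, w i * hd (φ i) c1 c2 := by
  obtain ⟨t, v, hs, hw⟩ := hd_eval c1 c2
  simp_rw [hw, Finset.mul_sum]
  rw [Finset.sum_comm]
  exact Finset.sum_congr rfl fun _ _ => Finset.sum_congr rfl fun _ _ => by ring

lemma hd_zero_right (φ : Cls F → ℂ) (c z : Cls F) (hz : z.dim = 0) : hd φ c z = φ c := by
  induction c using cl_ind with | h V f
  induction z using cl_ind with | h V' f'
  have := Module.finrank_zero_iff.1 hz
  rw [hd_cl]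
  have h1 : ∀ h : V' →ₗ[F] V, cl (sext f f' h) = cl f := by
    intro h
    symm
    refine cl_eq (LinearEquiv.ofLinearMap (LinearMap.inl F V V') (LinearMap.fst F V V') ?_ ?_) ?_
    · apply LinearMap.ext; rintro ⟨x, y⟩; ext <;> simp <;> exact Subsingleton.elim _ _
    · ext x; simp
    · intro x; simp
  simp [h1]
lemma hd_zero_left (φ : Cls F → ℂ) (c z : Cls F) (hz : z.dim = 0) : hd φ z c = φ c := by
  induction c using cl_ind with | h V f
  induction z using cl_ind with | h V' f'
  have := Module.finrank_zero_iff.1 hz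
  rw [hd_cl]
  have h1 : ∀ h : V →ₗ[F] V', cl (sext f' f h) = cl f := by
    intro h
    symm
    refine cl_eq (LinearEquiv.ofLinearMap (LinearMap.inr F V' V) (LinearMap.snd F V' V) ?_ ?_) ?_
    · apply LinearMap.ext; rintro ⟨x, y⟩; ext <;> simp <;> exact Subsingleton.elim _ _
    · ext x; simp
    · intro x; ext <;> simp; exact Subsingleton.elim _ _
  simp [h1]

lemma avg_surj {A B : Type} [AddGroup A] [AddGroup B] [Fintype A] [Fintype B] (L : A →+ B)
    (hL : Function.Surjective L) (G : B → ℂ) :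
    (Nat.card B : ℂ) * ∑ a, G (L a) = Nat.card A * ∑ b, G b := by
  have h1 : ∀ b, (Finset.univ.filter fun a => L a = b).card =
      (Finset.univ.filter fun a => L a = 0).card := fun b =>
    AddMonoidHom.card_fiber_eq_of_mem_range L (hL b) (hL 0)
  have h2 : Nat.card A = Nat.card B * (Finset.univ.filter fun a => L a = 0).card := by
    rw [Nat.card_eq_fintype_card, Nat.card_eq_fintype_card, ← Finset.card_univ,
      Finset.card_eq_sum_card_fiberwise (f := L) (t := Finset.univ) (by simp)]
    simp_rw [h1]
    simp
  have h3 : ∑ a, G (L a) = ∑ b, ((Finset.univ.filter fun a => L a = 0).card : ℂ) * G b := by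
    rw [← Finset.sum_fiberwise (s := Finset.univ) (g := L)]
    refine Finset.sum_congr rfl fun b _ => ?_
    rw [← h1 b, ← nsmul_eq_mul, ← Finset.sum_const]
    refine Finset.sum_congr rfl fun a ha => ?_
    rw [(Finset.mem_filter.1 ha).2]
  rw [h3, h2, ← Finset.mul_sum]
  push_cast; ring

section L4
variable {V1 V2 : Type} [AddCommGroup V1] [Module F V1] [Finite V1]
  [AddCommGroup V2] [Module F V2] [Finite V2]

def shear (s : V2 →ₗ[F] V1) : (V1 × V2) ≃ₗ[F] (V1 × V2) :=
  LinearEquiv.ofLinearMap ((LinearMap.fst F V1 V2 + s.comp (LinearMap.snd F V1 V2)).prod (LinearMap.snd F V1 V2))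
    ((LinearMap.fst F V1 V2 - s.comp (LinearMap.snd F V1 V2)).prod (LinearMap.snd F V1 V2))
    (by ext <;> simp) (by ext <;> simp)

@[simp] lemma shear_apply (s : V2 →ₗ[F] V1) (x : V1 × V2) : shear s x = (x.1 + s x.2, x.2) := rfl

def tw (s : V2 →ₗ[F] V1) (W1 : Submodule F V1) (W2 : Submodule F V2) : Submodule F (V1 × V2) :=
  (W1.prod W2).map (shear s : (V1 × V2) →ₗ[F] (V1 × V2))

lemma mem_tw (s : V2 →ₗ[F] V1) (W1 : Submodule F V1) (W2 : Submodule F V2) (x : V1 × V2) :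
    x ∈ tw s W1 W2 ↔ x.2 ∈ W2 ∧ x.1 - s x.2 ∈ W1 := by
  constructor
  · rintro ⟨y, hy, rfl⟩
    simp only [SetLike.mem_coe, Submodule.mem_prod] at hy
    simp [hy]
  · rintro ⟨h1, h2⟩
    exact ⟨(x.1 - s x.2, x.2), ⟨h2, h1⟩, by ext <;> simp⟩

lemma tw_comap (s : V2 →ₗ[F] V1) (W1 : Submodule F V1) (W2 : Submodule F V2) :
    (tw s W1 W2).comap (LinearMap.inl F V1 V2) = W1 := by
  ext x; simp [mem_tw]
lemma tw_map (s : V2 →ₗ[F] V1) (W1 : Submodule F V1) (W2 : Submodule F V2) :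
    (tw s W1 W2).map (LinearMap.snd F V1 V2) = W2 := by
  ext x
  constructor
  · rintro ⟨y, hy, rfl⟩; exact ((mem_tw _ _ _ _).1 hy).1
  · intro hx; exact ⟨(s x, x), (mem_tw _ _ _ _).2 ⟨hx, by simp⟩, rfl⟩

lemma tw_eq_iff (s s' : V2 →ₗ[F] V1) (W1 : Submodule F V1) (W2 : Submodule F V2) :
    tw s' W1 W2 = tw s W1 W2 ↔ s' - s ∈ Submodule.compatibleMaps W2 W1 := by
  constructor
  · intro h x hx
    have : (s' x, x) ∈ tw s W1 W2 := by
      rw [← h]; exact (mem_tw _ _ _ _).2 ⟨hx, by simp⟩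
    exact ((mem_tw _ _ _ _).1 this).2
  · intro h
    ext x
    rw [mem_tw, mem_tw]
    refine and_congr_right fun hx => ?_
    have h1 : s' x.2 - s x.2 ∈ W1 := h hx
    constructor
    · intro h2; have := add_mem h2 h1; convert this using 1; abel
    · intro h2; have := sub_mem h2 h1; convert this using 1; abel

lemma exists_tw (W : Submodule F (V1 × V2)) :
    ∃ s : V2 →ₗ[F] V1, tw s (W.comap (LinearMap.inl F V1 V2)) (W.map (LinearMap.snd F V1 V2)) = W := by
  obtain ⟨g, hg⟩ := ((LinearMap.snd F V1 V2).comp W.subtype).rangeRestrict.exists_rightInverse_of_surjective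
    (LinearMap.range_rangeRestrict _)
  have hr : LinearMap.range ((LinearMap.snd F V1 V2).comp W.subtype) = W.map (LinearMap.snd F V1 V2) := by
    rw [LinearMap.range_comp, Submodule.range_subtype]
  obtain ⟨s, hs⟩ := LinearMap.exists_extend ((LinearMap.fst F V1 V2).comp (W.subtype.comp g))
  have key : ∀ x ∈ W.map (LinearMap.snd F V1 V2), (s x, x) ∈ W := by
    intro x hx
    rw [← hr] at hx
    have h1 := LinearMap.congr_fun hs ⟨x, hx⟩
    have h2 := congrArg Subtype.val (LinearMap.congr_fun hg ⟨x, hx⟩)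
    simp at h1 h2
    have h3 : ((g ⟨x, hx⟩ : W) : V1 × V2) = (s x, x) := Prod.ext h1.symm h2
    rw [← h3]; exact (g ⟨x, hx⟩).2
  refine ⟨s, ?_⟩
  ext x
  rw [mem_tw]
  constructor
  · rintro ⟨h1, h2⟩
    have := add_mem (key _ h1) h2
    simpa using this
  · intro hx
    have h1 : x.2 ∈ W.map (LinearMap.snd F V1 V2) := ⟨x, hx, rfl⟩
    refine ⟨h1, ?_⟩
    have := sub_mem hx (key _ h1)
    rw [Submodule.mem_comap]
    convert this using 1
    ext <;> simp

lemma card_fib (W1 : Submodule F V1) (W2 : Submodule F V2) :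
    (Finset.univ.filter fun W : Submodule F (V1 × V2) =>
      (W.comap (LinearMap.inl F V1 V2), W.map (LinearMap.snd F V1 V2)) = (W1, W2)).card *
      Nat.card (Submodule.compatibleMaps W2 W1) = Nat.card (V2 →ₗ[F] V1) := by
  rw [Nat.card_eq_fintype_card (α := V2 →ₗ[F] V1), ← Finset.card_univ,
    Finset.card_eq_sum_card_fiberwise (f := fun s => tw s W1 W2)
      (t := Finset.univ.filter fun W : Submodule F (V1 × V2) =>
      (W.comap (LinearMap.inl F V1 V2), W.map (LinearMap.snd F V1 V2)) = (W1, W2))]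
  · rw [← smul_eq_mul, ← Finset.sum_const]
    refine Finset.sum_congr rfl fun W hW => ?_
    have hW := (Finset.mem_filter.1 hW).2
    rw [Prod.mk.injEq] at hW
    obtain ⟨s, hs⟩ := exists_tw W
    rw [hW.1, hW.2] at hs
    rw [← hs]
    simp_rw [tw_eq_iff]
    rw [Nat.card_eq_fintype_card, ← Finset.card_univ]
    refine Finset.card_bij (fun a _ => a.1 + s) (by simp) ?_ ?_
    · intro a _ b _ h; exact Subtype.ext (add_right_cancel h)
    · intro b hb
      exact ⟨⟨b - s, (Finset.mem_filter.1 hb).2⟩, Finset.mem_univ _, by simp⟩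
  · intro s _
    simp [tw_comap, tw_map]

lemma sum_subs (Ξ : Submodule F (V1 × V2) → ℂ)
    (h : ∀ (s : V2 →ₗ[F] V1) W, Ξ (W.map (shear s : (V1 × V2) →ₗ[F] (V1 × V2))) = Ξ W) :
    (Nat.card (V2 →ₗ[F] V1) : ℂ)⁻¹ * ∑ W, Ξ W = ∑ W1 : Submodule F V1, ∑ W2 : Submodule F V2,
      (Nat.card (Submodule.compatibleMaps W2 W1) : ℂ)⁻¹ * Ξ (W1.prod W2) := by
  rw [← Fintype.sum_prod_type', ← Finset.sum_fiberwise (s := Finset.univ)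
    (g := fun W : Submodule F (V1 × V2) => (W.comap (LinearMap.inl F V1 V2), W.map (LinearMap.snd F V1 V2))),
    Finset.mul_sum]
  refine Finset.sum_congr rfl ?_
  rintro ⟨W1, W2⟩ _
  have h1 : ∀ W ∈ (Finset.univ.filter fun W : Submodule F (V1 × V2) =>
      (W.comap (LinearMap.inl F V1 V2), W.map (LinearMap.snd F V1 V2)) = (W1, W2)), Ξ W = Ξ (W1.prod W2) := by
    intro W hW
    have hW := (Finset.mem_filter.1 hW).2
    rw [Prod.mk.injEq] at hW
    obtain ⟨s, hs⟩ := exists_tw W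
    rw [hW.1, hW.2] at hs
    rw [← hs]; exact h _ _
  rw [Finset.sum_congr rfl h1, Finset.sum_const, nsmul_eq_mul, ← card_fib W1 W2, ← mul_assoc]
  congr 1
  have h2 : (Nat.card (Submodule.compatibleMaps W2 W1) : ℂ) ≠ 0 := by exact_mod_cast Nat.card_pos.ne'
  have h3 : (Nat.card (V2 →ₗ[F] V1) : ℂ) ≠ 0 := by exact_mod_cast Nat.card_pos.ne'
  rw [← card_fib W1 W2] at h3
  push_cast at h3 ⊢
  have := left_ne_zero_of_mul h3
  field_simp

lemma isInv_prod {f1 : V1 →ₗ[F] V1} {f2 : V2 →ₗ[F] V2} {h : V2 →ₗ[F] V1} {W1 : Submodule F V1}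
    {W2 : Submodule F V2} : IsInv (sext f1 f2 h) (W1.prod W2) ↔
      IsInv f1 W1 ∧ IsInv f2 W2 ∧ h ∈ Submodule.compatibleMaps W2 W1 := by
  constructor
  · intro hh
    refine ⟨fun x hx => ?_, fun x hx => ?_, fun x hx => ?_⟩
    · have := hh (show (x, (0 : V2)) ∈ W1.prod W2 from ⟨hx, zero_mem _⟩)
      have := this.1
      simpa using this
    · have := hh (show ((0 : V1), x) ∈ W1.prod W2 from ⟨zero_mem _, hx⟩)
      exact this.2
    · have := hh (show ((0 : V1), x) ∈ W1.prod W2 from ⟨zero_mem _, hx⟩)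
      have := this.1
      simpa using this
  · rintro ⟨h1, h2, h3⟩ x ⟨hx1, hx2⟩
    exact ⟨add_mem (h1 hx1) (h3 hx2), h2 hx2⟩

def resE (W1 : Submodule F V1) (W2 : Submodule F V2) :
    Submodule.compatibleMaps W2 W1 →+ (W2 →ₗ[F] W1) × ((V2 ⧸ W2) →ₗ[F] (V1 ⧸ W1)) where
  toFun h := (h.1.restrict h.2, W2.mapQ W1 h.1 h.2)
  map_zero' := by
    ext1
    · rfl
    · ext x; rfl
  map_add' a b := by
    ext1
    · rfl
    · ext x; rfl

lemma resE_surj (W1 : Submodule F V1) (W2 : Submodule F V2) : Function.Surjective (resE W1 W2) := by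
  rintro ⟨α, β⟩
  obtain ⟨π, hπ⟩ := W2.subtype.exists_leftInverse_of_injective (by simp)
  obtain ⟨σ, hσ⟩ := W1.mkQ.exists_rightInverse_of_surjective (by simp)
  have hπ' : ∀ x : W2, π x = x := fun x => LinearMap.congr_fun hπ x
  have hσ' : ∀ x, W1.mkQ (σ x) = x := fun x => LinearMap.congr_fun hσ x
  have h0 : ∀ x : W2, W2.mkQ (x : V2) = 0 := fun x => by simp
  let h : V2 →ₗ[F] V1 := W1.subtype.comp (α.comp π) + σ.comp (β.comp W2.mkQ)
  have key : ∀ x : W2, h x = α x := by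
    intro x
    simp only [h, LinearMap.add_apply, LinearMap.comp_apply, hπ', h0]
    simp
  have key2 : ∀ x : V2, W1.mkQ (h x) = β (W2.mkQ x) := by
    intro x
    simp only [h, LinearMap.add_apply, LinearMap.comp_apply, map_add, hσ']
    simp
  refine ⟨⟨h, fun x hx => ?_⟩, ?_⟩
  · have := key ⟨x, hx⟩
    simp only at this
    rw [Submodule.mem_comap, this]; exact (α _).2
  · refine Prod.ext ?_ ?_
    · ext x; exact key x
    · ext x; exact key2 x

lemma term_prod (x y : Cls F → ℂ) {f1 : V1 →ₗ[F] V1} {f2 : V2 →ₗ[F] V2} {W1 : Submodule F V1}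
    {W2 : Submodule F V2} (h1 : IsInv f1 W1) (h2 : IsInv f2 W2) (h : Submodule.compatibleMaps W2 W1) :
    cR (sext f1 f2 h.1) (W1.prod W2) = cl (sext (f1.restrict h1) (f2.restrict h2) (resE W1 W2 h).1) ∧
    cQ (sext f1 f2 h.1) (W1.prod W2) = cl (sext (W1.mapQ W1 f1 h1) (W2.mapQ W2 f2 h2) (resE W1 W2 h).2) := by
  have hi := isInv_prod.2 ⟨h1, h2, h.2⟩
  constructor
  · refine cR_eq hi (W1.subtype.prodMap W2.subtype) ?_ ?_ ?_
    · exact W1.injective_subtype.prodMap W2.injective_subtype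
    · rw [LinearMap.range_prodMap]; simp
    · intro x; rfl
  · refine cQ_eq hi (W1.mkQ.prodMap W2.mkQ) ?_ ?_ ?_
    · exact W1.mkQ_surjective.prodMap W2.mkQ_surjective
    · rw [LinearMap.ker_prodMap]; simp
    · intro x
      ext1
      · simp [resE]; rfl
      · simp; rfl

lemma hd_mul (x y : Cls F → ℂ) (c1 c2 : Cls F) :
    hd (fun c => hm (fun a b => x a * y b) c) c1 c2 =
      hm (fun a1 b1 => hm (fun a2 b2 => hd x a1 a2 * hd y b1 b2) c2) c1 := by
  induction c1 using cl_ind with | h V1 f1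
  induction c2 using cl_ind with | h V2 f2
  rw [hd_cl]
  simp_rw [hm_cl]
  rw [Finset.sum_comm, sum_subs]
  · refine Finset.sum_congr rfl fun W1 _ => ?_
    by_cases h1 : IsInv f1 W1
    swap
    · rw [if_neg h1]
      refine Finset.sum_eq_zero fun W2 _ => ?_
      rw [Finset.sum_eq_zero, mul_zero]
      intro h _
      rw [if_neg (fun hh => h1 (isInv_prod.1 hh).1)]
    rw [if_pos h1]
    refine Finset.sum_congr rfl fun W2 _ => ?_
    by_cases h2 : IsInv f2 W2
    swap
    · rw [if_neg h2]
      rw [Finset.sum_eq_zero, mul_zero]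
      intro h _
      rw [if_neg (fun hh => h2 (isInv_prod.1 hh).2.1)]
    rw [if_pos h2]
    simp_rw [isInv_prod, and_iff_right h1, and_iff_right h2]
    rw [sum_ite_sub (fun h => h ∈ Submodule.compatibleMaps W2 W1)]
    simp_rw [term_prod x y h1 h2]
    have h3 := avg_surj (resE W1 W2) (resE_surj W1 W2) (fun p =>
      x (cl (sext (f1.restrict h1) (f2.restrict h2) p.1)) *
        y (cl (sext (W1.mapQ W1 f1 h1) (W2.mapQ W2 f2 h2) p.2)))
    have h4 : (Nat.card (Submodule.compatibleMaps W2 W1) : ℂ) ≠ 0 := by exact_mod_cast Nat.card_pos.ne'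
    have h5 : (Nat.card ((W2 →ₗ[F] W1) × ((V2 ⧸ W2) →ₗ[F] (V1 ⧸ W1))) : ℂ) ≠ 0 := by
      exact_mod_cast Nat.card_pos.ne'
    rw [inv_mul_eq_iff_eq_mul₀ h4]
    apply mul_left_cancel₀ h5
    refine h3.trans ?_
    rw [mul_left_comm]
    congr 1
    rw [cR_def h1, cR_def h2, cQ_def h1, cQ_def h2, hd_cl, hd_cl, Fintype.sum_prod_type,
      Nat.card_prod]
    rw [Nat.card_prod] at h5
    push_cast at h5 ⊢
    simp_rw [← Finset.mul_sum, ← Finset.sum_mul]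
    have h6 := left_ne_zero_of_mul h5
    have h7 := right_ne_zero_of_mul h5
    field_simp
  · intro s W
    let E : (V2 →ₗ[F] V1) ≃ (V2 →ₗ[F] V1) := Equiv.addRight (s.comp f2 - f1.comp s)
    symm
    refine Fintype.sum_equiv E _ _ fun h => ?_
    refine term_map (fun a b => x a * y b) (shear s) (fun v => ?_) W
    ext
    · simp [E]; abel
    · simp [E]
end L4
end PartB2

set_option linter.unusedSectionVars false
section PartB3
attribute [local instance 10] Fintype.ofFinite
attribute [local instance] Classical.propDecidable
variable {F : Type} [Field F]

noncomputable def SN : ℕ → (Cls F → ℂ) → Cls F → ℂ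
  | 0, φ, c => if c.dim = 0 then φ c else 0
  | n + 1, φ, c => if c.dim = 0 then φ c else
      - hm (fun a b => if b.dim = 0 then 0 else SN n (fun x => hd φ x b) a) c

noncomputable def Sf (φ : Cls F → ℂ) (c : Cls F) : ℂ := SN c.dim φ c

lemma SN_succ (n : ℕ) : ∀ (φ : Cls F → ℂ) (c : Cls F), c.dim ≤ n → SN (n + 1) φ c = SN n φ c := by
  induction n with
  | zero =>
    intro φ c hc
    have : c.dim = 0 := by omega
    simp [SN, this]
  | succ n ih =>
    intro φ c hc
    rw [SN, SN]
    split_ifs with h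
    · rfl
    · congr 1
      refine hm_congr' c fun a b hab => ?_
      split_ifs with hb
      · rfl
      · exact ih _ _ (by omega)

lemma SN_eq (n : ℕ) (φ : Cls F → ℂ) (c : Cls F) (h : c.dim ≤ n) : SN n φ c = Sf φ c := by
  induction n, h using Nat.le_induction with
  | base => rfl
  | succ n hn ih => rw [SN_succ n φ c hn, ih]

lemma Sf_zero (φ : Cls F → ℂ) (c : Cls F) (h : c.dim = 0) : Sf φ c = φ c := by
  rw [Sf, h, SN, if_pos h]

lemma Sf_rec (φ : Cls F → ℂ) (c : Cls F) (h : c.dim ≠ 0) : Sf φ c =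
    - hm (fun a b => if b.dim = 0 then 0 else Sf (fun x => hd φ x b) a) c := by
  obtain ⟨n, hn⟩ := Nat.exists_eq_succ_of_ne_zero h
  rw [Sf, hn, SN, if_neg h]
  congr 1
  refine hm_congr' c fun a b hab => ?_
  split_ifs with hb
  · rfl
  · exact SN_eq _ _ _ (by omega)

lemma Sf_congr {φ ψ : Cls F → ℂ} (c : Cls F) (h : ∀ c', c'.dim = c.dim → φ c' = ψ c') :
    Sf φ c = Sf ψ c := by
  induction hn : c.dim using Nat.strong_induction_on generalizing φ ψ c with
  | h n ih =>
    by_cases hc : c.dim = 0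
    · rw [Sf_zero _ _ hc, Sf_zero _ _ hc, h _ rfl]
    · rw [Sf_rec _ _ hc, Sf_rec _ _ hc]
      congr 1
      refine hm_congr' c fun a b hab => ?_
      split_ifs with hb
      · rfl
      · refine ih a.dim (by omega) a (fun c' hc' => ?_) rfl
        exact hd_congr _ _ fun c'' hc'' => h _ (by omega)

lemma Sf_sum {ι : Type*} (s : Finset ι) (w : ι → ℂ) (φ : ι → Cls F → ℂ) (c : Cls F) :
    Sf (fun c => ∑ i ∈ s, w i * φ i c) c = ∑ i ∈ s, w i * Sf (φ i) c := by
  induction hn : c.dim using Nat.strong_induction_on generalizing φ c with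
  | h n ih =>
    by_cases hc : c.dim = 0
    · simp_rw [Sf_zero _ _ hc]
    · simp_rw [Sf_rec _ _ hc, hd_sum, mul_neg]
      rw [Finset.sum_neg_distrib]
      congr 1
      simp_rw [← hm_smul]
      rw [← hm_sum]
      refine hm_congr' c fun a b hab => ?_
      split_ifs with hb
      · simp
      · exact ih a.dim (by omega) _ a rfl

lemma Sf_main (φ : Cls F → ℂ) (c : Cls F) :
    hm (fun a b => Sf (fun x => hd φ x b) a) c = if c.dim = 0 then φ c else 0 := by
  have h1 : hm (fun a b => Sf (fun x => hd φ x b) a) c =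
      hm (fun a b => if b.dim = 0 then Sf φ a else 0) c +
      hm (fun a b => if b.dim = 0 then 0 else Sf (fun x => hd φ x b) a) c := by
    rw [← hm_add]
    refine hm_congr' c fun a b hab => ?_
    split_ifs with hb
    · rw [add_zero]
      exact Sf_congr a fun c' _ => hd_zero_right _ _ _ hb
    · simp
  rw [h1, hm_unit_right]
  split_ifs with hc
  · rw [Sf_zero _ _ hc, hm_congr' (Φ' := fun _ _ => 0 * 0) c, hm_smul]
    · simp
    · intro a b hab
      rw [if_pos (by omega)]; simp
  · rw [Sf_rec _ _ hc]; ring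

noncomputable def zc : Cls F := cl (0 : PUnit →ₗ[F] PUnit)
lemma dim_zc : (zc : Cls F).dim = 0 := by
  unfold zc; rw [dim_cl]; exact Module.finrank_zero_of_subsingleton

lemma Sf_mul (x y : Cls F → ℂ) (c : Cls F) :
    Sf (fun c => hm (fun a b => x a * y b) c) c = hm (fun b a => Sf y b * Sf x a) c := by
  induction hn : c.dim using Nat.strong_induction_on generalizing x y c with
  | h n ih =>
  by_cases hc : c.dim = 0
  · rw [Sf_zero _ _ hc]
    refine hm_congr' c fun a b hab => ?_
    rw [Sf_zero _ _ (by omega), Sf_zero _ _ (by omega), cls_dim0 (c := a) (c' := b) (by omega) (by omega), mul_comm]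
  let Θ : Cls F → Cls F → ℂ := fun a b =>
    hm (fun a2 b2 => hm (fun β α => Sf (fun z => hd y z b2) β * Sf (fun z => hd x z a2) α) a) b
  have c1 : ∀ a b : Cls F, a.dim < c.dim → Sf (fun z => hd (fun c => hm (fun a b => x a * y b) c) z b) a = Θ a b := by
    intro a b hab
    simp_rw [hd_mul]
    simp_rw [fun z => hm_swap z b (fun a1 b1 a2 b2 => hd x a1 a2 * hd y b1 b2)]
    obtain ⟨s, w, -, hs⟩ := hm_eval b
    simp only [Θ]
    simp_rw [hs]
    rw [Sf_sum]
    refine Finset.sum_congr rfl fun p _ => ?_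
    rw [ih a.dim (by omega) _ _ a rfl]
  have c2 : hm Θ c = 0 := by
    simp only [Θ]
    simp_rw [fun a b => hm_swap b a (fun a2 b2 β α => Sf (fun z => hd y z b2) β * Sf (fun z => hd x z a2) α)]
    rw [hm_assoc (fun β α b => hm (fun a2 b2 => Sf (fun z => hd y z b2) β * Sf (fun z => hd x z a2) α) b)]
    have h1 : ∀ β e : Cls F, hm (fun α b => hm (fun a2 b2 => Sf (fun z => hd y z b2) β * Sf (fun z => hd x z a2) α) b) e
        = x zc * Sf (fun z => hd y z e) β := by
      intro β e
      rw [← hm_assoc (fun α a2 b2 => Sf (fun z => hd y z b2) β * Sf (fun z => hd x z a2) α)]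
      simp_rw [hm_smul, Sf_main]
      rw [← hm_unit_left (fun e => x zc * Sf (fun z => hd y z e) β) e]
      refine hm_congr' e fun a b hab => ?_
      split_ifs with h
      · rw [cls_dim0 h dim_zc, mul_comm]
      · simp
    simp_rw [h1]
    rw [hm_smul, Sf_main, if_neg hc, mul_zero]
  rw [Sf_rec _ _ hc]
  have c3 : hm (fun a b => if b.dim = 0 then 0 else
      Sf (fun z => hd (fun c => hm (fun a b => x a * y b) c) z b) a) c =
      hm Θ c - hm (fun a b => if b.dim = 0 then hm (fun b a => Sf y b * Sf x a) a else 0) c := by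
    rw [← hm_sub]
    refine hm_congr' c fun a b hab => ?_
    split_ifs with hb
    · symm
      rw [sub_eq_zero]
      simp only [Θ]
      rw [← hm_unit_left (fun _ => hm (fun b a => Sf y b * Sf x a) a) b]
      refine hm_congr' b fun a2 b2 h2 => ?_
      rw [if_pos (by omega)]
      congr 1
      ext β α
      congr 1
      · exact Sf_congr _ fun c' _ => hd_zero_right _ _ _ (by omega)
      · exact Sf_congr _ fun c' _ => hd_zero_right _ _ _ (by omega)
    · rw [c1 a b (by omega), sub_zero]
  rw [c3, c2, hm_unit_right]
  ring
end PartB3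

set_option linter.unusedSectionVars false
section PartB4
attribute [local instance 10] Fintype.ofFinite
attribute [local instance] Classical.propDecidable
open ComplexConjugate
variable {F : Type} [Field F] [Finite F]

instance {V V' : Type} [AddCommGroup V] [Module F V] [Finite V]
  [AddCommGroup V'] [Module F V'] [Finite V'] : Finite (V ≃ₗ[F] V') :=
  Finite.of_injective (fun f => (f : V → V')) DFunLike.coe_injective

noncomputable def av (n : ℕ) (g : Cls F → ℂ) : ℂ :=
  (Nat.card ((Fin n → F) ≃ₗ[F] (Fin n → F)) : ℂ)⁻¹ * ∑ A : (Fin n → F) →ₗ[F] (Fin n → F), g (cl A)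

lemma av_congr (n : ℕ) {g g' : Cls F → ℂ} (h : ∀ c, c.dim = n → g c = g' c) : av n g = av n g' := by
  unfold av
  congr 1
  exact Finset.sum_congr rfl fun A _ => h _ (by simp)
lemma av_sub (n : ℕ) (g g' : Cls F → ℂ) : av n (fun c => g c - g' c) = av n g - av n g' := by
  unfold av; rw [Finset.sum_sub_distrib, mul_sub]
lemma av_neg (n : ℕ) (g : Cls F → ℂ) : av n (fun c => - g c) = - av n g := by
  unfold av; rw [Finset.sum_neg_distrib, mul_neg]
lemma av_zero (n : ℕ) : av n (fun _ : Cls F => (0:ℂ)) = 0 := by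
  unfold av; simp
lemma exists_rep (c : Cls F) : ∃ A : (Fin c.dim → F) →ₗ[F] (Fin c.dim → F), cl A = c := by
  induction c using cl_ind with | h V f
  rw [dim_cl]
  have : Module.Finite F V := inferInstance
  let e : V ≃ₗ[F] (Fin (Module.finrank F V) → F) := LinearEquiv.ofFinrankEq _ _ (by simp)
  refine ⟨e.conj f, ?_⟩
  symm
  exact cl_eq e fun x => by simp [LinearEquiv.conj_apply]

lemma av_delta (a : Cls F) : ∃ w : ℂ, w ≠ 0 ∧ ∀ g : Cls F → ℂ, av a.dim (fun c => if c = a then g c else 0) = w * g a := by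
  refine ⟨(Nat.card ((Fin a.dim → F) ≃ₗ[F] (Fin a.dim → F)) : ℂ)⁻¹ *
    ((Finset.univ.filter fun A : (Fin a.dim → F) →ₗ[F] (Fin a.dim → F) => cl A = a).card), ?_, ?_⟩
  · refine mul_ne_zero (inv_ne_zero (by exact_mod_cast Nat.card_pos.ne')) ?_
    obtain ⟨A, hA⟩ := exists_rep a
    have : 0 < (Finset.univ.filter fun A : (Fin a.dim → F) →ₗ[F] (Fin a.dim → F) => cl A = a).card :=
      Finset.card_pos.2 ⟨A, by simp [hA]⟩
    exact_mod_cast this.ne'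
  · intro g
    unfold av
    rw [mul_assoc]
    congr 1
    rw [← Finset.sum_filter, ← nsmul_eq_mul, ← Finset.sum_const]
    exact Finset.sum_congr rfl fun A hA => by rw [(Finset.mem_filter.1 hA).2]

section adj
variable {V : Type} [AddCommGroup V] [Module F V] [Finite V]
  {V1 V2 : Type} [AddCommGroup V1] [Module F V1] [Finite V1]
  [AddCommGroup V2] [Module F V2] [Finite V2]

lemma exists_split (W : Submodule F V) {k l : ℕ} (hk : Module.finrank F W = k)
    (hl : k + l = Module.finrank F V) : ∃ e : ((Fin k → F) × (Fin l → F)) ≃ₗ[F] V,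
      (LinearMap.range (LinearMap.inl F (Fin k → F) (Fin l → F))).map (e : _ →ₗ[F] V) = W := by
  obtain ⟨W', hW'⟩ := W.exists_isCompl
  have h1 := Submodule.finrank_add_eq_of_isCompl hW'
  let e1 : (Fin k → F) ≃ₗ[F] W := LinearEquiv.ofFinrankEq _ _ (by simp [hk])
  let e2 : (Fin l → F) ≃ₗ[F] W' := LinearEquiv.ofFinrankEq _ _ (by simp; omega)
  refine ⟨(e1.prodCongr e2).trans (Submodule.prodEquivOfIsCompl W W' hW'), ?_⟩
  ext x
  constructor
  · rintro ⟨_, ⟨y, rfl⟩, rfl⟩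
    simp
  · intro hx
    refine ⟨_, ⟨e1.symm ⟨x, hx⟩, rfl⟩, ?_⟩
    simp

lemma card_stab : Nat.card {g : (V1 × V2) ≃ₗ[F] (V1 × V2) //
      (LinearMap.range (LinearMap.inl F V1 V2)).map (g : _ →ₗ[F] (V1 × V2)) = LinearMap.range (LinearMap.inl F V1 V2)} =
    Nat.card (V1 ≃ₗ[F] V1) * Nat.card (V2 ≃ₗ[F] V2) * Nat.card (V2 →ₗ[F] V1) := by
  rw [← Nat.card_prod, ← Nat.card_prod]
  symm
  have hmem : ∀ x : V1 × V2, x ∈ LinearMap.range (LinearMap.inl F V1 V2) ↔ x.2 = 0 := by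
    intro x
    constructor
    · rintro ⟨y, rfl⟩; rfl
    · intro h; exact ⟨x.1, Prod.ext rfl h.symm⟩
  refine Nat.card_eq_of_bijective (fun p => ⟨(p.1.1.prodCongr p.1.2).trans (shear p.2), ?_⟩) ⟨?_, ?_⟩
  · ext x
    constructor
    · rintro ⟨_, ⟨y, rfl⟩, rfl⟩
      simp
    · rintro ⟨y, rfl⟩
      refine ⟨_, ⟨p.1.1.symm y, rfl⟩, ?_⟩
      simp
  · rintro ⟨⟨a, d⟩, h⟩ ⟨⟨a', d'⟩, h'⟩ hh
    have hh' : ∀ x : V1 × V2, (a x.1 + h (d x.2), d x.2) = (a' x.1 + h' (d' x.2), d' x.2) :=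
      fun x => LinearEquiv.congr_fun (congrArg Subtype.val hh) x
    have hd : d = d' := by
      ext x; exact (Prod.ext_iff.1 (hh' (0, x))).2
    subst hd
    have ha : a = a' := by
      ext x; simpa using (Prod.ext_iff.1 (hh' (x, 0))).1
    have hh : h = h' := by
      ext x; simpa using (Prod.ext_iff.1 (hh' (0, d.symm x))).1
    rw [ha, hh]
  · rintro ⟨g, hg⟩
    have hg1 : ∀ x, (g (x, 0)).2 = 0 := by
      intro x
      rw [← hmem, ← hg]
      exact ⟨(x, 0), ⟨x, rfl⟩, rfl⟩
    let a : V1 →ₗ[F] V1 := (LinearMap.fst F V1 V2).comp ((g : _ →ₗ[F] (V1 × V2)).comp (LinearMap.inl F V1 V2))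
    let d : V2 →ₗ[F] V2 := (LinearMap.snd F V1 V2).comp ((g : _ →ₗ[F] (V1 × V2)).comp (LinearMap.inr F V1 V2))
    have ha : ∀ x, g (x, 0) = (a x, 0) := fun x => Prod.ext rfl (hg1 x)
    have hdd : ∀ x, d x = (g (0, x)).2 := fun x => rfl
    have hdec : ∀ x : V1 × V2, g x = g (x.1, 0) + g (0, x.2) := fun x => by rw [← map_add]; simp
    have hai : Function.Injective a := by
      intro x y hxy
      have : g (x, 0) = g (y, 0) := by rw [ha, ha, hxy]
      exact (Prod.ext_iff.1 (g.injective this)).1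
    have hds : Function.Surjective d := by
      intro w
      obtain ⟨x, hx⟩ := g.surjective (0, w)
      refine ⟨x.2, ?_⟩
      rw [hdec, ha] at hx
      have := (Prod.ext_iff.1 hx).2
      rw [hdd]
      simpa using this
    let a' := LinearEquiv.ofBijective a ⟨hai, Finite.surjective_of_injective hai⟩
    let d' := LinearEquiv.ofBijective d ⟨Finite.injective_iff_surjective.2 hds, hds⟩
    have ha' : ∀ x, a' x = a x := fun x => rfl
    have hd' : ∀ x, d' x = d x := fun x => rfl
    refine ⟨((a', d'), ((LinearMap.fst F V1 V2).comp ((g : _ →ₗ[F] (V1 × V2)).comp (LinearMap.inr F V1 V2))).comp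
      (d'.symm : V2 →ₗ[F] V2)), ?_⟩
    apply Subtype.ext
    apply LinearEquiv.ext
    intro x
    rw [hdec, ha]
    ext
    · simp [ha']
    · simp [hd', hdd]

lemma card_equiv_congr (e : V1 ≃ₗ[F] V) : Nat.card (V1 ≃ₗ[F] V) = Nat.card (V ≃ₗ[F] V) :=
  Nat.card_congr ⟨fun g => e.symm.trans g, fun g => e.trans g, fun g => by ext; simp, fun g => by ext; simp⟩

lemma card_subs [inst : Fintype (Submodule F V)] {k l : ℕ} (hl : k + l = Module.finrank F V) :
    (Finset.univ.filter fun W : Submodule F V => Module.finrank F W = k).card *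
      (Nat.card ((Fin k → F) ≃ₗ[F] (Fin k → F)) * Nat.card ((Fin l → F) ≃ₗ[F] (Fin l → F)) *
        Nat.card ((Fin l → F) →ₗ[F] (Fin k → F))) = Nat.card (V ≃ₗ[F] V) := by
  let X := (Fin k → F) × (Fin l → F)
  let W0 : Submodule F X := LinearMap.range (LinearMap.inl F (Fin k → F) (Fin l → F))
  have hW0 : Module.finrank F W0 = k := by
    rw [LinearMap.finrank_range_of_inj LinearMap.inl_injective]; simp
  let e0 : X ≃ₗ[F] V := LinearEquiv.ofFinrankEq _ _ (by simp [X, hl])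
  rw [← card_equiv_congr e0, Nat.card_eq_fintype_card (α := X ≃ₗ[F] V), ← Finset.card_univ,
    Finset.card_eq_sum_card_fiberwise (f := fun g : X ≃ₗ[F] V => W0.map (g : X →ₗ[F] V))
      (t := Finset.univ.filter fun W : Submodule F V => Module.finrank F W = k)]
  · rw [← smul_eq_mul, ← Finset.sum_const]
    refine Finset.sum_congr rfl fun W hW => ?_
    have hW := (Finset.mem_filter.1 hW).2
    obtain ⟨e, he⟩ := exists_split W hW hl
    rw [← card_stab, Nat.card_eq_fintype_card, ← Finset.card_univ]
    refine Finset.card_bij (fun g _ => g.1.trans e) ?_ ?_ ?_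
    · intro g _
      simp only [Finset.mem_filter, Finset.mem_univ, true_and]
      have := g.2
      conv_rhs => rw [← he, ← this]
      rw [← Submodule.map_comp]; rfl
    · intro g _ g' _ h
      apply Subtype.ext; apply LinearEquiv.ext; intro x
      exact e.injective (LinearEquiv.congr_fun h x)
    · intro b hb
      have hb := (Finset.mem_filter.1 hb).2
      refine ⟨⟨b.trans e.symm, ?_⟩, Finset.mem_univ _, by ext <;> simp⟩
      have h1 : ((b.trans e.symm : X ≃ₗ[F] X) : X →ₗ[F] X) = (e.symm : V →ₗ[F] X).comp (b : X →ₗ[F] V) := rfl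
      rw [h1, Submodule.map_comp]
      change Submodule.map _ (Submodule.map _ W0) = W0
      rw [hb, ← he, ← Submodule.map_comp]
      change Submodule.map _ W0 = W0
      convert Submodule.map_id W0
      ext <;> simp
  · intro g _
    simp only [Finset.coe_filter, Finset.mem_univ, true_and, Set.mem_ofPred_eq]
    exact (LinearEquiv.finrank_eq (g.submoduleMap W0)).symm.trans hW0

lemma sum_inv_W0 (Φ : Cls F → Cls F → ℂ) (ψ : Cls F → ℂ) :
    ∑ A : (V1 × V2) →ₗ[F] (V1 × V2), (if IsInv A (LinearMap.range (LinearMap.inl F V1 V2)) then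
      Φ (cR A (LinearMap.range (LinearMap.inl F V1 V2))) (cQ A (LinearMap.range (LinearMap.inl F V1 V2))) else 0) * ψ (cl A) =
    ∑ A2 : V2 →ₗ[F] V2, ∑ A1 : V1 →ₗ[F] V1, ∑ h : V2 →ₗ[F] V1, Φ (cl A1) (cl A2) * ψ (cl (sext A1 A2 h)) := by
  have hmem : ∀ x : V1 × V2, x ∈ LinearMap.range (LinearMap.inl F V1 V2) ↔ x.2 = 0 := by
    intro x
    constructor
    · rintro ⟨y, rfl⟩; rfl
    · intro h; exact ⟨x.1, Prod.ext rfl h.symm⟩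
  have hinv : ∀ (A1 : V1 →ₗ[F] V1) (A2 : V2 →ₗ[F] V2) (h : V2 →ₗ[F] V1),
      IsInv (sext A1 A2 h) (LinearMap.range (LinearMap.inl F V1 V2)) := by
    intro A1 A2 h x hx
    rw [hmem] at hx
    rw [Submodule.mem_comap, hmem]; simp [hx]
  simp_rw [ite_mul, zero_mul]
  rw [sum_ite_sub (fun A => IsInv A (LinearMap.range (LinearMap.inl F V1 V2)))]
  rw [show (∑ A2 : V2 →ₗ[F] V2, ∑ A1 : V1 →ₗ[F] V1, ∑ h : V2 →ₗ[F] V1, Φ (cl A1) (cl A2) * ψ (cl (sext A1 A2 h)))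
    = ∑ p : ((V2 →ₗ[F] V2) × (V1 →ₗ[F] V1)) × (V2 →ₗ[F] V1), Φ (cl p.1.2) (cl p.1.1) *
      ψ (cl (sext p.1.2 p.1.1 p.2)) by simp only [Fintype.sum_prod_type]]
  symm
  let m : ((V2 →ₗ[F] V2) × (V1 →ₗ[F] V1)) × (V2 →ₗ[F] V1) →
    {A : (V1 × V2) →ₗ[F] (V1 × V2) // IsInv A (LinearMap.range (LinearMap.inl F V1 V2))} :=
    fun p => ⟨sext p.1.2 p.1.1 p.2, hinv _ _ _⟩
  have hm : Function.Bijective m := by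
    constructor
    · rintro ⟨⟨d, a⟩, h⟩ ⟨⟨d', a'⟩, h'⟩ hh
      have hh' : ∀ x : V1 × V2, (a x.1 + h x.2, d x.2) = (a' x.1 + h' x.2, d' x.2) :=
        fun x => LinearMap.congr_fun (congrArg Subtype.val hh) x
      have hd : d = d' := by
        ext x; exact (Prod.ext_iff.1 (hh' (0, x))).2
      have ha : a = a' := by
        ext x; simpa using (Prod.ext_iff.1 (hh' (x, 0))).1
      have hh : h = h' := by
        ext x; simpa using (Prod.ext_iff.1 (hh' (0, x))).1
      rw [ha, hh, hd]
    · rintro ⟨A, hA⟩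
      refine ⟨(((LinearMap.snd F V1 V2).comp (A.comp (LinearMap.inr F V1 V2)),
        (LinearMap.fst F V1 V2).comp (A.comp (LinearMap.inl F V1 V2))),
        (LinearMap.fst F V1 V2).comp (A.comp (LinearMap.inr F V1 V2))), ?_⟩
      apply Subtype.ext
      apply LinearMap.ext
      intro x
      have h1 : (A (x.1, 0)).2 = 0 := (hmem _).1 (hA ((hmem (x.1, 0)).2 rfl))
      have h2 : A x = A (x.1, 0) + A (0, x.2) := by rw [← map_add]; simp
      rw [h2]
      ext
      · simp [m]
      · simp [m, h1]
  refine (Fintype.sum_equiv (Equiv.ofBijective m hm) _ _ ?_)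
  rintro ⟨⟨A2, A1⟩, h⟩
  simp only [Equiv.ofBijective_apply, m]
  rw [cR_eq (hinv A1 A2 h) (f' := A1) (LinearMap.inl F V1 V2) LinearMap.inl_injective rfl (fun x => by simp),
    cQ_eq (hinv A1 A2 h) (f' := A2) (LinearMap.snd F V1 V2) LinearMap.snd_surjective
      (by rw [LinearMap.range_inl]) (fun x => by simp)]

lemma sum_inv_transport (Φ : Cls F → Cls F → ℂ) (ψ : Cls F → ℂ) (e : V1 ≃ₗ[F] V) (W : Submodule F V1) :
    ∑ A : V1 →ₗ[F] V1, (if IsInv A W then Φ (cR A W) (cQ A W) else 0) * ψ (cl A) =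
    ∑ A : V →ₗ[F] V, (if IsInv A (W.map (e : V1 →ₗ[F] V)) then
      Φ (cR A (W.map (e : V1 →ₗ[F] V))) (cQ A (W.map (e : V1 →ₗ[F] V))) else 0) * ψ (cl A) := by
  refine Fintype.sum_equiv e.conj.toEquiv _ _ fun A => ?_
  have h : ∀ x, e (A x) = e.conj A (e x) := fun x => by simp [LinearEquiv.conj_apply]
  have := term_map Φ e h W
  rw [this, cl_eq e h]; rfl

end adj

lemma adjoint (n : ℕ) (Φ : Cls F → Cls F → ℂ) (ψ : Cls F → ℂ) :
    av n (fun c => hm Φ c * ψ c) =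
      ∑ p ∈ Finset.HasAntidiagonal.antidiagonal n, av p.2 (fun b => av p.1 (fun a => Φ a b * hd ψ a b)) := by
  conv_lhs => unfold av
  simp_rw [hm_cl, Finset.sum_mul]
  rw [Finset.sum_comm, ← Finset.sum_fiberwise_of_maps_to (t := Finset.HasAntidiagonal.antidiagonal n)
    (g := fun W : Submodule F (Fin n → F) => (Module.finrank F W, Module.finrank F ((Fin n → F) ⧸ W)))]
  · rw [Finset.mul_sum]
    refine Finset.sum_congr rfl ?_
    rintro ⟨k, l⟩ hkl
    rw [Finset.HasAntidiagonal.mem_antidiagonal] at hkl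
    simp only at hkl ⊢
    have hl : k + l = Module.finrank F (Fin n → F) := by simp [hkl]
    have h1 : (Finset.univ.filter fun W : Submodule F (Fin n → F) =>
      (Module.finrank F W, Module.finrank F ((Fin n → F) ⧸ W)) = (k, l)) =
      Finset.univ.filter fun W : Submodule F (Fin n → F) => Module.finrank F W = k := by
      ext W
      simp only [Finset.mem_filter, Finset.mem_univ, true_and, Prod.mk.injEq]
      have := Submodule.finrank_quotient_add_finrank W
      constructor
      · exact fun h => h.1
      · intro h; exact ⟨h, by omega⟩
    rw [h1]
    have h2 : ∀ W ∈ Finset.univ.filter (fun W : Submodule F (Fin n → F) => Module.finrank F W = k),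
      ∑ A : (Fin n → F) →ₗ[F] (Fin n → F), (if IsInv A W then Φ (cR A W) (cQ A W) else 0) * ψ (cl A) =
      (Nat.card ((Fin k → F) ≃ₗ[F] (Fin k → F)) * Nat.card ((Fin l → F) ≃ₗ[F] (Fin l → F)) *
        Nat.card ((Fin l → F) →ₗ[F] (Fin k → F)) : ℕ) * av l (fun b => av k (fun a => Φ a b * hd ψ a b)) := by
      intro W hW
      obtain ⟨e, he⟩ := exists_split W (Finset.mem_filter.1 hW).2 hl
      rw [← he, ← sum_inv_transport, sum_inv_W0]
      unfold av
      simp_rw [hd_cl]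
      have e1 : (Nat.card ((Fin k → F) ≃ₗ[F] (Fin k → F)) : ℂ) ≠ 0 := by exact_mod_cast Nat.card_pos.ne'
      have e2 : (Nat.card ((Fin l → F) ≃ₗ[F] (Fin l → F)) : ℂ) ≠ 0 := by exact_mod_cast Nat.card_pos.ne'
      have e3 : (Nat.card ((Fin l → F) →ₗ[F] (Fin k → F)) : ℂ) ≠ 0 := by exact_mod_cast Nat.card_pos.ne'
      push_cast
      simp_rw [Finset.mul_sum]
      refine Finset.sum_congr rfl fun _ _ => Finset.sum_congr rfl fun _ _ => Finset.sum_congr rfl fun _ _ => ?_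
      field_simp
    rw [Finset.sum_congr rfl h2, Finset.sum_const, nsmul_eq_mul]
    have h3 : (Nat.card ((Fin n → F) ≃ₗ[F] (Fin n → F)) : ℂ) ≠ 0 := by exact_mod_cast Nat.card_pos.ne'
    have h4 : ∀ (a b c : ℕ) (Z : ℂ), a * b = c → (c : ℂ) ≠ 0 → (c : ℂ)⁻¹ * ((a : ℂ) * ((b : ℂ) * Z)) = Z := by
      intro a b c Z h hc
      rw [← mul_assoc (a : ℂ), ← Nat.cast_mul, h, ← mul_assoc, inv_mul_cancel₀ hc, one_mul]
    exact h4 _ _ _ _ (card_subs hl) h3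
  · intro W _
    rw [Finset.HasAntidiagonal.mem_antidiagonal]
    have := Submodule.finrank_quotient_add_finrank W
    simp at this ⊢
    omega

lemma Sf_selfadj (n : ℕ) : ∀ φ ψ : Cls F → ℂ, av n (fun c => Sf φ c * ψ c) = av n (fun c => φ c * Sf ψ c) := by
  induction n using Nat.strong_induction_on with
  | h n ih =>
  intro φ ψ
  by_cases hn : n = 0
  · subst hn
    refine av_congr 0 fun c hc => ?_
    rw [Sf_zero _ _ hc, Sf_zero _ _ hc]
  have h1 : ∀ φ ψ : Cls F → ℂ, av n (fun c => Sf φ c * ψ c) = - ∑ p ∈ Finset.HasAntidiagonal.antidiagonal n,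
      av p.2 (fun b => if b.dim = 0 then 0 else av p.1 (fun a => Sf (fun x => hd φ x b) a * hd ψ a b)) := by
    intro φ ψ
    have : av n (fun c => Sf φ c * ψ c) =
      av n (fun c => - (hm (fun a b => if b.dim = 0 then 0 else Sf (fun x => hd φ x b) a) c * ψ c)) := by
      refine av_congr n fun c hc => ?_
      rw [Sf_rec _ _ (by omega)]; ring
    rw [this, av_neg, adjoint]
    congr 1
    refine Finset.sum_congr rfl fun p _ => av_congr _ fun b _ => ?_
    split_ifs with hb
    · simp [av_zero]
    · rfl
  rw [h1 φ ψ]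
  have h2 : av n (fun c => φ c * Sf ψ c) = av n (fun c => Sf ψ c * φ c) := by
    congr 1; ext c; ring
  rw [h2, h1 ψ φ]
  congr 1
  refine Finset.sum_congr rfl fun p hp => av_congr _ fun b hb => ?_
  rw [Finset.HasAntidiagonal.mem_antidiagonal] at hp
  split_ifs with hb0
  · rfl
  · rw [ih p.1 (by omega)]
    congr 1; ext c; ring

lemma hm_conj (Φ : Cls F → Cls F → ℂ) (c : Cls F) : hm (fun a b => conj (Φ a b)) c = conj (hm Φ c) := by
  induction c using cl_ind with | h V f
  rw [hm_cl, hm_cl, map_sum]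
  refine Finset.sum_congr rfl fun W _ => ?_
  split_ifs <;> simp
lemma hd_conj (φ : Cls F → ℂ) (a b : Cls F) : hd (fun c => conj (φ c)) a b = conj (hd φ a b) := by
  induction a using cl_ind with | h V f
  induction b using cl_ind with | h V' f'
  rw [hd_cl, hd_cl, map_mul, map_sum, map_inv₀, Complex.conj_natCast]
lemma Sf_conj (φ : Cls F → ℂ) (c : Cls F) : Sf (fun c => conj (φ c)) c = conj (Sf φ c) := by
  induction hn : c.dim using Nat.strong_induction_on generalizing φ c with
  | h n ih =>
  by_cases hc : c.dim = 0
  · rw [Sf_zero _ _ hc, Sf_zero _ _ hc]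
  · rw [Sf_rec _ _ hc, Sf_rec _ _ hc, map_neg, ← hm_conj]
    congr 1
    refine hm_congr' c fun a b hab => ?_
    split_ifs with hb
    · simp
    · simp_rw [hd_conj]
      exact ih a.dim (by omega) _ a rfl

lemma Sf_const_zero (c : Cls F) : Sf (fun _ => (0:ℂ)) c = 0 := by
  have := Sf_sum (∅ : Finset ℕ) (fun _ => 0) (fun _ _ => 0) c
  simpa using this
lemma Sf_lin2 (r : ℂ) (φ ψ : Cls F → ℂ) (c : Cls F) :
    Sf (fun c => φ c + r * ψ c) c = Sf φ c + r * Sf ψ c := by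
  have := Sf_sum (Finset.univ : Finset (Fin 2)) ![1, r] ![φ, ψ] c
  simpa using this

lemma Sf_sq (n : ℕ) : ∀ (φ : Cls F → ℂ) (c : Cls F), c.dim = n → Sf (Sf φ) c = φ c := by
  induction n using Nat.strong_induction_on with
  | h n ih =>
  by_cases hn : n = 0
  · subst hn
    intro φ c hc
    rw [Sf_zero _ _ hc, Sf_zero _ _ hc]
  let T : (Cls F → ℂ) → Cls F → ℂ := fun φ c => Sf (Sf φ) c + (-1) * φ c
  have hTadj : ∀ φ ψ : Cls F → ℂ, av n (fun c => T φ c * ψ c) = av n (fun c => φ c * T ψ c) := by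
    intro φ ψ
    have e1 : ∀ φ ψ : Cls F → ℂ, av n (fun c => T φ c * ψ c) =
        av n (fun c => Sf (Sf φ) c * ψ c) - av n (fun c => φ c * ψ c) := by
      intro φ ψ
      rw [← av_sub]; congr 1; ext c; simp only [T]; ring
    have e2 : av n (fun c => φ c * T ψ c) =
        av n (fun c => φ c * Sf (Sf ψ) c) - av n (fun c => φ c * ψ c) := by
      rw [← av_sub]; congr 1; ext c; simp only [T]; ring
    rw [e1, e2, Sf_selfadj, Sf_selfadj]
  have hhd : ∀ (φ : Cls F → ℂ) (a b : Cls F), a.dim ≠ 0 → b.dim ≠ 0 → a.dim + b.dim = n → hd (T φ) a b = 0 := by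
    intro φ a b ha hb hab
    let x : Cls F → ℂ := fun c => if c = a then 1 else 0
    let y : Cls F → ℂ := fun c => if c = b then 1 else 0
    have hxz : ∀ c : Cls F, c.dim = 0 → x c = 0 := fun c hc => if_neg (by rintro rfl; exact ha hc)
    have hyz : ∀ c : Cls F, c.dim = 0 → y c = 0 := fun c hc => if_neg (by rintro rfl; exact hb hc)
    have h1 : ∀ c : Cls F, c.dim = n → T (fun c => hm (fun a b => x a * y b) c) c = 0 := by
      intro c hc
      simp only [T]
      have e1 : Sf (Sf fun c => hm (fun a b => x a * y b) c) c =
          Sf (fun c => hm (fun b a => Sf y b * Sf x a) c) c :=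
        Sf_congr c fun c' _ => Sf_mul x y c'
      rw [e1, Sf_mul (Sf y) (Sf x)]
      have e2 : hm (fun b a => Sf (Sf x) b * Sf (Sf y) a) c = hm (fun a b => x a * y b) c := by
        refine hm_congr' c fun a' b' h' => ?_
        by_cases ha' : a'.dim = 0
        · rw [Sf_zero _ _ ha', Sf_zero _ _ ha', hxz _ ha']; simp
        by_cases hb' : b'.dim = 0
        · rw [Sf_zero _ b' hb', Sf_zero _ b' hb', hyz _ hb']; simp
        rw [ih a'.dim (by omega) _ _ rfl, ih b'.dim (by omega) _ _ rfl]
      rw [e2]; ring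
    have h2 : av n (fun c => hm (fun a b => x a * y b) c * T φ c) = 0 := by
      rw [← hTadj]
      rw [← av_zero (F := F) n]
      exact av_congr n fun c hc => by rw [h1 c hc, zero_mul]
    rw [adjoint, Finset.sum_eq_single (a.dim, b.dim)] at h2
    · obtain ⟨w, hw, hw'⟩ := av_delta a
      obtain ⟨v, hv, hv'⟩ := av_delta b
      have e : ∀ b', av a.dim (fun a' => x a' * y b' * hd (T φ) a' b') =
          if b' = b then w * hd (T φ) a b' else 0 := by
        intro b'
        by_cases hbb : b' = b
        · rw [if_pos hbb, ← hw' (fun a => hd (T φ) a b')]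
          congr 1; ext a'
          simp [x, y, hbb]
        · rw [if_neg hbb]
          simp [y, hbb, av_zero]
      simp_rw [e] at h2
      rw [hv' (fun b => w * hd (T φ) a b)] at h2
      simpa [hw, hv] using h2
    · rintro ⟨k, l⟩ hkl hne
      rw [Finset.HasAntidiagonal.mem_antidiagonal] at hkl
      simp only at hkl ⊢
      rw [← av_zero (F := F) l]
      refine av_congr l fun b' hb' => ?_
      rw [← av_zero (F := F) k]
      refine av_congr k fun a' ha' => ?_
      by_cases hx : a' = a
      · by_cases hy : b' = b
        · exfalso; apply hne; rw [← ha', ← hb', hx, hy]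
        · simp [y, hy]
      · simp [x, hx]
    · intro h
      exact absurd (Finset.HasAntidiagonal.mem_antidiagonal.2 hab) h
  have hS : ∀ (φ : Cls F → ℂ) (c : Cls F), c.dim = n → Sf (T φ) c = - T φ c := by
    intro φ c hc
    rw [Sf_rec _ _ (by omega)]
    congr 1
    rw [← hm_unit_left (T φ) c]
    refine hm_congr' c fun a b hab => ?_
    split_ifs with h1 h2 h2
    · omega
    · rfl
    · rw [Sf_zero _ _ h2, hd_zero_left _ _ _ h2]
    · rw [← Sf_const_zero a]
      exact Sf_congr a fun a' ha' => hhd φ a' b (by omega) h1 (by omega)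
  have hTT : ∀ (φ : Cls F → ℂ) (c : Cls F), c.dim = n → T (T φ) c = 0 := by
    intro φ c hc
    have e1 : Sf (Sf (T φ)) c = Sf (fun c => 0 + (-1) * T φ c) c :=
      Sf_congr c fun c' hc' => by rw [hS φ c' (by omega)]; ring
    simp only [T] at e1 ⊢
    rw [e1, Sf_lin2 (-1) (fun _ => 0) (T φ) c, Sf_const_zero, hS φ c hc]
    simp only [T]
    ring
  intro φ c hc
  have hconj : ∀ c, T (fun c => conj (φ c)) c = conj (T φ c) := by
    intro c
    simp only [T]
    have : Sf (Sf fun c => conj (φ c)) c = Sf (fun c => conj (Sf φ c)) c :=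
      Sf_congr c fun c' _ => Sf_conj φ c'
    rw [this, Sf_conj]; simp
  have h0 : av n (fun c => T φ c * conj (T φ c)) = 0 := by
    simp_rw [← hconj]
    rw [hTadj, ← av_zero (F := F) n]
    exact av_congr n fun c hc => by rw [hTT _ c hc, mul_zero]
  unfold av at h0
  have h1 : ∑ A : (Fin n → F) →ₗ[F] (Fin n → F), T φ (cl A) * conj (T φ (cl A)) = 0 := by
    refine (mul_eq_zero.1 h0).resolve_left (inv_ne_zero (by exact_mod_cast Nat.card_pos.ne'))
  have h2 : ∑ A : (Fin n → F) →ₗ[F] (Fin n → F), Complex.normSq (T φ (cl A)) = 0 := by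
    have : ((∑ A : (Fin n → F) →ₗ[F] (Fin n → F), Complex.normSq (T φ (cl A)) : ℝ) : ℂ) = 0 := by
      push_cast
      rw [← h1]
      exact Finset.sum_congr rfl fun A _ => (Complex.mul_conj _).symm
    exact_mod_cast this
  subst hc
  obtain ⟨A, hA⟩ := exists_rep c
  have h3 := (Finset.sum_eq_zero_iff_of_nonneg (fun A _ => Complex.normSq_nonneg _)).1 h2 A (Finset.mem_univ _)
  rw [Complex.normSq_eq_zero, hA] at h3
  simp only [T] at h3
  linear_combination h3
end PartB4

set_option linter.unusedSectionVars false
section PartE1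
attribute [local instance 10] Fintype.ofFinite
attribute [local instance] Classical.propDecidable
open Polynomial
variable {F : Type} [Field F] [Finite F]

section cyc
variable {V V' : Type} [AddCommGroup V] [Module F V] [Finite V]
  [AddCommGroup V'] [Module F V'] [Finite V']

/-- evaluation at a vector -/
noncomputable def evv (N : V →ₗ[F] V) (v : V) : F[X] →ₗ[F] V :=
  (LinearMap.applyₗ v).comp (aeval N).toLinearMap

lemma evv_apply (N : V →ₗ[F] V) (v : V) (p : F[X]) : evv N v p = aeval N p v := rfl
lemma evv_mul (N : V →ₗ[F] V) (v : V) (p r : F[X]) : evv N v (p * r) = aeval N p (evv N v r) := by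
  simp [evv_apply]
lemma evv_X_mul (N : V →ₗ[F] V) (v : V) (r : F[X]) : evv N v (X * r) = N (evv N v r) := by
  rw [evv_mul]; simp

def RegNil (N : V →ₗ[F] V) (v : V) : Prop :=
  N ^ (Module.finrank F V) = 0 ∧ Function.Surjective (evv N v)

lemma evv_mod {N : V →ₗ[F] V} {v : V} {m : ℕ} (h : (N ^ m) v = 0) (p : F[X]) :
    evv N v (p %ₘ X ^ m) = evv N v p := by
  conv_rhs => rw [← modByMonic_add_div p (X ^ m)]
  rw [map_add, mul_comm, evv_mul]
  simp [evv_apply, h]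

lemma evv_degreeLT_surj {N : V →ₗ[F] V} {v : V} {m : ℕ} (h : (N ^ m) v = 0) (hs : Function.Surjective (evv N v)) :
    Function.Surjective ((evv N v).comp (degreeLT F m).subtype) := by
  intro w
  obtain ⟨p, hp⟩ := hs w
  refine ⟨⟨p %ₘ X ^ m, ?_⟩, ?_⟩
  · rw [mem_degreeLT]
    refine (degree_modByMonic_lt p (monic_X_pow m)).trans_le ?_
    simp
  · simp only [LinearMap.comp_apply, Submodule.subtype_apply]
    rw [evv_mod h, hp]

lemma finrank_degreeLT (m : ℕ) : Module.finrank F (degreeLT F m) = m := by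
  rw [(degreeLTEquiv F m).finrank_eq]; simp

instance (m : ℕ) : FiniteDimensional F (degreeLT F m) :=
  Module.Finite.equiv (degreeLTEquiv F m).symm

lemma regNil_ker {N : V →ₗ[F] V} {v : V} (h : RegNil N v) (p : F[X]) :
    evv N v p = 0 ↔ X ^ (Module.finrank F V) ∣ p := by
  constructor
  · intro hp
    have h1 : (N ^ (Module.finrank F V)) v = 0 := by rw [h.1]; rfl
    have h2 := evv_degreeLT_surj h1 h.2
    have h3 : Function.Injective ((evv N v).comp (degreeLT F (Module.finrank F V)).subtype) := by
      rwa [LinearMap.injective_iff_surjective_of_finrank_eq_finrank (finrank_degreeLT _)]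
    have h4 : p %ₘ X ^ (Module.finrank F V) ∈ degreeLT F (Module.finrank F V) := by
      rw [mem_degreeLT]
      refine (degree_modByMonic_lt p (monic_X_pow _)).trans_le ?_
      simp
    have h5 : (⟨_, h4⟩ : degreeLT F (Module.finrank F V)) = 0 := by
      apply h3
      rw [map_zero]
      simp only [LinearMap.comp_apply, Submodule.subtype_apply]
      rw [evv_mod h1, hp]
    rw [← modByMonic_eq_zero_iff_dvd (monic_X_pow _)]
    exact congrArg Subtype.val h5
  · rintro ⟨r, rfl⟩
    rw [mul_comm, evv_mul, evv_apply]
    simp [h.1]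

def RegUni (f : V →ₗ[F] V) : Prop := ∃ v, RegNil (f - 1) v

lemma regUni_cl {f : V →ₗ[F] V} {f' : V' →ₗ[F] V'} (h : RegUni f) (h' : RegUni f')
    (hd : Module.finrank F V = Module.finrank F V') : cl f = cl f' := by
  obtain ⟨v, hv⟩ := h
  obtain ⟨v', hv'⟩ := h'
  have hk : LinearMap.ker (evv (f - 1) v) = LinearMap.ker (evv (f' - 1) v') := by
    ext p
    rw [LinearMap.mem_ker, LinearMap.mem_ker, regNil_ker hv, regNil_ker hv', hd]
  let e1 := (evv (f - 1) v).quotKerEquivOfSurjective hv.2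
  let e2 := (evv (f' - 1) v').quotKerEquivOfSurjective hv'.2
  let e : V ≃ₗ[F] V' := e1.symm.trans ((Submodule.quotEquivOfEq _ _ hk).trans e2)
  have he : ∀ p, e (evv (f - 1) v p) = evv (f' - 1) v' p := by
    intro p
    have : e1.symm (evv (f - 1) v p) = Submodule.Quotient.mk p := by
      rw [LinearEquiv.symm_apply_eq]; rfl
    simp only [e, LinearEquiv.trans_apply, this]
    rfl
  refine cl_eq e fun x => ?_
  obtain ⟨p, rfl⟩ := hv.2 x
  have h1 : f (evv (f - 1) v p) = evv (f - 1) v (X * p) + evv (f - 1) v p := by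
    rw [evv_X_mul]; simp
  have h2 : f' (evv (f' - 1) v' p) = evv (f' - 1) v' (X * p) + evv (f' - 1) v' p := by
    rw [evv_X_mul]; simp
  rw [he, h2, h1, map_add, he, he]

lemma inv_aeval {N : V →ₗ[F] V} {W : Submodule F V} (hW : IsInv N W) (p : F[X]) {w : V} (hw : w ∈ W) :
    aeval N p w ∈ W := by
  induction p using Polynomial.induction_on' with
  | add p r hp hr => rw [map_add]; exact add_mem hp hr
  | monomial n a =>
    rw [← C_mul_X_pow_eq_monomial]
    have : ∀ n, (N ^ n) w ∈ W := by
      intro n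
      induction n with
      | zero => simpa
      | succ n ih => rw [pow_succ']; exact hW ih
    simp only [map_mul, aeval_C, map_pow, aeval_X, Module.End.mul_apply, Module.algebraMap_end_apply]
    exact W.smul_mem _ (this n)

lemma isInv_sub_one {f : V →ₗ[F] V} {W : Submodule F V} : IsInv (f - 1) W ↔ IsInv f W := by
  constructor
  · intro h x hx
    have h1 : (f - 1) x ∈ W := h hx
    have := add_mem h1 hx
    change f x ∈ W
    simpa using this
  · intro h x hx
    have h1 : f x ∈ W := h hx
    change f x - x ∈ W
    exact sub_mem h1 hx

lemma inv_eq_range {N : V →ₗ[F] V} {v : V} (h : RegNil N v) {W : Submodule F V} (hW : IsInv N W) :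
    ∃ j ≤ Module.finrank F V, W = LinearMap.range (N ^ j) := by
  let I : Ideal F[X] :=
    { carrier := {p | evv N v p ∈ W}
      add_mem' := fun {a b} ha hb => by
        change evv N v (a + b) ∈ W
        rw [map_add]; exact add_mem ha hb
      zero_mem' := by change evv N v 0 ∈ W; rw [map_zero]; exact zero_mem _
      smul_mem' := fun c x hx => by
        change evv N v (c * x) ∈ W
        rw [evv_mul]; exact inv_aeval hW c hx }
  obtain ⟨g, hg⟩ := (IsPrincipalIdealRing.principal I).principal
  have h1 : (X : F[X]) ^ (Module.finrank F V) ∈ I := by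
    change evv N v _ ∈ W
    rw [(regNil_ker h _).2 dvd_rfl]; exact zero_mem _
  have hI : ∀ p, p ∈ I ↔ g ∣ p := fun p => by
    rw [hg]; exact Ideal.mem_span_singleton
  obtain ⟨j, hj, hgj⟩ := (dvd_prime_pow prime_X _).1 ((hI _).1 h1)
  refine ⟨j, hj, ?_⟩
  ext w
  obtain ⟨p, rfl⟩ := h.2 w
  have h2 : evv N v p ∈ W ↔ X ^ j ∣ p := by
    rw [← hgj.dvd_iff_dvd_left, ← hI]; rfl
  rw [h2]
  constructor
  · rintro ⟨r, rfl⟩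
    exact ⟨evv N v r, by rw [evv_mul]; simp⟩
  · rintro ⟨y, hy⟩
    obtain ⟨r, rfl⟩ := h.2 y
    have h3 : evv N v (X ^ j * r - p) = 0 := by
      rw [map_sub, evv_mul, sub_eq_zero, ← hy]; simp
    rw [regNil_ker h] at h3
    have := (pow_dvd_pow X hj).trans h3
    rwa [dvd_sub_right (dvd_mul_right _ _)] at this

lemma isInv_range_pow (N : V →ₗ[F] V) (j : ℕ) : IsInv N (LinearMap.range (N ^ j)) := by
  rintro _ ⟨y, rfl⟩
  exact ⟨N y, by rw [← Module.End.mul_apply, ← Module.End.mul_apply, ← pow_succ, ← pow_succ']⟩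

lemma regUni_finrank {N : V →ₗ[F] V} {v : V} (h : RegNil N v) {j : ℕ} (hj : j ≤ Module.finrank F V) :
    Module.finrank F (LinearMap.range (N ^ j)) = Module.finrank F V - j := by
  let n := Module.finrank F V
  have h1 : (N ^ n) v = 0 := by rw [h.1]; rfl
  let T : degreeLT F (n - j) →ₗ[F] V :=
    ((N ^ j).comp (evv N v)).comp (degreeLT F (n - j)).subtype
  have hT : ∀ p, T p = evv N v (X ^ j * p.1) := fun p => by rw [evv_mul]; simp [T]
  have hr : LinearMap.range T = LinearMap.range (N ^ j) := by
    apply le_antisymm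
    · rintro _ ⟨p, rfl⟩
      exact ⟨evv N v p.1, rfl⟩
    · rintro _ ⟨y, rfl⟩
      obtain ⟨r, rfl⟩ := h.2 y
      refine ⟨⟨r %ₘ X ^ (n - j), ?_⟩, ?_⟩
      · rw [mem_degreeLT]
        refine (degree_modByMonic_lt _ (monic_X_pow _)).trans_le ?_
        simp
      · rw [hT]
        have h2 : evv N v (X ^ j * r) = (N ^ j) (evv N v r) := by rw [evv_mul]; simp
        rw [← h2, ← sub_eq_zero, ← map_sub, regNil_ker h, ← mul_sub]
        have h3 : (X : F[X]) ^ (Module.finrank F V) = X ^ j * X ^ (n - j) := by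
          rw [← pow_add]; congr 1; omega
        rw [h3]
        refine mul_dvd_mul_left _ ?_
        rw [← dvd_neg, neg_sub]
        refine ⟨r /ₘ X ^ (n - j), ?_⟩
        have := modByMonic_add_div r (X ^ (n - j))
        simp only at this ⊢
        linear_combination -this
  have hi : Function.Injective T := by
    rw [injective_iff_map_eq_zero]
    intro p hp
    rw [hT, regNil_ker h] at hp
    apply Subtype.ext
    by_contra hne
    have hne' : p.1 ≠ 0 := hne
    have := degree_le_of_dvd hp (mul_ne_zero (pow_ne_zero _ X_ne_zero) hne')
    have h4 := mem_degreeLT.1 p.2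
    rw [degree_mul, degree_X_pow, degree_X_pow, degree_eq_natDegree hne'] at this
    rw [degree_eq_natDegree hne'] at h4
    norm_cast at this h4
    omega
  rw [← hr, LinearMap.finrank_range_of_inj hi, finrank_degreeLT]

lemma evv_comm {N : V →ₗ[F] V} {N' : V' →ₗ[F] V'} (g : V →ₗ[F] V') (h : ∀ x, g (N x) = N' (g x)) (v : V)
    (p : F[X]) : g (evv N v p) = evv N' (g v) p := by
  induction p using Polynomial.induction_on' with
  | add p r hp hr => rw [map_add, map_add, map_add, hp, hr]
  | monomial n a =>
    rw [← C_mul_X_pow_eq_monomial, evv_mul, evv_mul]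
    simp only [aeval_C, Module.algebraMap_end_apply, map_smul]
    congr 1
    simp only [evv_apply, map_pow, aeval_X]
    induction n with
    | zero => simp
    | succ n ih => rw [pow_succ', pow_succ', Module.End.mul_apply, Module.End.mul_apply, h, ih]

lemma regUni_restrict {f : V →ₗ[F] V} {v : V} (h : RegNil (f - 1) v) {j : ℕ} (hj : j ≤ Module.finrank F V)
    (hW : IsInv f (LinearMap.range ((f - 1) ^ j))) :
    RegUni (LinearMap.restrict (p := LinearMap.range ((f - 1) ^ j)) (q := LinearMap.range ((f - 1) ^ j)) f hW) := by
  set fr : LinearMap.range ((f - 1) ^ j) →ₗ[F] LinearMap.range ((f - 1) ^ j) :=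
    LinearMap.restrict (p := LinearMap.range ((f - 1) ^ j)) (q := LinearMap.range ((f - 1) ^ j)) f hW with hfr
  have hc : ∀ x, (LinearMap.range ((f - 1) ^ j)).subtype ((fr - 1) x) =
    (f - 1) ((LinearMap.range ((f - 1) ^ j)).subtype x) := fun x => rfl
  have hc' : ∀ (m : ℕ) (x : LinearMap.range ((f - 1) ^ j)),
      (((fr - 1 : Module.End F (LinearMap.range ((f - 1) ^ j))) ^ m) x).1 = ((f - 1 : Module.End F V) ^ m) (x : V) := by
    intro m
    induction m with
    | zero => intro x; rfl
    | succ m ih =>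
      intro x
      rw [pow_succ', pow_succ', Module.End.mul_apply, Module.End.mul_apply, ← ih]
      rfl
  refine ⟨⟨((f - 1) ^ j) v, ⟨v, rfl⟩⟩, ?_, ?_⟩
  · rw [regUni_finrank h hj]
    ext ⟨_, ⟨y, rfl⟩⟩
    rw [hc', ← Module.End.mul_apply, ← pow_add]
    have : Module.finrank F V - j + j = Module.finrank F V := by omega
    rw [this, h.1]; rfl
  · rintro ⟨_, ⟨y, rfl⟩⟩
    obtain ⟨p, rfl⟩ := h.2 y
    refine ⟨p, ?_⟩
    apply Subtype.ext
    have := evv_comm (LinearMap.range ((f - 1) ^ j)).subtype hc ⟨((f - 1) ^ j) v, ⟨v, rfl⟩⟩ p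
    refine this.trans ?_
    exact (evv_comm ((f - 1) ^ j) (fun x => by
      rw [← Module.End.mul_apply, ← Module.End.mul_apply, ← pow_succ, ← pow_succ']) v p).symm

lemma regUni_quot {f : V →ₗ[F] V} {v : V} (h : RegNil (f - 1) v) {j : ℕ} (hj : j ≤ Module.finrank F V)
    (hW : IsInv f (LinearMap.range ((f - 1) ^ j))) : RegUni ((LinearMap.range ((f - 1) ^ j)).mapQ _ f hW) := by
  set W := LinearMap.range ((f - 1) ^ j) with hWdef
  have hc : ∀ x, W.mkQ ((f - 1) x) = (W.mapQ W f hW - 1) (W.mkQ x) := fun x => rfl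
  have hc' : ∀ (m : ℕ) (x : V), W.mkQ (((f - 1 : Module.End F V) ^ m) x) =
      ((W.mapQ W f hW - 1 : Module.End F (V ⧸ W)) ^ m) (W.mkQ x) := by
    intro m
    induction m with
    | zero => intro x; rfl
    | succ m ih =>
      intro x
      rw [pow_succ', pow_succ', Module.End.mul_apply, Module.End.mul_apply, ← ih]
      rfl
  refine ⟨W.mkQ v, ?_, ?_⟩
  · have h1 : Module.finrank F (V ⧸ W) = j := by
      have := Submodule.finrank_quotient_add_finrank W
      have h2 := regUni_finrank h hj
      rw [← hWdef] at h2
      omega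
    rw [h1]
    apply LinearMap.ext
    intro x
    obtain ⟨x, rfl⟩ := W.mkQ_surjective x
    rw [← hc']
    simp only [Submodule.mkQ_apply, LinearMap.zero_apply, Submodule.Quotient.mk_eq_zero]
    exact ⟨x, rfl⟩
  · intro y
    obtain ⟨y, rfl⟩ := W.mkQ_surjective y
    obtain ⟨p, rfl⟩ := h.2 y
    exact ⟨p, (evv_comm W.mkQ hc v p).symm⟩
end cyc

lemma regUni_matrix {n : ℕ} (A : Matrix (Fin n) (Fin n) F) (h1 : ∀ i j, j < i → A i j = 0)
    (h2 : ∀ i, A i i = 1) (h3 : ∀ i j : Fin n, j.1 = i.1 + 1 → A i j ≠ 0) : RegUni (Matrix.toLin' A) := by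
  cases n with
  | zero =>
    refine ⟨0, ?_, fun w => ⟨0, Subsingleton.elim _ _⟩⟩
    ext x i; exact i.elim0
  | succ m =>
  set N := Matrix.toLin' A - 1 with hN
  have hap : ∀ x i, N x i = ∑ k, (if i < k then A i k else 0) * x k := by
    intro x i
    simp only [hN, LinearMap.sub_apply, Matrix.toLin'_apply, Pi.sub_apply, Module.End.one_apply,
      Matrix.mulVec, dotProduct]
    rw [sub_eq_iff_eq_add]
    have : x i = ∑ k, if k = i then x k else 0 := by simp
    conv_rhs => rw [this]
    rw [← Finset.sum_add_distrib]
    refine Finset.sum_congr rfl fun k _ => ?_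
    rcases lt_trichotomy i k with h | h | h
    · simp [h, h.ne']
    · subst h; simp [h2]
    · simp [h1 i k h, h.ne, h.not_gt]
  have hz : ∀ (j : ℕ) x (i : Fin (m + 1)), m + 1 ≤ i.1 + j → (N ^ j) x i = 0 := by
    intro j
    induction j with
    | zero => intro x i hi; omega
    | succ j ih =>
      intro x i hi
      rw [pow_succ', Module.End.mul_apply, hap]
      refine Finset.sum_eq_zero fun k _ => ?_
      split_ifs with hik
      · rw [ih x k (by have : i.1 < k.1 := hik; omega), mul_zero]
      · simp
  let v : Fin (m + 1) → F := Pi.single (Fin.last m) 1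
  have hv : ∀ (j : ℕ) (i : Fin (m + 1)), (i.1 + j = m → (N ^ j) v i ≠ 0) ∧ (m < i.1 + j → (N ^ j) v i = 0) := by
    intro j
    induction j with
    | zero =>
      intro i
      refine ⟨fun hi => ?_, fun hi => by omega⟩
      have : i = Fin.last m := Fin.ext (by simpa using hi)
      subst this; simp [v]
    | succ j ih =>
      intro i
      refine ⟨fun hi => ?_, fun hi => hz _ _ _ (by omega)⟩
      rw [pow_succ', Module.End.mul_apply, hap]
      rw [Finset.sum_eq_single (⟨i.1 + 1, by omega⟩ : Fin (m + 1))]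
      · rw [if_pos (Fin.lt_def.2 (by simp))]
        refine mul_ne_zero (h3 _ _ rfl) ((ih _).1 ?_)
        simp only; omega
      · intro k _ hk
        split_ifs with hik
        · rw [(ih k).2, mul_zero]
          have h4 : i.1 < k.1 := hik
          have h5 : k.1 ≠ i.1 + 1 := fun h => hk (Fin.ext h)
          omega
        · simp
      · simp
  refine ⟨v, ?_, ?_⟩
  · apply LinearMap.ext
    intro x
    funext i
    simp only [Module.finrank_fintype_fun_eq_card, Fintype.card_fin]
    exact hz _ _ _ (by omega)
  · have key : ∀ k : ℕ, k ≤ m + 1 → ∀ x : Fin (m + 1) → F, (∀ i : Fin (m + 1), k ≤ i.1 → x i = 0) →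
        x ∈ LinearMap.range (evv N v) := by
      intro k
      induction k with
      | zero =>
        intro _ x hx
        have : x = 0 := by ext i; exact hx i (by omega)
        rw [this]; exact zero_mem _
      | succ k ih =>
        intro hk x hx
        have hw : (N ^ (m - k)) v ∈ LinearMap.range (evv N v) := ⟨X ^ (m - k), by simp [evv_apply]⟩
        let i0 : Fin (m + 1) := ⟨k, by omega⟩
        have hw0 : (N ^ (m - k)) v i0 ≠ 0 := (hv _ _).1 (by simp only [i0]; omega)
        have h5 := ih (by omega) (x - (x i0 / (N ^ (m - k)) v i0) • (N ^ (m - k)) v) (by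
          intro i hi
          by_cases hik : i.1 = k
          · have : i = i0 := Fin.ext hik
            rw [this]
            simp [hw0]
          · have e1 := hx i (by omega)
            have e2 := (hv (m - k) i).2 (by omega)
            simp [e1, e2])
        have := add_mem h5 (Submodule.smul_mem _ (x i0 / (N ^ (m - k)) v i0) hw)
        simpa using this
    intro w
    exact key (m + 1) le_rfl w fun i hi => by omega

noncomputable def uM (n : ℕ) : Matrix (Fin n) (Fin n) F :=
  Matrix.of fun i j => if i = j then 1 else if j.1 = i.1 + 1 then 1 else 0

noncomputable def u (F : Type) [Field F] [Finite F] (n : ℕ) : Cls F := cl (Matrix.toLin' (uM n : Matrix (Fin n) (Fin n) F))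

lemma regUni_uM (n : ℕ) : RegUni (Matrix.toLin' (uM n : Matrix (Fin n) (Fin n) F)) := by
  refine regUni_matrix _ ?_ ?_ ?_
  · intro i j hij
    have h : j.1 < i.1 := hij
    simp only [uM, Matrix.of_apply]
    rw [if_neg (by rintro rfl; omega), if_neg (by omega)]
  · intro i; simp [uM]
  · intro i j hij
    simp only [uM, Matrix.of_apply]
    rw [if_neg (by rintro rfl; omega), if_pos hij]
    exact one_ne_zero

lemma cl_eq_u {V : Type} [AddCommGroup V] [Module F V] [Finite V] {f : V →ₗ[F] V} (h : RegUni f) {n : ℕ}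
    (hn : Module.finrank F V = n) : cl f = u F n :=
  regUni_cl h (regUni_uM n) (by simp [hn])

@[simp] lemma dim_u (n : ℕ) : (u F n).dim = n := by simp [u]

lemma hm_u (Φ : Cls F → Cls F → ℂ) (n : ℕ) :
    hm Φ (u F n) = ∑ k ∈ Finset.range (n + 1), Φ (u F k) (u F (n - k)) := by
  obtain ⟨v, hv⟩ := regUni_uM (F := F) n
  set f := Matrix.toLin' (uM n : Matrix (Fin n) (Fin n) F) with hf
  have hfr : Module.finrank F (Fin n → F) = n := by simp
  have hinv : ∀ j, IsInv f (LinearMap.range ((f - 1) ^ j)) := fun j => isInv_sub_one.1 (isInv_range_pow _ j)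
  rw [u, hm_cl, ← Finset.sum_filter, ← Finset.sum_range_reflect]
  symm
  refine Finset.sum_bij (fun j _ => LinearMap.range ((f - 1) ^ j)) ?_ ?_ ?_ ?_
  · intro j _
    simp only [Finset.mem_filter, Finset.mem_univ, true_and]
    exact hinv j
  · intro j hj j' hj' h
    rw [Finset.mem_range] at hj hj'
    have h1 := regUni_finrank hv (j := j) (by omega)
    have h2 := regUni_finrank hv (j := j') (by omega)
    rw [h] at h1
    omega
  · intro W hW
    obtain ⟨j, hj, h⟩ := inv_eq_range hv (isInv_sub_one.2 (Finset.mem_filter.1 hW).2)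
    exact ⟨j, by rw [Finset.mem_range]; omega, h.symm⟩
  · intro j hj
    rw [Finset.mem_range] at hj
    have h2 := regUni_finrank hv (j := j) (by omega)
    have h3 := Submodule.finrank_quotient_add_finrank (LinearMap.range ((f - 1) ^ j))
    rw [cR_def (hinv j), cQ_def (hinv j), cl_eq_u (regUni_restrict hv (by omega) (hinv j)) (h2.trans (by rw [hfr])),
      cl_eq_u (n := j) (regUni_quot hv (by omega) (hinv j)) (by omega)]
    congr 2 <;> omega
end PartE1

set_option linter.unusedSectionVars false
section PartE2
attribute [local instance 10] Fintype.ofFinite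
attribute [local instance 10] Classical.propDecidable
variable {F : Type} [Field F] [Finite F]

section gen
variable {ι κ : Type} [Fintype ι] [Fintype κ] [DecidableEq ι] [DecidableEq κ]

/-- weighted sum over matrices -/
noncomputable def IW (t : ι → ι → F → ℂ) (φ : Cls F → ℂ) : ℂ :=
  ∑ A : Matrix ι ι F, (∏ i, ∏ j, t i j (A i j)) * φ (cl (Matrix.toLin' A))

lemma cl_reindex (e : ι ≃ κ) (A : Matrix ι ι F) :
    cl (Matrix.toLin' (Matrix.reindex e e A)) = cl (Matrix.toLin' A) := by
  symm
  refine cl_eq (LinearEquiv.funCongrLeft F F e.symm) fun x => ?_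
  funext i
  simp only [LinearEquiv.funCongrLeft_apply, LinearMap.funLeft_apply, Matrix.toLin'_apply, Matrix.mulVec,
    dotProduct, Matrix.reindex_apply, Matrix.submatrix_apply]
  exact (Equiv.sum_comp e.symm (fun j => A (e.symm i) j * x j)).symm

lemma IW_reindex (e : ι ≃ κ) (t : κ → κ → F → ℂ) (φ : Cls F → ℂ) :
    IW t φ = IW (fun i j => t (e i) (e j)) φ := by
  unfold IW
  symm
  refine Fintype.sum_equiv (Matrix.reindex e e) _ _ fun A => ?_
  rw [cl_reindex]
  congr 1
  rw [← Equiv.prod_comp e]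
  refine Finset.prod_congr rfl fun i _ => ?_
  rw [← Equiv.prod_comp e]
  simp

def blkE : (Matrix ι ι F × Matrix κ κ F × Matrix κ ι F × Matrix ι κ F) ≃ Matrix (ι ⊕ κ) (ι ⊕ κ) F where
  toFun x := Matrix.fromBlocks x.1 x.2.2.2 x.2.2.1 x.2.1
  invFun M := (M.toBlocks₁₁, M.toBlocks₂₂, M.toBlocks₂₁, M.toBlocks₁₂)
  left_inv x := by simp
  right_inv M := by simp [Matrix.fromBlocks_toBlocks]

lemma cl_fromBlocks (A : Matrix ι ι F) (B : Matrix ι κ F) (D : Matrix κ κ F) :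
    cl (Matrix.toLin' (Matrix.fromBlocks A B 0 D)) =
      cl (sext (Matrix.toLin' A) (Matrix.toLin' D) (Matrix.toLin' B)) := by
  refine cl_eq (LinearEquiv.sumArrowLequivProdArrow ι κ F F) fun x => ?_
  obtain ⟨y, rfl⟩ := (LinearEquiv.sumArrowLequivProdArrow ι κ F F).symm.surjective x
  obtain ⟨y, z⟩ := y
  rw [Matrix.toLin'_apply, Matrix.fromBlocks_mulVec]
  ext i <;> simp [LinearEquiv.sumArrowLequivProdArrow, Function.comp_def]

lemma IW_split (t : ι ⊕ κ → ι ⊕ κ → F → ℂ) (φ : Cls F → ℂ)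
    (h21 : ∀ i j x, t (Sum.inr i) (Sum.inl j) x = if x = 0 then 1 else 0)
    (h12 : ∀ i j x, t (Sum.inl i) (Sum.inr j) x = (Nat.card F : ℂ)⁻¹) :
    IW t φ = IW (fun i j => t (Sum.inl i) (Sum.inl j)) (fun a =>
      IW (fun i j => t (Sum.inr i) (Sum.inr j)) (fun b => hd φ a b)) := by
  unfold IW
  rw [← Equiv.sum_comp blkE, Fintype.sum_prod_type]
  refine Finset.sum_congr rfl fun A _ => ?_
  rw [Fintype.sum_prod_type, Finset.mul_sum]
  refine Finset.sum_congr rfl fun D _ => ?_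
  beta_reduce
  rw [Fintype.sum_prod_type, hd_cl]
  rw [Finset.sum_eq_single (0 : Matrix κ ι F)]
  · rw [← Equiv.sum_comp (Matrix.toLin' (R := F) (m := ι) (n := κ)).toEquiv]
    simp only [Finset.mul_sum]
    refine Finset.sum_congr rfl fun B _ => ?_
    simp only [blkE, Equiv.coe_fn_mk, cl_fromBlocks, Fintype.prod_sum_type, Matrix.fromBlocks_apply₁₁,
      Matrix.fromBlocks_apply₁₂, Matrix.fromBlocks_apply₂₁, Matrix.fromBlocks_apply₂₂, h21, h12,
      Finset.prod_mul_distrib, Matrix.zero_apply, if_true, Finset.prod_const_one, one_mul]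
    have : (∏ _ : ι, ∏ _ : κ, (Nat.card F : ℂ)⁻¹) = (Nat.card ((κ → F) →ₗ[F] (ι → F)) : ℂ)⁻¹ := by
      rw [Nat.card_congr (Matrix.toLin' (R := F) (m := ι) (n := κ)).symm.toEquiv]
      simp [Matrix, Nat.card_pi, ← pow_mul, Nat.card_eq_fintype_card]
    rw [this]
    simp only [LinearEquiv.coe_toEquiv]
    ring
  · intro C _ hC
    refine Finset.sum_eq_zero fun B _ => ?_
    have : ∃ i j, C i j ≠ 0 := by
      by_contra! h
      exact hC (Matrix.ext h)
    obtain ⟨i, j, hij⟩ := this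
    rw [Finset.prod_eq_zero (Finset.mem_univ (Sum.inr i)), zero_mul]
    refine Finset.prod_eq_zero (Finset.mem_univ (Sum.inl j)) ?_
    simp [blkE, h21, hij]
  · simp

lemma sum_prod_one (t : ι → ι → F → ℂ) (h : ∀ i j, ∑ x, t i j x = 1) :
    ∑ A : Matrix ι ι F, ∏ i, ∏ j, t i j (A i j) = 1 := by
  have h1 : ∀ i, ∑ r : ι → F, ∏ j, t i j (r j) = 1 := by
    intro i
    rw [← Fintype.prod_sum]
    simp [h]
  have h2 := Fintype.prod_sum (fun (i : ι) (r : ι → F) => ∏ j, t i j (r j))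
  simp only [h1, Finset.prod_const_one] at h2
  exact h2.symm

lemma IW_const (t : ι → ι → F → ℂ) (h : ∀ i j, ∑ x, t i j x = 1) (φ : Cls F → ℂ) (c : Cls F)
    (hc : ∀ A : Matrix ι ι F, (∀ i j, t i j (A i j) ≠ 0) → cl (Matrix.toLin' A) = c) : IW t φ = φ c := by
  have : IW t φ = ∑ A : Matrix ι ι F, (∏ i, ∏ j, t i j (A i j)) * φ c := by
    refine Finset.sum_congr rfl fun A _ => ?_
    by_cases hA : ∀ i j, t i j (A i j) ≠ 0
    · rw [hc A hA]
    · push Not at hA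
      obtain ⟨i, j, hij⟩ := hA
      rw [Finset.prod_eq_zero (Finset.mem_univ i) (Finset.prod_eq_zero (Finset.mem_univ j) hij), zero_mul, zero_mul]
  rw [this, ← Finset.sum_mul, sum_prod_one t h, one_mul]

lemma IW_add (t1 t2 t : ι → ι → F → ℂ) (i0 j0 : ι) (h0 : ∀ x, t i0 j0 x = t1 i0 j0 x + t2 i0 j0 x)
    (h1 : ∀ i j, (i, j) ≠ (i0, j0) → t i j = t1 i j ∧ t i j = t2 i j) (φ : Cls F → ℂ) :
    IW t φ = IW t1 φ + IW t2 φ := by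
  unfold IW
  rw [← Finset.sum_add_distrib]
  refine Finset.sum_congr rfl fun A _ => ?_
  rw [← add_mul]
  congr 1
  simp only [← Fintype.prod_prod_type']
  symm
  refine Finset.prod_add_prod_eq (Finset.mem_univ (i0, j0)) (h0 _).symm ?_ ?_
  · intro p _ hp
    rw [(h1 p.1 p.2 hp).1]
  · intro p _ hp
    rw [(h1 p.1 p.2 hp).2]
end gen

/-- basic weight -/
noncomputable def tw' (w : ℕ → F → ℂ) (i j : ℕ) (x : F) : ℂ :=
  if j < i then (if x = 0 then 1 else 0) else if j = i then (if x = 1 then 1 else 0)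
  else if j = i + 1 then w i x * (Nat.card F : ℂ)⁻¹ else (Nat.card F : ℂ)⁻¹

noncomputable def In (n : ℕ) (w : ℕ → F → ℂ) (φ : Cls F → ℂ) : ℂ :=
  IW (fun i j : Fin n => tw' w i.1 j.1) φ

lemma In_congr (n : ℕ) {w w' : ℕ → F → ℂ} (h : ∀ i, i + 1 < n → w i = w' i) (φ : Cls F → ℂ) :
    In n w φ = In n w' φ := by
  unfold In
  congr 1
  funext i j x
  unfold tw'
  by_cases h1 : j.1 = i.1 + 1
  · rw [h i.1 (by omega)]
  · simp [h1]

lemma In_add (n : ℕ) {w w1 w2 : ℕ → F → ℂ} (k : ℕ) (hk : k + 1 < n) (h0 : ∀ x, w k x = w1 k x + w2 k x)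
    (h : ∀ i, i ≠ k → w i = w1 i ∧ w i = w2 i) (φ : Cls F → ℂ) : In n w φ = In n w1 φ + In n w2 φ := by
  refine IW_add _ _ _ ⟨k, by omega⟩ ⟨k + 1, hk⟩ ?_ ?_ φ
  · intro x
    simp only [tw', h0]
    simp; ring
  · intro i j hij
    by_cases h1 : i.1 = k
    · have : j.1 ≠ i.1 + 1 := fun h2 => hij (by ext <;> simp [h1, h2])
      constructor <;> (funext x; simp [tw', this])
    · constructor <;> funext x
      · simp only [tw', ← (h i.1 h1).1]
      · simp only [tw', ← (h i.1 h1).2]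

noncomputable def nu (x : F) : ℂ := if x = 0 then 0 else (Nat.card F : ℂ) * ((Nat.card F : ℂ) - 1)⁻¹
noncomputable def psit (x : F) : ℂ := 1 - nu x

lemma cardF_ne : (Nat.card F : ℂ) ≠ 0 := by
  exact_mod_cast Nat.card_pos.ne'
lemma cardF_sub_ne : (Nat.card F : ℂ) - 1 ≠ 0 := by
  have : 1 < Nat.card F := Finite.one_lt_card
  rw [sub_ne_zero]
  exact_mod_cast this.ne'

lemma sum_nu : ∑ x : F, nu x * (Nat.card F : ℂ)⁻¹ = 1 := by
  have : ∑ x : F, nu x = Nat.card F := by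
    simp only [nu]
    have h : ∀ x : F, (if x = 0 then (0:ℂ) else (Nat.card F : ℂ) * ((Nat.card F : ℂ) - 1)⁻¹) =
      (Nat.card F : ℂ) * ((Nat.card F : ℂ) - 1)⁻¹ - if x = 0 then (Nat.card F : ℂ) * ((Nat.card F : ℂ) - 1)⁻¹ else 0 := by
      intro x; split_ifs <;> simp
    simp only [h, Finset.sum_sub_distrib, Finset.sum_const, Finset.sum_ite_eq', Finset.mem_univ, if_true,
      Finset.card_univ, ← Nat.card_eq_fintype_card, nsmul_eq_mul]
    have := cardF_sub_ne (F := F)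
    field_simp
  rw [← Finset.sum_mul, this, mul_inv_cancel₀ cardF_ne]

lemma In_nu (n : ℕ) (φ : Cls F → ℂ) : In n (fun _ => nu) φ = φ (u F n) := by
  refine IW_const _ ?_ φ _ ?_
  · intro i j
    unfold tw'
    split_ifs
    · simp
    · simp
    · exact sum_nu
    · simp only [Finset.sum_const, Finset.card_univ, ← Nat.card_eq_fintype_card, nsmul_eq_mul]
      exact mul_inv_cancel₀ cardF_ne
  · intro A hA
    refine cl_eq_u (regUni_matrix A ?_ ?_ ?_) (by simp)
    · intro i j hij
      have h := hA i j
      unfold tw' at h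
      rw [if_pos (show j.1 < i.1 from hij)] at h
      by_contra h2
      simp [h2] at h
    · intro i
      have h := hA i i
      unfold tw' at h
      by_contra h2
      simp [h2] at h
    · intro i j hij h2
      have h := hA i j
      unfold tw' at h
      rw [if_neg (by omega), if_neg (by omega), if_pos hij] at h
      simp [h2, nu] at h

lemma In_split (k l : ℕ) (w : ℕ → F → ℂ) (hw : ∀ x, w (k - 1) x = 1) (φ : Cls F → ℂ) :
    In (k + l) w φ = In k w (fun a => In l (fun i => w (k + i)) (fun b => hd φ a b)) := by
  unfold In
  rw [IW_reindex finSumFinEquiv, IW_split]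
  · congr 1
    funext a
    congr 1
    funext i j x
    simp [tw', add_assoc]
  · intro i j x
    have : j.1 < k + i.1 := by omega
    simp [tw', this]
  · intro i j x
    have e1 : (finSumFinEquiv (Sum.inl i : Fin k ⊕ Fin l)).1 = i.1 := by simp
    have e2 : (finSumFinEquiv (Sum.inr j : Fin k ⊕ Fin l)).1 = k + j.1 := by simp
    rw [e1, e2]
    unfold tw'
    rw [if_neg (by omega), if_neg (by omega)]
    split_ifs with h
    · rw [show i.1 = k - 1 by omega, hw, one_mul]
    · rfl

noncomputable def wk (k i : ℕ) (x : F) : ℂ := if i < k then psit x else nu x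

lemma Sf_u (n : ℕ) : ∀ φ : Cls F → ℂ, Sf φ (u F n) = (-1) ^ n * In n (fun _ => psit) φ := by
  induction n using Nat.strong_induction_on with
  | _ n ih =>
  intro φ
  by_cases hn : n = 0
  · subst hn
    rw [Sf_zero _ _ (by simp), pow_zero, one_mul, ← In_nu 0 φ]
    exact In_congr 0 (fun i hi => by omega) φ
  rw [Sf_rec _ _ (by simpa using hn), hm_u, Finset.sum_range_succ]
  simp only [dim_u, Nat.sub_self, if_true, add_zero]
  have key : ∀ m, m + 1 ≤ n → (∑ k ∈ Finset.range (m + 1), if n - k = 0 then (0:ℂ) else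
      Sf (fun x => hd φ x (u F (n - k))) (u F k)) = (-1) ^ m * In n (wk m) φ := by
    intro m
    induction m with
    | zero =>
      intro _
      simp only [zero_add, Finset.range_one, Finset.sum_singleton, Nat.sub_zero, if_neg hn, pow_zero, one_mul]
      rw [Sf_zero _ _ (by simp), hd_zero_left _ _ _ (by simp), ← In_nu n φ]
      exact In_congr n (fun i hi => by funext x; simp [wk]) φ
    | succ m ihm =>
      intro hm
      rw [Finset.sum_range_succ, ihm (by omega), if_neg (by omega), ih (m + 1) (by omega)]
      have h1 : In (m + 1) (fun _ => psit) (fun x => hd φ x (u F (n - (m + 1)))) =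
          In n (fun i x => if i = m then 1 else wk m i x) φ := by
        have hs := In_split (m + 1) (n - (m + 1)) (fun i x => if i = m then 1 else wk m i x) (by simp) φ
        have e : m + 1 + (n - (m + 1)) = n := by omega
        rw [e] at hs
        rw [hs]
        have h2 : ∀ a, In (n - (m + 1)) (fun i => (fun i x => if i = m then 1 else wk m i x) (m + 1 + i))
            (fun b => hd φ a b) = hd φ a (u F (n - (m + 1))) := by
          intro a
          rw [← In_nu (n - (m + 1)) (fun b => hd φ a b)]
          refine In_congr _ (fun i hi => ?_) _
          funext x
          simp only [wk]
          rw [if_neg (by omega), if_neg (by omega)]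
        simp only [h2]
        refine In_congr _ (fun i hi => ?_) _
        funext x
        simp only [wk]
        rw [if_neg (by omega), if_pos (by omega)]
      have h3 : In n (fun i x => if i = m then 1 else wk m i x) φ = In n (wk (m + 1)) φ + In n (wk m) φ := by
        refine In_add n m (by omega) ?_ ?_ φ
        · intro x; simp [wk, psit]
        · intro i hi
          constructor <;> funext x <;> simp only [wk, if_neg hi]
          by_cases h : i < m
          · rw [if_pos h, if_pos (by omega)]
          · rw [if_neg h, if_neg (by omega)]
      rw [h1, h3, pow_succ]; ring
  obtain ⟨m, rfl⟩ := Nat.exists_eq_succ_of_ne_zero hn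
  have := key m le_rfl
  simp only [Nat.succ_eq_add_one] at this ⊢
  rw [this, pow_succ]
  have h4 : In (m + 1) (wk m) φ = In (m + 1) (fun _ => psit) φ :=
    In_congr _ (fun i hi => by funext x; simp only [wk]; rw [if_pos (by omega)]) φ
  rw [h4]; ring
end PartE2

set_option linter.unusedSectionVars false
section PartC1
attribute [local instance 10] Fintype.ofFinite
attribute [local instance 10] Classical.propDecidable
open Matrix ComplexConjugate
variable {F : Type} [Field F] [Finite F]

noncomputable def clG {n : ℕ} (g : GL (Fin n) F) : Cls F := cl (Matrix.toLin' g.1)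
@[simp] lemma dim_clG {n : ℕ} (g : GL (Fin n) F) : (clG g).dim = n := by simp [clG]

def InvC (c : Cls F) : Prop := ∃ (n : ℕ) (g : GL (Fin n) F), clG g = c

lemma gl_inj {n : ℕ} (g : GL (Fin n) F) : Function.Injective (Matrix.toLin' g.1) := by
  have : (Matrix.toLin' g⁻¹.1).comp (Matrix.toLin' g.1) = LinearMap.id := by
    rw [← Matrix.toLin'_mul, Units.inv_mul, Matrix.toLin'_one]
  intro x y h
  have := congrArg (Matrix.toLin' g⁻¹.1) h
  rw [← LinearMap.comp_apply, ← LinearMap.comp_apply] at this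
  simpa only [‹_ ∘ₗ _ = LinearMap.id›, LinearMap.id_apply] using this

lemma exists_gl {n : ℕ} {A : (Fin n → F) →ₗ[F] (Fin n → F)} (h : Function.Injective A) :
    ∃ g : GL (Fin n) F, Matrix.toLin' g.1 = A := by
  let e := LinearEquiv.ofInjectiveEndo A h
  refine ⟨⟨LinearMap.toMatrix' A, LinearMap.toMatrix' (e.symm : (Fin n → F) →ₗ[F] (Fin n → F)), ?_, ?_⟩, ?_⟩
  · rw [← LinearMap.toMatrix'_comp]
    have : A.comp (e.symm : (Fin n → F) →ₗ[F] (Fin n → F)) = LinearMap.id := by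
      ext1 x; exact LinearMap.ext fun y => e.apply_symm_apply _
    rw [this, LinearMap.toMatrix'_id]
  · rw [← LinearMap.toMatrix'_comp]
    have : (e.symm : (Fin n → F) →ₗ[F] (Fin n → F)).comp A = LinearMap.id := by
      ext1 x; exact LinearMap.ext fun y => e.symm_apply_apply _
    rw [this, LinearMap.toMatrix'_id]
  · exact Matrix.toLin'_toMatrix' A

section
variable {V V' : Type} [AddCommGroup V] [Module F V] [Finite V]
  [AddCommGroup V'] [Module F V'] [Finite V']

lemma inj_of_cl_eq {f : V →ₗ[F] V} {f' : V' →ₗ[F] V'} (h : cl f = cl f') (hf : Function.Injective f) :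
    Function.Injective f' := by
  obtain ⟨e, he⟩ := cl_eq_iff.1 h
  intro x y hxy
  obtain ⟨x, rfl⟩ := e.surjective x
  obtain ⟨y, rfl⟩ := e.surjective y
  rw [← he, ← he] at hxy
  rw [hf (e.injective hxy)]

lemma invC_cl {f : V →ₗ[F] V} : InvC (cl f) ↔ Function.Injective f := by
  constructor
  · rintro ⟨n, g, hg⟩
    exact inj_of_cl_eq hg (gl_inj g)
  · intro h
    obtain ⟨A, hA⟩ := exists_rep (cl f)
    obtain ⟨g, hg⟩ := exists_gl (inj_of_cl_eq hA.symm h)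
    exact ⟨_, g, by rw [clG, hg, hA]⟩

lemma invC_sext {f1 : V →ₗ[F] V} {f2 : V' →ₗ[F] V'} {h : V' →ₗ[F] V} :
    InvC (cl (sext f1 f2 h)) ↔ InvC (cl f1) ∧ InvC (cl f2) := by
  rw [invC_cl, invC_cl, invC_cl]
  constructor
  · intro hs
    have h1 : Function.Injective f1 := by
      intro x y hxy
      have := @hs (x, 0) (y, 0) (by simp [hxy])
      exact congrArg Prod.fst this
    refine ⟨h1, ?_⟩
    rw [injective_iff_map_eq_zero]
    intro y hy
    have hsurj := (LinearMap.injective_iff_surjective (f := f1)).1 h1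
    obtain ⟨x, hx⟩ := hsurj (- h y)
    have := @hs (x, y) 0 (by simp [hx, hy])
    exact congrArg Prod.snd this
  · rintro ⟨h1, h2⟩
    rw [injective_iff_map_eq_zero]
    rintro ⟨x, y⟩ hxy
    simp only [sext_apply, Prod.mk_eq_zero] at hxy
    have hy : y = 0 := h2 (by rw [hxy.2, map_zero])
    subst hy
    have hx : x = 0 := h1 (by rw [map_zero]; simpa using hxy.1)
    rw [hx]; rfl

lemma invC_RQ {f : V →ₗ[F] V} {W : Submodule F V} (hW : IsInv f W) :
    InvC (cR f W) → InvC (cQ f W) → InvC (cl f) := by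
  rw [cR_def hW, cQ_def hW, invC_cl, invC_cl, invC_cl]
  intro h1 h2
  rw [injective_iff_map_eq_zero]
  intro x hx
  have h3 : W.mkQ x = 0 := by
    apply h2
    rw [map_zero]
    change W.mkQ (f x) = 0
    rw [hx, map_zero]
  have h4 : x ∈ W := by simpa using h3
  have h5 : (⟨x, h4⟩ : W) = 0 := by
    apply h1
    rw [map_zero]
    exact Subtype.ext hx
  exact congrArg Subtype.val h5
end

lemma hd_supp {φ : Cls F → ℂ} (h : ∀ c, ¬ InvC c → φ c = 0) (a b : Cls F) (hab : ¬ (InvC a ∧ InvC b)) :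
    hd φ a b = 0 := by
  induction a using cl_ind with | h V f
  induction b using cl_ind with | h V' f'
  rw [hd_cl, Finset.sum_eq_zero, mul_zero]
  intro g _
  exact h _ (by rwa [invC_sext])

lemma hm_supp {Φ : Cls F → Cls F → ℂ} (h : ∀ a b, ¬ (InvC a ∧ InvC b) → Φ a b = 0) (c : Cls F) (hc : ¬ InvC c) :
    hm Φ c = 0 := by
  induction c using cl_ind with | h V f
  rw [hm_cl, Finset.sum_eq_zero]
  intro W _
  split_ifs with hW
  · exact h _ _ fun hh => hc (invC_RQ hW hh.1 hh.2)
  · rfl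

lemma Sf_supp : ∀ (n : ℕ) (φ : Cls F → ℂ), (∀ c, ¬ InvC c → φ c = 0) → ∀ c : Cls F, c.dim = n → ¬ InvC c → Sf φ c = 0 := by
  intro n
  induction n using Nat.strong_induction_on with
  | _ n ih =>
  intro φ h c hcn hc
  by_cases hn : c.dim = 0
  · rw [Sf_zero _ _ hn, h c hc]
  rw [Sf_rec _ _ hn, neg_eq_zero]
  rw [hm_congr' (Φ' := fun a b => if a.dim + b.dim = n then if b.dim = 0 then 0 else Sf (fun x => hd φ x b) a else 0)]
  · refine hm_supp (fun a b hab => ?_) c hc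
    split_ifs with h1 h2
    · rfl
    · by_cases hb : InvC b
      · refine ih a.dim (by omega) _ (fun x hx => hd_supp h _ _ fun h3 => hx h3.1) a rfl fun ha => hab ⟨ha, hb⟩
      · rw [Sf_congr (ψ := fun _ => 0) a (fun x _ => hd_supp h _ _ fun h3 => hb h3.2), Sf_const_zero]
    · rfl
  · intro a b hab
    beta_reduce
    rw [if_pos (show a.dim + b.dim = n by omega)]

lemma clG_conj {n : ℕ} {g h : GL (Fin n) F} (e : clG g = clG h) : ∃ x : GL (Fin n) F, x * g * x⁻¹ = h := by
  obtain ⟨e, he⟩ := cl_eq_iff.1 e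
  obtain ⟨x, hx⟩ := exists_gl (A := (e : (Fin n → F) →ₗ[F] (Fin n → F))) e.injective
  refine ⟨x, ?_⟩
  rw [mul_inv_eq_iff_eq_mul]
  apply Units.ext
  apply Matrix.toLin'.injective
  rw [Units.val_mul, Units.val_mul, Matrix.toLin'_mul, Matrix.toLin'_mul, hx]
  exact LinearMap.ext he

lemma clG_conj' {n : ℕ} (g x : GL (Fin n) F) : clG (x * g * x⁻¹) = clG g := by
  symm
  let e : (Fin n → F) ≃ₗ[F] (Fin n → F) := LinearEquiv.ofInjectiveEndo (Matrix.toLin' x.1) (gl_inj x)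
  refine cl_eq e fun y => ?_
  have h : (Matrix.toLin' x.1).comp (Matrix.toLin' g.1) =
      (Matrix.toLin' (x * g * x⁻¹).1).comp (Matrix.toLin' x.1) := by
    rw [← Matrix.toLin'_mul, ← Matrix.toLin'_mul, ← Units.val_mul, ← Units.val_mul]
    congr 2
    group
  exact LinearMap.congr_fun h y

/-- extension by zero -/
noncomputable def extn {n : ℕ} (θ : GL (Fin n) F → ℂ) (c : Cls F) : ℂ :=
  if h : ∃ g : GL (Fin n) F, clG g = c then θ h.choose else 0

def IsCl {n : ℕ} (θ : GL (Fin n) F → ℂ) : Prop := ∀ g x, θ (x * g * x⁻¹) = θ g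

lemma extn_clG {n : ℕ} {θ : GL (Fin n) F → ℂ} (hθ : IsCl θ) (g : GL (Fin n) F) : extn θ (clG g) = θ g := by
  have h : ∃ g' : GL (Fin n) F, clG g' = clG g := ⟨g, rfl⟩
  rw [extn, dif_pos h]
  obtain ⟨x, hx⟩ := clG_conj h.choose_spec
  exact (hθ _ x).symm.trans (congrArg θ hx)

lemma extn_supp {n : ℕ} (θ : GL (Fin n) F → ℂ) (c : Cls F) (hc : ¬ InvC c) : extn θ c = 0 := by
  rw [extn, dif_neg]
  rintro ⟨g, hg⟩
  exact hc ⟨n, g, hg⟩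

lemma invC_dim {n : ℕ} {c : Cls F} (hc : InvC c) (hn : c.dim = n) : ∃ g : GL (Fin n) F, clG g = c := by
  obtain ⟨m, g, rfl⟩ := hc
  rw [dim_clG] at hn
  subst hn
  exact ⟨g, rfl⟩

lemma ext_dim {n : ℕ} {φ ψ : Cls F → ℂ} (h1 : ∀ c, ¬ InvC c → φ c = 0) (h2 : ∀ c, ¬ InvC c → ψ c = 0)
    (h : ∀ g : GL (Fin n) F, φ (clG g) = ψ (clG g)) (c : Cls F) (hc : c.dim = n) : φ c = ψ c := by
  by_cases hi : InvC c
  · obtain ⟨g, rfl⟩ := invC_dim hi hc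
    exact h g
  · rw [h1 c hi, h2 c hi]

lemma card_lin (n : ℕ) : Nat.card ((Fin n → F) ≃ₗ[F] (Fin n → F)) = Nat.card (GL (Fin n) F) :=
  Nat.card_congr ((Matrix.GeneralLinearGroup.toLin (n := Fin n) (R := F)).toEquiv.trans
    (LinearMap.GeneralLinearGroup.generalLinearEquiv F (Fin n → F)).toEquiv).symm

lemma av_eq [Fintype (GL (Fin n) F)] {ψ : Cls F → ℂ} (h : ∀ c, ¬ InvC c → ψ c = 0) :
    av n ψ = (Nat.card (GL (Fin n) F) : ℂ)⁻¹ * ∑ g : GL (Fin n) F, ψ (clG g) := by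
  rw [av, card_lin]
  congr 1
  symm
  refine Fintype.sum_of_injective (fun g : GL (Fin n) F => Matrix.toLin' g.1) ?_ _ _ ?_ ?_
  · intro g g' hg
    exact Units.ext (Matrix.toLin'.injective hg)
  · intro A hA
    refine h _ fun hi => hA ?_
    exact exists_gl (invC_cl.1 hi)
  · intro g; rfl

lemma irr_isCl {n : ℕ} (χ : Irr (GL (Fin n) F)) : IsCl χ.1 := fun g x => irr_class χ.2 g x

lemma cip_av {n : ℕ} [Fintype (GL (Fin n) F)] (φ : Cls F → ℂ) (χ : GL (Fin n) F → ℂ) (hχ : IsCl χ) :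
    cip (fun g => φ (clG g)) χ = av n (fun c => φ c * conj (extn χ c)) := by
  rw [av_eq (n := n) (fun c hc => by rw [extn_supp χ c hc]; simp), cip]
  simp only [extn_clG hχ]
end PartC1

set_option linter.unusedSectionVars false
section PartC2
attribute [local instance 10] Fintype.ofFinite
attribute [local instance 10] Classical.propDecidable
open Matrix ComplexConjugate
variable {F : Type} [Field F] [Finite F]

/-- parabolic group -/
@[ext] structure Par (F : Type) [Field F] (k l : ℕ) where
  a : GL (Fin k) F
  d : GL (Fin l) F
  b : Matrix (Fin k) (Fin l) F

variable {k l : ℕ}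
noncomputable instance : Mul (Par F k l) := ⟨fun x y => ⟨x.a * y.a, x.d * y.d, x.a.1 * y.b + x.b * y.d.1⟩⟩
noncomputable instance : One (Par F k l) := ⟨⟨1, 1, 0⟩⟩
noncomputable instance : Inv (Par F k l) := ⟨fun x => ⟨x.a⁻¹, x.d⁻¹, -(x.a⁻¹.1 * x.b * x.d⁻¹.1)⟩⟩
lemma Par.mul_def (x y : Par F k l) : x * y = ⟨x.a * y.a, x.d * y.d, x.a.1 * y.b + x.b * y.d.1⟩ := rfl
lemma Par.one_def : (1 : Par F k l) = ⟨1, 1, 0⟩ := rfl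
lemma Par.inv_def (x : Par F k l) : x⁻¹ = ⟨x.a⁻¹, x.d⁻¹, -(x.a⁻¹.1 * x.b * x.d⁻¹.1)⟩ := rfl
noncomputable instance : Group (Par F k l) := Group.ofLeftAxioms
  (by
    intro x y z
    simp only [Par.mul_def, mul_assoc, Units.val_mul, Matrix.mul_add, Matrix.add_mul, Matrix.mul_assoc, add_assoc])
  (by intro x; simp [Par.mul_def, Par.one_def])
  (by
    intro x
    simp only [Par.mul_def, Par.one_def, Par.inv_def, inv_mul_cancel, Matrix.neg_mul, Matrix.mul_assoc]
    congr 1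
    rw [← Units.val_mul, inv_mul_cancel]; simp)

def parE : Par F k l ≃ GL (Fin k) F × GL (Fin l) F × Matrix (Fin k) (Fin l) F where
  toFun x := (x.a, x.d, x.b)
  invFun y := ⟨y.1, y.2.1, y.2.2⟩
  left_inv _ := rfl
  right_inv _ := rfl
instance : Finite (Par F k l) := Finite.of_equiv _ parE.symm

noncomputable def parA : Par F k l →* GL (Fin k) F := ⟨⟨fun x => x.a, rfl⟩, fun _ _ => rfl⟩
noncomputable def parD : Par F k l →* GL (Fin l) F := ⟨⟨fun x => x.d, rfl⟩, fun _ _ => rfl⟩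
noncomputable def parM : Par F k l →* Matrix (Fin (k + l)) (Fin (k + l)) F where
  toFun x := Matrix.reindex finSumFinEquiv finSumFinEquiv (Matrix.fromBlocks x.a.1 x.b 0 x.d.1)
  map_one' := by
    change Matrix.reindex _ _ (Matrix.fromBlocks 1 0 0 1) = 1
    rw [Matrix.fromBlocks_one]; simp
  map_mul' x y := by
    simp [Par.mul_def, Matrix.submatrix_mul_equiv, Matrix.fromBlocks_multiply]
noncomputable def parG : Par F k l →* GL (Fin (k + l)) F := parM.toHomUnits

lemma clG_parG (x : Par F k l) : clG (parG x) = cl (sext (Matrix.toLin' x.a.1) (Matrix.toLin' x.d.1) (Matrix.toLin' x.b)) := by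
  rw [← cl_fromBlocks, clG]
  exact cl_reindex finSumFinEquiv _

lemma hd_clG (χ : GL (Fin (k + l)) F → ℂ) (hχ : IsCl χ) (g1 : GL (Fin k) F) (g2 : GL (Fin l) F) :
    hd (extn χ) (clG g1) (clG g2) = (Nat.card (Matrix (Fin k) (Fin l) F) : ℂ)⁻¹ *
      ∑ B : Matrix (Fin k) (Fin l) F, χ (parG ⟨g1, g2, B⟩) := by
  rw [clG, clG, hd_cl, Nat.card_congr (Matrix.toLin' (R := F) (m := Fin k) (n := Fin l)).symm.toEquiv]
  congr 1
  rw [← Equiv.sum_comp (Matrix.toLin' (R := F) (m := Fin k) (n := Fin l)).toEquiv]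
  refine Finset.sum_congr rfl fun B _ => ?_
  rw [← extn_clG hχ, clG_parG]
  rfl

lemma par_int (χ : Irr (GL (Fin (k + l)) F)) (χ1 : Irr (GL (Fin k) F)) (χ2 : Irr (GL (Fin l) F)) :
    ∃ N : ℕ, cip (fun x : Par F k l => χ.1 (parG x)) (fun x => χ1.1 (parA x) * χ2.1 (parD x)) = N := by
  obtain ⟨χ, h⟩ := χ
  obtain ⟨χ1, h1⟩ := χ1
  obtain ⟨χ2, h2⟩ := χ2
  obtain ⟨V, _, _, _, ρ, hρ, rfl⟩ := (isIrrChar_iff _).1 h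
  obtain ⟨V1, _, _, _, ρ1, hρ1, rfl⟩ := (isIrrChar_iff _).1 h1
  obtain ⟨V2, _, _, _, ρ2, hρ2, rfl⟩ := (isIrrChar_iff _).1 h2
  let σ1 : Representation ℂ (Par F k l) V1 := ρ1.comp parA
  let σ2 : Representation ℂ (Par F k l) V2 := ρ2.comp parD
  let σ : Representation ℂ (Par F k l) V := ρ.comp parG
  obtain ⟨N, hN⟩ := cip_char σ (Representation.tprod σ1 σ2)
  refine ⟨N, ?_⟩
  rw [← hN, Representation.char_tensor]
  rfl

lemma cip_swap_sum {G : Type} [Group G] [Fintype G] {ι : Type*} (s : Finset ι) (c : ι → ℂ) (f : ι → G → ℂ) (h : G → ℂ) :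
    cip (fun g => ∑ i ∈ s, c i * f i g) h = ∑ i ∈ s, c i * cip (f i) h := by
  unfold cip
  simp_rw [Finset.sum_mul, Finset.mul_sum]
  rw [Finset.sum_comm]
  refine Finset.sum_congr rfl fun i _ => Finset.sum_congr rfl fun g _ => by ring

lemma hd_expand (χ : Irr (GL (Fin (k + l)) F)) : ∃ N : Irr (GL (Fin k) F) → Irr (GL (Fin l) F) → ℕ,
    ∀ g1 g2, hd (extn χ.1) (clG g1) (clG g2) = ∑ i, ∑ j, (N i j : ℂ) * (i.1 g1 * j.1 g2) := by
  choose N hN using fun (χ1 : Irr (GL (Fin k) F)) (χ2 : Irr (GL (Fin l) F)) => par_int χ χ1 χ2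
  refine ⟨N, fun g1 g2 => ?_⟩
  rw [irr_expand (fun g1 => hd (extn χ.1) (clG g1) (clG g2)) (fun g h => by simp only [clG_conj'])]
  refine Finset.sum_congr rfl fun i _ => ?_
  have h1 : cip (fun g1 => hd (extn χ.1) (clG g1) (clG g2)) i.1 = ∑ j, (N i j : ℂ) * j.1 g2 := by
    rw [irr_expand (fun g2 => cip (fun g1 => hd (extn χ.1) (clG g1) (clG g2)) i.1) (fun g h => by simp only [clG_conj'])]
    refine Finset.sum_congr rfl fun j _ => ?_
    congr 1
    rw [← hN]
    unfold cip
    simp only [hd_clG χ.1 (irr_isCl χ), Nat.card_congr (parE (F := F) (k := k) (l := l)), Nat.card_prod]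
    rw [← Equiv.sum_comp (parE (F := F) (k := k) (l := l)).symm, Fintype.sum_prod_type]
    simp only [Fintype.sum_prod_type, Finset.mul_sum, Finset.sum_mul]
    rw [Finset.sum_comm]
    refine Finset.sum_congr rfl fun a _ => Finset.sum_congr rfl fun d _ => Finset.sum_congr rfl fun B _ => ?_
    simp only [parE, Equiv.coe_fn_symm_mk, parA, parD, MonoidHom.coe_mk, OneHom.coe_mk, map_mul, Nat.cast_mul,
      mul_inv]
    ring
  rw [h1, Finset.sum_mul]
  exact Finset.sum_congr rfl fun j _ => by ring

lemma hd_expand' (χ : Irr (GL (Fin (k + l)) F)) : ∃ N : Irr (GL (Fin k) F) → Irr (GL (Fin l) F) → ℕ,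
    ∀ a b : Cls F, a.dim = k → b.dim = l → hd (extn χ.1) a b = ∑ i, ∑ j, (N i j : ℂ) * (extn i.1 a * extn j.1 b) := by
  obtain ⟨N, hN⟩ := hd_expand χ
  refine ⟨N, fun a b ha hb => ?_⟩
  by_cases h : InvC a ∧ InvC b
  · obtain ⟨g1, rfl⟩ := invC_dim h.1 ha
    obtain ⟨g2, rfl⟩ := invC_dim h.2 hb
    rw [hN]
    simp only [extn_clG (irr_isCl _)]
  · rw [hd_supp (extn_supp χ.1) a b h]
    symm
    refine Finset.sum_eq_zero fun i _ => Finset.sum_eq_zero fun j _ => ?_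
    rw [not_and_or] at h
    rcases h with h | h
    · rw [extn_supp i.1 a h]; simp
    · rw [extn_supp j.1 b h]; simp

lemma av_sum {ι : Type*} (n : ℕ) (s : Finset ι) (w : ι → ℂ) (φ : ι → Cls F → ℂ) :
    av n (fun c => ∑ i ∈ s, w i * φ i c) = ∑ i ∈ s, w i * av n (φ i) := by
  unfold av
  simp_rw [Finset.mul_sum]
  rw [Finset.sum_comm]
  exact Finset.sum_congr rfl fun _ _ => Finset.sum_congr rfl fun _ _ => by ring

def IsI (z : ℂ) : Prop := z ∈ (Int.castRingHom ℂ).range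
lemma isI_nat (n : ℕ) : IsI (n : ℂ) := ⟨n, by simp⟩
lemma isI_mul {x y : ℂ} (hx : IsI x) (hy : IsI y) : IsI (x * y) := Subring.mul_mem _ hx hy
lemma isI_neg {x : ℂ} (hx : IsI x) : IsI (-x) := Subring.neg_mem _ hx
lemma isI_zero : IsI 0 := Subring.zero_mem _
lemma isI_sum {ι : Type*} (s : Finset ι) (f : ι → ℂ) (h : ∀ i ∈ s, IsI (f i)) : IsI (∑ i ∈ s, f i) :=
  Subring.sum_mem _ h

lemma av_irr {n : ℕ} (χ χ' : Irr (GL (Fin n) F)) : IsI (av n (fun c => extn χ.1 c * conj (extn χ'.1 c))) := by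
  rw [← cip_av (extn χ.1) χ'.1 (irr_isCl χ')]
  have : (fun g => extn χ.1 (clG g)) = χ.1 := by
    funext g; rw [extn_clG (irr_isCl χ)]
  rw [this, irr_ortho χ.2 χ'.2]
  split_ifs
  · simpa using isI_nat 1
  · exact isI_zero

lemma Sf_int : ∀ (n : ℕ) (χ χ' : Irr (GL (Fin n) F)), IsI (av n (fun c => Sf (extn χ.1) c * conj (extn χ'.1 c))) := by
  intro n
  induction n using Nat.strong_induction_on with
  | _ n ih =>
  intro χ χ'
  by_cases hn : n = 0
  · have : av n (fun c => Sf (extn χ.1) c * conj (extn χ'.1 c)) = av n (fun c => extn χ.1 c * conj (extn χ'.1 c)) :=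
      av_congr n fun c hc => by rw [Sf_zero (extn χ.1) c (by omega)]
    rw [this]
    exact av_irr χ χ'
  have h1 : av n (fun c => Sf (extn χ.1) c * conj (extn χ'.1 c)) =
      - av n (fun c => hm (fun a b => if b.dim = 0 then 0 else Sf (fun x => hd (extn χ.1) x b) a) c *
        conj (extn χ'.1 c)) := by
    rw [← av_neg]
    refine av_congr n fun c hc => ?_
    rw [Sf_rec _ _ (by omega)]; ring
  rw [h1, adjoint]
  refine isI_neg (isI_sum _ _ ?_)
  rintro ⟨k, l⟩ hkl
  rw [Finset.HasAntidiagonal.mem_antidiagonal] at hkl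
  simp only at hkl ⊢
  subst hkl
  by_cases hl : l = 0
  · have : av l (fun b : Cls F => av k (fun a => (if b.dim = 0 then 0 else Sf (fun x => hd (extn χ.1) x b) a) *
        hd (fun c => conj (extn χ'.1 c)) a b)) = av l (fun _ : Cls F => (0:ℂ)) := by
      refine av_congr l fun b hb => ?_
      refine Eq.trans ?_ (av_zero (F := F) k)
      refine av_congr k fun a ha => ?_
      rw [if_pos (by omega), zero_mul]
    rw [this, av_zero]; exact isI_zero
  obtain ⟨N, hN⟩ := hd_expand' χ
  obtain ⟨N', hN'⟩ := hd_expand' χ'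
  let P := (Irr (GL (Fin k) F) × Irr (GL (Fin l) F)) × (Irr (GL (Fin k) F) × Irr (GL (Fin l) F))
  have h2 : av l (fun b : Cls F => av k (fun a => (if b.dim = 0 then 0 else Sf (fun x => hd (extn χ.1) x b) a) *
        hd (fun c => conj (extn χ'.1 c)) a b)) =
      ∑ p : P, ((N p.1.1 p.1.2 : ℂ) * N' p.2.1 p.2.2 * av k (fun a => Sf (extn p.1.1.1) a * conj (extn p.2.1.1 a))) *
        av l (fun b => extn p.1.2.1 b * conj (extn p.2.2.1 b)) := by
    rw [← av_sum]
    refine av_congr l fun b hb => ?_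
    have h4 : ∀ a : Cls F, a.dim = k → (if b.dim = 0 then 0 else Sf (fun x => hd (extn χ.1) x b) a) *
        hd (fun c => conj (extn χ'.1 c)) a b = ∑ p : P, ((N p.1.1 p.1.2 : ℂ) * N' p.2.1 p.2.2 *
          (extn p.1.2.1 b * conj (extn p.2.2.1 b))) * (Sf (extn p.1.1.1) a * conj (extn p.2.1.1 a)) := by
      intro a ha
      rw [if_neg (by omega), hd_conj, hN' a b ha hb]
      have h5 : Sf (fun x => hd (extn χ.1) x b) a = ∑ p : Irr (GL (Fin k) F) × Irr (GL (Fin l) F),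
            ((N p.1 p.2 : ℂ) * extn p.2.1 b) * Sf (extn p.1.1) a := by
        rw [← Sf_sum]
        refine Sf_congr a fun x hx => ?_
        rw [hN x b (by omega) hb, Fintype.sum_prod_type]
        exact Finset.sum_congr rfl fun _ _ => Finset.sum_congr rfl fun _ _ => by ring
      rw [h5, Finset.sum_mul]
      change _ = ∑ p : (Irr (GL (Fin k) F) × Irr (GL (Fin l) F)) × (Irr (GL (Fin k) F) × Irr (GL (Fin l) F)), _
      rw [Fintype.sum_prod_type (α₁ := Irr (GL (Fin k) F) × Irr (GL (Fin l) F))]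
      refine Finset.sum_congr rfl fun p _ => ?_
      rw [← Fintype.sum_prod_type', map_sum, Finset.mul_sum]
      refine Finset.sum_congr rfl fun p' _ => ?_
      simp only [map_mul, Complex.conj_natCast]
      ring
    rw [av_congr k h4, av_sum]
    exact Finset.sum_congr rfl fun p _ => by ring
  rw [h2]
  refine isI_sum _ _ fun p _ => ?_
  exact isI_mul (isI_mul (isI_mul (isI_nat _) (isI_nat _)) (ih k (by omega) _ _)) (av_irr _ _)

/-- the dual of an irreducible character is up to sign an irreducible character -/
lemma Sf_irr {n : ℕ} (χ : Irr (GL (Fin n) F)) : ∃ (χ' : Irr (GL (Fin n) F)) (ε : ℂ), (ε = 1 ∨ ε = -1) ∧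
    ∀ g, χ.1 g = ε * Sf (extn χ'.1) (clG g) := by
  -- expansion of the dual
  have hcl : ∀ χ : Irr (GL (Fin n) F), IsCl (fun g : GL (Fin n) F => Sf (extn χ.1) (clG g)) := fun χ g x => by simp only [clG_conj']
  have hs : ∀ χ χ' : Irr (GL (Fin n) F), IsI (cip (fun g : GL (Fin n) F => Sf (extn χ.1) (clG g)) χ'.1) := by
    intro χ χ'
    rw [cip_av _ _ (irr_isCl χ')]
    exact Sf_int n χ χ'
  have hsup : ∀ c : Cls F, c.dim = n → ¬ InvC c → Sf (extn χ.1) c = 0 := fun c hc h =>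
    Sf_supp n (extn χ.1) (extn_supp χ.1) c hc h
  set D : GL (Fin n) F → ℂ := fun g => Sf (extn χ.1) (clG g) with hD
  have hexD : ∀ c : Cls F, c.dim = n → extn D c = Sf (extn χ.1) c := by
    intro c hc
    by_cases h : InvC c
    · obtain ⟨g, rfl⟩ := invC_dim h hc
      rw [extn_clG (hcl χ)]
    · rw [extn_supp D c h, hsup c hc h]
  have hnorm : cip D D = 1 := by
    rw [cip_av _ _ (hcl χ)]
    have e1 : av n (fun c => Sf (extn χ.1) c * conj (extn D c)) =
        av n (fun c => Sf (extn χ.1) c * Sf (fun x => conj (extn χ.1 x)) c) :=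
      av_congr n fun c hc => by rw [hexD c hc, Sf_conj]
    rw [e1, ← Sf_selfadj]
    have e2 : av n (fun c => Sf (Sf (extn χ.1)) c * conj (extn χ.1 c)) =
        av n (fun c => extn χ.1 c * conj (extn χ.1 c)) :=
      av_congr n fun c hc => by rw [Sf_sq n _ c hc]
    rw [e2, ← cip_av _ _ (irr_isCl χ)]
    have : (fun g => extn χ.1 (clG g)) = χ.1 := by
      funext g; rw [extn_clG (irr_isCl χ)]
    rw [this, irr_ortho χ.2 χ.2, if_pos rfl]
  choose s hs' using hs χ
  have hs : ∀ χ', cip D χ'.1 = (s χ' : ℂ) := fun χ' => (hs' χ').symm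
  have hex : ∀ g, D g = ∑ χ', (s χ' : ℂ) * χ'.1 g := by
    intro g
    rw [irr_expand D (hcl χ) g]
    exact Finset.sum_congr rfl fun χ' _ => by rw [hs]
  have hsq : ∑ χ', (s χ') ^ 2 = 1 := by
    have e : cip D D = ∑ χ', ((s χ' : ℂ)) ^ 2 := by
      have e3 : ∀ χ' : Irr (GL (Fin n) F), cip χ'.1 D = s χ' := by
        intro χ'
        have : cip χ'.1 D = conj (cip D χ'.1) := by
          unfold cip
          rw [map_mul, map_sum]
          simp [mul_comm]
        rw [this, hs]; simp
      have : D = fun g => ∑ χ', (s χ' : ℂ) * χ'.1 g := funext hex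
      conv_lhs => rw [this]
      rw [cip_swap_sum, ← this]
      exact Finset.sum_congr rfl fun χ' _ => by rw [e3]; ring
    rw [hnorm] at e
    exact_mod_cast e.symm
  obtain ⟨χ', hχ'⟩ : ∃ χ', s χ' ≠ 0 := by
    by_contra! h
    simp [h] at hsq
  have h1 : s χ' ^ 2 + ∑ x ∈ Finset.univ.erase χ', s x ^ 2 = 1 := by
    rw [Finset.add_sum_erase _ (fun x => s x ^ 2) (Finset.mem_univ χ'), hsq]
  have h2 : 0 ≤ ∑ x ∈ Finset.univ.erase χ', s x ^ 2 := Finset.sum_nonneg fun _ _ => sq_nonneg _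
  have h3 : 0 < s χ' ^ 2 := by positivity
  have h4 : ∑ x ∈ Finset.univ.erase χ', s x ^ 2 = 0 := by omega
  have h5 : s χ' ^ 2 = 1 := by omega
  rw [Finset.sum_eq_zero_iff_of_nonneg (fun _ _ => sq_nonneg _)] at h4
  have hDχ : ∀ g, D g = (s χ' : ℂ) * χ'.1 g := by
    intro g
    rw [hex, Finset.sum_eq_single χ']
    · intro x _ hx
      have := h4 x (by simp [hx])
      rw [sq_eq_zero_iff] at this
      simp [this]
    · simp
  refine ⟨χ', (s χ' : ℂ), ?_, ?_⟩
  · rcases (show s χ' = 1 ∨ s χ' = -1 from by rcases (mul_eq_zero.1 (show (s χ' - 1) * (s χ' + 1) = 0 by linarith [h5, sq (s χ')])) with h | h <;> omega) with h | h <;> simp [h]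
  · intro g
    have e1 : Sf (Sf (extn χ.1)) (clG g) = χ.1 g := by
      rw [Sf_sq n _ _ (dim_clG g), extn_clG (irr_isCl χ)]
    rw [← e1]
    have e2 : Sf (Sf (extn χ.1)) (clG g) = Sf (fun c => ∑ i ∈ ({0} : Finset ℕ), (s χ' : ℂ) * extn χ'.1 c) (clG g) := by
      refine Sf_congr _ fun c hc => ?_
      rw [dim_clG] at hc
      rw [Finset.sum_singleton]
      by_cases h : InvC c
      · obtain ⟨g, rfl⟩ := invC_dim h hc
        rw [extn_clG (irr_isCl χ')]
        exact hDχ g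
      · rw [hsup c hc h, extn_supp _ c h, mul_zero]
    rw [e2, Sf_sum, Finset.sum_singleton]
end PartC2

section PartF1
open Matrix
attribute [local instance 10] Fintype.ofFinite
attribute [local instance 10] Classical.propDecidable

section layered
variable {n : ℕ} (π : Equiv.Perm (Fin n)) {T : Type*} (t : Fin n → T)
  (h : ∀ j k : Fin n, (k : ℕ) = j + 1 → (π j : ℕ) ≤ π k + 1 ∧ ((π j : ℕ) = π k + 1 → t j = t k))
include h

lemma lay_ivt : ∀ (m : ℕ) (j k : Fin n), (k : ℕ) = j + m → ∀ v : ℕ, v ≤ π j → (π k : ℕ) ≤ v →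
    ∃ i : Fin n, j ≤ i ∧ i ≤ k ∧ (π i : ℕ) = v := by
  intro m
  induction m with
  | zero =>
    intro j k hk v hv hv'
    have : j = k := Fin.ext (by omega)
    subst this
    exact ⟨j, le_rfl, le_rfl, by omega⟩
  | succ m ih =>
    intro j k hk v hv hv'
    by_cases e : (π j : ℕ) = v
    · exact ⟨j, le_rfl, by rw [Fin.le_def]; omega, e⟩
    · have hj : (j : ℕ) + 1 < n := by omega
      have := (h j ⟨j + 1, hj⟩ rfl).1
      obtain ⟨i, h1, h2, h3⟩ := ih ⟨j + 1, hj⟩ k (by simp only; omega) v (by omega) hv'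
      refine ⟨i, ?_, h2, h3⟩
      rw [Fin.le_def] at h1 ⊢
      simp only at h1; omega

lemma lay_inv : ∀ (m : ℕ) (j k : Fin n), (k : ℕ) = j + m → π k < π j →
    (π j : ℕ) + j = π k + k ∧ t j = t k := by
  intro m
  induction m with
  | zero =>
    intro j k hk hv
    have : j = k := Fin.ext (by omega)
    subst this
    exact absurd hv (lt_irrefl _)
  | succ m ih =>
    intro j k hk hv
    rw [Fin.lt_def] at hv
    have hj : (j : ℕ) + 1 < n := by omega
    have h0 := h j ⟨j + 1, hj⟩ rfl
    have h1 : (π ⟨j + 1, hj⟩ : ℕ) ≠ π j := fun e => by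
      have := congrArg Fin.val (π.injective (Fin.ext e)); simp at this
    have h2 : (π j : ℕ) = π ⟨j + 1, hj⟩ + 1 := by
      by_contra hne
      obtain ⟨i, h3, h4, h5⟩ := lay_ivt π t h m ⟨j + 1, hj⟩ k (by simp only; omega) (π j) (by omega) (by omega)
      have := congrArg Fin.val (π.injective (Fin.ext h5))
      rw [Fin.le_def] at h3
      simp only at h3; omega
    have h6 := h0.2 h2
    by_cases e : (k : ℕ) = j + 1
    · have : k = ⟨j + 1, hj⟩ := Fin.ext e
      subst this
      exact ⟨by simp only; omega, h6⟩
    · have hne : (π k : ℕ) ≠ π ⟨j + 1, hj⟩ := fun e' => by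
        have := congrArg Fin.val (π.injective (Fin.ext e')); simp only at this; omega
      obtain ⟨h7, h8⟩ := ih ⟨j + 1, hj⟩ k (by simp only; omega) (by rw [Fin.lt_def]; omega)
      simp only at h7
      exact ⟨by omega, h6.trans h8⟩

lemma lay_inv' {j k : Fin n} (hjk : j < k) (hv : π k < π j) : (π j : ℕ) + j = π k + k ∧ t j = t k :=
  lay_inv π t h (k - j) j k (by rw [Fin.lt_def] at hjk; omega) hv

omit h in
lemma lay_pig (S : Fin n → Prop) (m : Fin n) (hm : S m) (hm' : ¬ S (π m)) : ∃ x, S (π x) ∧ ¬ S x := by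
  by_contra! hc
  have hi : Function.Injective (fun x : {x // S x} => (⟨π.symm x.1, hc _ (by simpa using x.2)⟩ : {x // S x})) := by
    intro a b hab
    simpa [Subtype.ext_iff] using hab
  obtain ⟨y, hy⟩ := (Finite.injective_iff_surjective.1 hi) ⟨m, hm⟩
  rw [Subtype.ext_iff] at hy
  simp only at hy
  exact hm' (by rw [← hy]; simpa using y.2)

lemma layered (k : Fin n) : π (π k) = k ∧ t (π k) = t k := by
  rcases lt_trichotomy (π k) k with hl | hl | hl
  · set m := π.symm k with hm
    have hπm : π m = k := by simp [hm]
    have hmk : m ≠ k := by rintro e; rw [e] at hπm; rw [hπm] at hl; exact lt_irrefl _ hl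
    rcases lt_or_gt_of_ne hmk with h1 | h1
    · obtain ⟨a, b⟩ := lay_inv' π t h h1 (by rw [hπm]; exact hl)
      rw [hπm] at a
      have : m = π k := Fin.ext (by omega)
      rw [← this]; exact ⟨hπm, b⟩
    · obtain ⟨x, hx1, hx2⟩ := lay_pig π (fun x => k < x) m h1 (by simp [hπm])
      have hxk : x ≠ k := by rintro rfl; exact absurd hx1 (not_lt.2 hl.le)
      have hxk' : x < k := lt_of_le_of_ne (not_lt.1 hx2) hxk
      have a := (lay_inv' π t h hxk' (hl.trans hx1)).1
      have b := (lay_inv' π t h (hxk'.trans h1) (by rw [hπm]; exact hx1)).1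
      rw [hπm] at b
      rw [Fin.lt_def] at *
      omega
  · rw [hl]; exact ⟨hl, rfl⟩
  · set m := π.symm k with hm
    have hπm : π m = k := by simp [hm]
    have hmk : m ≠ k := by rintro e; rw [e] at hπm; rw [hπm] at hl; exact lt_irrefl _ hl
    rcases lt_or_gt_of_ne hmk with h1 | h1
    · obtain ⟨x, hx1, hx2⟩ := lay_pig π (fun x => x < k) m h1 (by simp [hπm])
      have hxk : x ≠ k := by rintro rfl; exact absurd hx1 (not_lt.2 hl.le)
      have hxk' : k < x := lt_of_le_of_ne (not_lt.1 hx2) hxk.symm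
      have a := (lay_inv' π t h hxk' (hx1.trans hl)).1
      have b := (lay_inv' π t h (h1.trans hxk') (by rw [hπm]; exact hx1)).1
      rw [hπm] at b
      rw [Fin.lt_def] at *
      omega
    · obtain ⟨a, b⟩ := lay_inv' π t h h1 (by rw [hπm]; exact hl)
      rw [hπm] at a
      have : m = π k := Fin.ext (by omega)
      rw [← this]; exact ⟨hπm, b.symm⟩
end layered

section Bruhat
variable {F : Type} [Field F] {n : ℕ}

def UT (A : Matrix (Fin n) (Fin n) F) : Prop := ∀ i j, j ≤ i → A i j = if j = i then 1 else 0

lemma UT_one : UT (1 : Matrix (Fin n) (Fin n) F) := fun i j _ => by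
  rw [Matrix.one_apply]; simp [eq_comm]

lemma UT_mul {A B : Matrix (Fin n) (Fin n) F} (hA : UT A) (hB : UT B) : UT (A * B) := by
  intro i j hij
  rw [Matrix.mul_apply]
  rw [Finset.sum_eq_single i]
  · rw [hA i i le_rfl, hB i j hij]; simp
  · intro k _ hk
    rcases lt_or_gt_of_ne hk with h | h
    · rw [hA i k h.le, if_neg hk, zero_mul]
    · rw [hB k j (hij.trans h.le), if_neg (hij.trans_lt h).ne, mul_zero]
  · simp

lemma UT_superdiag {A B : Matrix (Fin n) (Fin n) F} (hA : UT A) (hB : UT B) (i j : Fin n) (hj : (j : ℕ) = i + 1) :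
    (A * B) i j = A i j + B i j := by
  have hij : i ≠ j := fun e => by subst e; omega
  rw [Matrix.mul_apply, ← Finset.add_sum_erase _ _ (Finset.mem_univ i),
    ← Finset.add_sum_erase _ _ (show j ∈ Finset.univ.erase i by simp [hij.symm]), Finset.sum_eq_zero]
  · rw [hA i i le_rfl, hB j j le_rfl]; simp; ring
  · intro k hk
    simp only [Finset.mem_erase, Finset.mem_univ, and_true] at hk
    rcases lt_or_gt_of_ne hk.2 with h | h
    · rw [hA i k h.le, if_neg hk.2, zero_mul]
    · have : j < k := lt_of_le_of_ne (by rw [Fin.le_def]; rw [Fin.lt_def] at h; omega) hk.1.symm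
      rw [hB k j this.le, if_neg hk.1.symm, mul_zero]

/-- the first m columns are monomial -/
def MonTo (m : ℕ) (A : Matrix (Fin n) (Fin n) F) : Prop :=
  ∀ c : Fin n, (c : ℕ) < m → ∃ r, A r c ≠ 0 ∧ (∀ r', r' ≠ r → A r' c = 0) ∧ ∀ c', c' ≠ c → A r c' = 0

lemma bruhat (A : Matrix (Fin n) (Fin n) F) (hA : IsUnit A) (m : ℕ) (hm : m ≤ n) :
    ∃ B C : Matrix (Fin n) (Fin n) F, UT B ∧ UT C ∧ MonTo m (B * A * C) ∧ IsUnit (B * A * C) := by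
  induction m with
  | zero => exact ⟨1, 1, UT_one, UT_one, fun c hc => by omega, by simpa⟩
  | succ m ih =>
    obtain ⟨B, C, hB, hC, hM, hu⟩ := ih (by omega)
    generalize hg : B * A * C = g at *
    obtain ⟨j, hjm⟩ : ∃ j : Fin n, (j : ℕ) = m := ⟨⟨m, by omega⟩, rfl⟩
    have hex : ∃ i, g i j ≠ 0 := by
      by_contra! h
      obtain ⟨g', hg'⟩ := hu.exists_left_inv
      have : (g' * g) j j = 0 := by rw [Matrix.mul_apply]; simp [h]
      rw [hg'] at this; simp at this
    obtain ⟨i, hi, himax⟩ : ∃ i, g i j ≠ 0 ∧ ∀ i', i < i' → g i' j = 0 := by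
      obtain ⟨i, hi⟩ := (Finset.univ.filter (fun i => g i j ≠ 0)).exists_maximal (by
        obtain ⟨i, hi⟩ := hex; exact ⟨i, by simpa using hi⟩)
      refine ⟨i, by simpa using hi.1, fun i' hi' => ?_⟩
      by_contra hne
      exact absurd (hi.2 (by simpa using hne) hi'.le) (not_le.2 hi')
    have hrow : ∀ c : Fin n, c < j → g i c = 0 := by
      intro c hc
      obtain ⟨r, h1, h2, h3⟩ := hM c (by rw [Fin.lt_def] at hc; omega)
      by_cases e : i = r
      · subst e; exact absurd (h3 j hc.ne') hi
      · exact h2 i e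
    -- clearing matrices
    let P : Matrix (Fin n) (Fin n) F := fun a b => if a = b then 1 else if b = i then - g a j / g i j else 0
    let R : Matrix (Fin n) (Fin n) F := fun a b => if a = b then 1 else if a = j then - g i b / g i j else 0
    have hP : UT P := by
      intro a b hba
      by_cases e : a = b
      · simp [P, e]
      · have : b < a := lt_of_le_of_ne hba (Ne.symm e)
        by_cases e2 : b = i
        · subst e2; simp [P, e, himax a this, Ne.symm e]
        · simp [P, e, e2, Ne.symm e]
    have hR : UT R := by
      intro a b hba
      by_cases e : a = b
      · simp [R, e]
      · have : b < a := lt_of_le_of_ne hba (Ne.symm e)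
        by_cases e2 : a = j
        · subst e2; simp [R, e, hrow b this, Ne.symm e]
        · simp [R, e, e2, Ne.symm e]
    have hPg : ∀ a b, (P * g) a b = g a b + if a = i then 0 else - g a j / g i j * g i b := by
      intro a b
      rw [Matrix.mul_apply]
      by_cases e : a = i
      · subst e
        rw [Finset.sum_eq_single a]
        · simp [P]
        · intro k _ hk; simp [P, hk, Ne.symm hk]
        · simp
      · rw [← Finset.add_sum_erase _ _ (Finset.mem_univ a),
          ← Finset.add_sum_erase _ _ (show i ∈ Finset.univ.erase a by simp [Ne.symm e]), Finset.sum_eq_zero]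
        · simp [P, e]
        · intro k hk
          simp only [Finset.mem_erase, Finset.mem_univ, and_true] at hk
          simp [P, hk.1, Ne.symm hk.2]
    have hgR : ∀ (g' : Matrix (Fin n) (Fin n) F) a b, (g' * R) a b = g' a b + if b = j then 0 else g' a j * (- g i b / g i j) := by
      intro g' a b
      rw [Matrix.mul_apply]
      by_cases e : b = j
      · rw [e, Finset.sum_eq_single j]
        · simp [R]
        · intro k _ hk; simp [R, hk]
        · simp
      · rw [← Finset.add_sum_erase _ _ (Finset.mem_univ b),
          ← Finset.add_sum_erase _ _ (show j ∈ Finset.univ.erase b by simp [Ne.symm e]), Finset.sum_eq_zero]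
        · simp [R, e, Ne.symm e]
        · intro k hk
          simp only [Finset.mem_erase, Finset.mem_univ, and_true] at hk
          simp [R, hk.1, hk.2]
    have hPj : ∀ a, (P * g) a j = if a = i then g i j else 0 := by
      intro a
      rw [hPg]
      split_ifs with e
      · simp [e]
      · field_simp; ring
    have hfin : ∀ a b, (P * g * R) a b = if a = i then (if b = j then g i j else 0) else
        if b = j then 0 else g a b - g a j / g i j * g i b := by
      intro a b
      rw [hgR, hPj, hPg]
      split_ifs with e1 e2 e2
      · simp [e1, e2]
      · subst e1; field_simp; ring
      · subst e2; field_simp; ring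
      · ring
    refine ⟨P * B, C * R, UT_mul hP hB, UT_mul hC hR, ?_, ?_⟩
    · have : P * B * A * (C * R) = P * g * R := by rw [← hg]; simp only [Matrix.mul_assoc]
      rw [this]
      intro c hc
      by_cases e : c = j
      · subst e
        refine ⟨i, by rw [hfin]; simpa using hi, fun r' hr' => by rw [hfin]; simp [hr'], fun c' hc' => by rw [hfin]; simp [hc']⟩
      · have hcj : c < j := lt_of_le_of_ne (by rw [Fin.le_def]; omega) e
        obtain ⟨r, h1, h2, h3⟩ := hM c (by rw [Fin.lt_def] at hcj; omega)
        have hri : r ≠ i := by rintro rfl; exact h1 (hrow c hcj)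
        refine ⟨r, ?_, ?_, ?_⟩
        · rw [hfin, if_neg hri, if_neg e, hrow c hcj]; simpa using h1
        · intro r' hr'
          rw [hfin]
          split_ifs
          · rfl
          · rw [h2 r' hr', hrow c hcj]; simp
        · intro c' hc'
          rw [hfin, if_neg hri]
          split_ifs with e3
          · rfl
          · rw [h3 c' hc', h3 j (Ne.symm e)]; simp
    · have hdet : ∀ M : Matrix (Fin n) (Fin n) F, UT M → IsUnit M := by
        intro M hM
        rw [Matrix.isUnit_iff_isUnit_det, Matrix.det_of_isUpperTriangular]
        · simp [hM _ _ le_rfl]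
        · intro a b hab
          have hab : b < a := hab
          rw [hM a b (le_of_lt hab), if_neg (ne_of_lt hab)]
      have : P * B * A * (C * R) = P * g * R := by rw [← hg]; simp only [Matrix.mul_assoc]
      rw [this]
      exact ((hdet P hP).mul hu).mul (hdet R hR)
end Bruhat
end PartF1

section PartF2
open Matrix
attribute [local instance 10] Fintype.ofFinite
attribute [local instance 10] Classical.propDecidable

set_option linter.unusedSectionVars false
section Gelf
variable {G : Type} [Group G] [Finite G] (U : Subgroup G) (l : G → ℂ) {V : Type} [AddCommGroup V] [Module ℂ V]
  (ρ : Representation ℂ G V)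

noncomputable def Eop : V →ₗ[ℂ] V := (Nat.card U : ℂ)⁻¹ • ∑ u : U, l u • ρ u

variable (h1 : l 1 = 1) (hm : ∀ u ∈ U, ∀ v ∈ U, l (u * v) = l u * l v)
include h1 hm

lemma l_inv (u : G) (hu : u ∈ U) : l u * l u⁻¹ = 1 := by
  rw [← hm u hu _ (U.inv_mem hu), mul_inv_cancel, h1]

lemma rho_E (v : G) (hv : v ∈ U) : ρ v * Eop U l ρ = l v⁻¹ • Eop U l ρ := by
  unfold Eop
  rw [mul_smul_comm, smul_comm (l v⁻¹), Finset.mul_sum]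
  congr 1
  rw [Finset.smul_sum]
  apply Fintype.sum_equiv (Equiv.mulLeft (⟨v, hv⟩ : U))
  intro u
  simp only [Equiv.coe_mulLeft, Subgroup.coe_mul]
  rw [hm v hv u u.2, mul_smul_comm, map_mul, smul_smul, ← mul_assoc, mul_comm (l v⁻¹), l_inv U l h1 hm v hv, one_mul]

lemma E_rho (v : G) (hv : v ∈ U) : Eop U l ρ * ρ v = l v⁻¹ • Eop U l ρ := by
  unfold Eop
  rw [smul_mul_assoc, smul_comm (l v⁻¹), Finset.sum_mul]
  congr 1
  rw [Finset.smul_sum]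
  apply Fintype.sum_equiv (Equiv.mulRight (⟨v, hv⟩ : U))
  intro u
  simp only [Equiv.coe_mulRight, Subgroup.coe_mul]
  rw [hm u u.2 v hv, smul_mul_assoc, map_mul, smul_smul, mul_comm (l u), ← mul_assoc, mul_comm (l v⁻¹),
    l_inv U l h1 hm v hv, one_mul]

lemma E_sq : Eop U l ρ * Eop U l ρ = Eop U l ρ := by
  conv_lhs => enter [1]; unfold Eop
  rw [smul_mul_assoc, Finset.sum_mul]
  have : ∀ u : U, l u • ρ u * Eop U l ρ = Eop U l ρ := fun u => by
    rw [smul_mul_assoc, rho_E U l ρ h1 hm u u.2, smul_smul, l_inv U l h1 hm u u.2, one_smul]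
  rw [Finset.sum_congr rfl fun u _ => this u, Finset.sum_const, Finset.card_univ, ← Nat.card_eq_fintype_card,
    ← Nat.cast_smul_eq_nsmul ℂ, smul_smul, inv_mul_cancel₀, one_smul]
  exact_mod_cast Nat.card_pos.ne'

variable [FiniteDimensional ℂ V]

lemma gelf (hρ : ρ.IsIrreducible) (τ : G → G) (hτ : ∀ g h, τ (g * h) = τ h * τ g) (hτi : Function.Involutive τ)
    (hτU : ∀ u ∈ U, τ u ∈ U) (hτl : ∀ u ∈ U, l (τ u) = l u)
    (hT : ∀ g, Eop U l ρ * ρ g * Eop U l ρ = Eop U l ρ * ρ (τ g) * Eop U l ρ) :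
    LinearMap.trace ℂ V (Eop U l ρ) = 0 ∨ LinearMap.trace ℂ V (Eop U l ρ) = 1 := by
  set E := Eop U l ρ with hE
  have hEE : E * E = E := E_sq U l ρ h1 hm
  have hE2 : ∀ A, E * (E * A) = E * A := fun A => by rw [← mul_assoc, hEE]
  -- commutation
  have hexp : ∀ g h, E * ρ g * E * ρ h * E = (Nat.card U : ℂ)⁻¹ • ∑ u : U, l u • (E * ρ (g * u * h) * E) := by
    intro g h
    have : E * ρ g * E * ρ h * E = E * ρ g * Eop U l ρ * ρ h * E := rfl
    rw [this]
    unfold Eop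
    rw [mul_smul_comm, Finset.mul_sum, smul_mul_assoc, smul_mul_assoc, Finset.sum_mul, Finset.sum_mul]
    congr 1
    refine Finset.sum_congr rfl fun u _ => ?_
    simp only [map_mul, mul_smul_comm, smul_mul_assoc, mul_assoc]
  have hcomm : ∀ g h, E * ρ g * E * (E * ρ h * E) = E * ρ h * E * (E * ρ g * E) := by
    intro g h
    have e : ∀ g h, E * ρ g * E * (E * ρ h * E) = E * ρ g * E * ρ h * E := fun g h => by
      simp only [mul_assoc, hE2]
    have e2 : E * ρ g * E * ρ h * E = E * ρ (τ h) * E * ρ (τ g) * E := by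
      rw [hexp, hexp]
      congr 1
      refine Fintype.sum_equiv ⟨fun u : U => ⟨τ u, hτU u u.2⟩, fun u : U => ⟨τ u, hτU u u.2⟩,
        fun u => Subtype.ext (hτi u), fun u => Subtype.ext (hτi u)⟩ _ _ fun u => ?_
      simp only [Equiv.coe_fn_mk]
      rw [hT, hτ, hτ, hτl u u.2, mul_assoc (τ h)]
    rw [e, e2, ← e, ← hT, ← hT]
  have hirr : ∀ w : V, w ≠ 0 → Submodule.span ℂ (Set.range fun g => ρ g w) = ⊤ := by
    intro w hw
    let S : Subrepresentation ρ := ⟨Submodule.span ℂ (Set.range fun g => ρ g w), by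
      intro g v hv
      induction hv using Submodule.span_induction with
      | mem x hx =>
        obtain ⟨h, rfl⟩ := hx
        exact Submodule.subset_span ⟨g * h, by simp⟩
      | zero => simp
      | add x y _ _ hx hy => rw [map_add]; exact add_mem hx hy
      | smul a x _ hx => rw [map_smul]; exact Submodule.smul_mem _ _ hx⟩
    rcases hρ.eq_bot_or_eq_top S with h | h
    · exfalso
      have : w ∈ S.toSubmodule := Submodule.subset_span ⟨1, by simp⟩
      rw [h] at this
      exact hw ((Submodule.mem_bot ℂ).1 this)
    · have := congrArg Subrepresentation.toSubmodule h
      exact this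
  have hmemE : ∀ x, x ∈ LinearMap.range E ↔ E x = x := by
    intro x
    constructor
    · rintro ⟨y, rfl⟩; exact LinearMap.congr_fun hEE y
    · intro h; exact ⟨x, h⟩
  -- span
  have hspan : ∀ w : V, w ≠ 0 → E w = w → ∀ (S : Submodule ℂ V), (∀ g, (E * ρ g * E) w ∈ S) → LinearMap.range E ≤ S := by
    intro w hw hEw S hS x hx
    rw [hmemE] at hx
    rw [← hx]
    have : x ∈ Submodule.span ℂ (Set.range fun g => ρ g w) := by rw [hirr w hw]; trivial
    clear hx
    induction this using Submodule.span_induction with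
    | mem x hx =>
      obtain ⟨g, rfl⟩ := hx
      have := hS g
      simpa [Module.End.mul_apply, hEw] using this
    | zero => simp
    | add x y _ _ hx hy => rw [map_add]; exact add_mem hx hy
    | smul a x _ hx => rw [map_smul]; exact Submodule.smul_mem _ _ hx
  by_cases h0 : LinearMap.range E = ⊥
  · left
    have : E = 0 := LinearMap.range_eq_bot.1 h0
    rw [this, map_zero]
  right
  obtain ⟨w, hwE, hw⟩ := (Submodule.ne_bot_iff _).1 h0
  have hEw := (hmemE w).1 hwE
  have hscal : ∀ g, ∃ c : ℂ, (E * ρ g * E) w = c • w := by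
    intro g
    have hmaps : ∀ x ∈ LinearMap.range E, (E * ρ g * E) x ∈ LinearMap.range E := fun x _ => ⟨_, rfl⟩
    have : Nontrivial (LinearMap.range E) := Submodule.nontrivial_iff_ne_bot.2 h0
    obtain ⟨c, hc⟩ := Module.End.exists_eigenvalue ((E * ρ g * E).restrict hmaps)
    obtain ⟨v, hv⟩ := hc.exists_hasEigenvector
    have hv1 : (E * ρ g * E) v.1 = c • v.1 := congrArg Subtype.val hv.apply_eq_smul
    have hv2 : v.1 ≠ 0 := fun h => hv.2 (Subtype.ext h)
    have := hspan v.1 hv2 ((hmemE _).1 v.2) (LinearMap.ker (E * ρ g * E - c • (1 : Module.End ℂ V))) (by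
      intro h
      rw [LinearMap.mem_ker, LinearMap.sub_apply, ← Module.End.mul_apply, hcomm, Module.End.mul_apply, hv1]
      simp)
    have := this hwE
    rw [LinearMap.mem_ker, LinearMap.sub_apply, sub_eq_zero] at this
    exact ⟨c, this⟩
  have hrange : LinearMap.range E = Submodule.span ℂ {w} := by
    refine le_antisymm (hspan w hw hEw _ fun g => ?_) ?_
    · obtain ⟨c, hc⟩ := hscal g
      rw [hc]; exact Submodule.smul_mem _ _ (Submodule.mem_span_singleton_self w)
    · rw [Submodule.span_singleton_le_iff_mem]; exact hwE
  have hp : LinearMap.IsProj (LinearMap.range E) E := (LinearMap.isProj_range_iff_isIdempotentElem E).2 hEE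
  rw [hp.trace, hrange, finrank_span_singleton hw]; simp
end Gelf
end PartF2

section PartF3
open Matrix
attribute [local instance 10] Fintype.ofFinite
attribute [local instance 10] Classical.propDecidable
set_option linter.unusedSectionVars false
variable {F : Type} [Field F] [Finite F] {n : ℕ}

lemma UT_unit {M : Matrix (Fin n) (Fin n) F} (hM : UT M) : IsUnit M := by
  rw [Matrix.isUnit_iff_isUnit_det, Matrix.det_of_isUpperTriangular]
  · simp [hM _ _ le_rfl]
  · intro a b hab
    have hab : b < a := hab
    rw [hM a b (le_of_lt hab), if_neg (ne_of_lt hab)]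

lemma UT_gl {M : Matrix (Fin n) (Fin n) F} (hM : UT M) : ∃ g : GL (Fin n) F, g.1 = M := UT_unit hM

def UG (F : Type) [Field F] [Finite F] (n : ℕ) : Subgroup (GL (Fin n) F) where
  carrier := {g | UT g.1}
  mul_mem' := fun {a b} ha hb => by
    have := UT_mul ha hb
    exact this
  one_mem' := UT_one
  inv_mem' := fun {a} ha => by
    have h : ∀ k : ℕ, UT (a ^ k).1 := by
      intro k
      induction k with
      | zero => exact UT_one
      | succ k ih => rw [pow_succ]; exact UT_mul ih ha
    have e : a⁻¹ = a ^ (orderOf a - 1) := by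
      rw [inv_eq_iff_mul_eq_one, ← pow_succ', Nat.sub_add_cancel (orderOf_pos a), pow_orderOf_eq_one]
    show UT (a⁻¹).1
    rw [e]; exact h _

lemma mem_UG (g : GL (Fin n) F) : g ∈ UG F n ↔ UT g.1 := Iff.rfl

def sd (A : Matrix (Fin n) (Fin n) F) : F := ∑ i : Fin n, ∑ j : Fin n, if (j : ℕ) = i + 1 then A i j else 0

lemma sd_one : sd (1 : Matrix (Fin n) (Fin n) F) = 0 := by
  unfold sd
  refine Finset.sum_eq_zero fun i _ => Finset.sum_eq_zero fun j _ => ?_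
  split_ifs with h
  · rw [Matrix.one_apply_ne]; rintro rfl; omega
  · rfl

lemma sd_mul {A B : Matrix (Fin n) (Fin n) F} (hA : UT A) (hB : UT B) : sd (A * B) = sd A + sd B := by
  unfold sd
  rw [← Finset.sum_add_distrib]
  refine Finset.sum_congr rfl fun i _ => ?_
  rw [← Finset.sum_add_distrib]
  refine Finset.sum_congr rfl fun j _ => ?_
  split_ifs with h
  · exact UT_superdiag hA hB i j h
  · simp

def tA (A : Matrix (Fin n) (Fin n) F) : Matrix (Fin n) (Fin n) F := fun i j => A j.rev i.rev

lemma tA_mul (A B : Matrix (Fin n) (Fin n) F) : tA (A * B) = tA B * tA A := by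
  ext i j
  simp only [tA, Matrix.mul_apply]
  exact Fintype.sum_equiv Fin.revPerm _ _ fun x => by simp [mul_comm]

lemma tA_one : tA (1 : Matrix (Fin n) (Fin n) F) = 1 := by
  ext i j
  simp [tA, Matrix.one_apply, eq_comm]

lemma tA_tA (A : Matrix (Fin n) (Fin n) F) : tA (tA A) = A := by
  ext i j; simp [tA]

lemma tA_UT {A : Matrix (Fin n) (Fin n) F} (h : UT A) : UT (tA A) := by
  intro i j hij
  unfold tA
  rw [h _ _ (Fin.rev_le_rev.2 hij)]
  simp [eq_comm]

lemma sd_tA (A : Matrix (Fin n) (Fin n) F) : sd (tA A) = sd A := by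
  unfold sd tA
  rw [Finset.sum_comm]
  refine Fintype.sum_equiv Fin.revPerm _ _ fun i => ?_
  refine Fintype.sum_equiv Fin.revPerm _ _ fun j => ?_
  simp only [Fin.revPerm_apply, Fin.val_rev]
  congr 1
  apply propext
  constructor <;> intro h <;> omega

def tau (g : GL (Fin n) F) : GL (Fin n) F :=
  ⟨tA g.1, tA (g⁻¹).1, by rw [← tA_mul, ← Units.val_mul, inv_mul_cancel]; exact tA_one,
    by rw [← tA_mul, ← Units.val_mul, mul_inv_cancel]; exact tA_one⟩

lemma tau_mul (g h : GL (Fin n) F) : tau (g * h) = tau h * tau g := Units.ext (tA_mul g.1 h.1)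
lemma tau_tau (g : GL (Fin n) F) : tau (tau g) = g := Units.ext (tA_tA g.1)

noncomputable def lam (ψ : AddChar F ℂ) (g : GL (Fin n) F) : ℂ := ψ (sd g.1)

lemma lam_one (ψ : AddChar F ℂ) : lam ψ (1 : GL (Fin n) F) = 1 := by
  unfold lam; rw [Units.val_one, sd_one, AddChar.map_zero_eq_one]

lemma lam_mul (ψ : AddChar F ℂ) : ∀ u ∈ UG F n, ∀ v ∈ UG F n, lam ψ (u * v) = lam ψ u * lam ψ v := by
  intro u hu v hv
  unfold lam; rw [Units.val_mul, sd_mul hu hv, AddChar.map_add_eq_mul]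

lemma lam_tau (ψ : AddChar F ℂ) (g : GL (Fin n) F) : lam ψ (tau g) = lam ψ g := by
  unfold lam
  exact congrArg ψ (sd_tA g.1)

lemma tau_mem (u : GL (Fin n) F) (h : u ∈ UG F n) : tau u ∈ UG F n := tA_UT h

lemma sd_transv (j k : Fin n) (a : F) : sd (transvection j k a) = if (k : ℕ) = j + 1 then a else 0 := by
  unfold transvection
  have : sd (1 + single j k a) = sd (1 : Matrix (Fin n) (Fin n) F) + sd (single j k a) := by
    unfold sd
    simp_rw [← Finset.sum_add_distrib]
    refine Finset.sum_congr rfl fun i _ => Finset.sum_congr rfl fun l _ => ?_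
    split_ifs <;> simp
  rw [this, sd_one, zero_add]
  unfold sd
  rw [Finset.sum_eq_single j, Finset.sum_eq_single k]
  · simp
  · intro b _ hb; simp [Ne.symm hb]
  · simp
  · intro b _ hb; refine Finset.sum_eq_zero fun c _ => ?_; simp [Ne.symm hb]
  · simp

lemma UT_transv {j k : Fin n} (h : j < k) (a : F) : UT (transvection j k a) := by
  intro x y hxy
  unfold transvection
  have hn : ¬ (j = x ∧ k = y) := by
    rintro ⟨rfl, rfl⟩
    exact absurd h (not_lt.2 hxy)
  rw [Matrix.add_apply, UT_one x y hxy, Matrix.single_apply, if_neg hn, add_zero]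

section rep
variable {V : Type} [AddCommGroup V] [Module ℂ V] (ρ : Representation ℂ (GL (Fin n) F) V) (ψ : AddChar F ℂ)

local notation "EE" => Eop (UG F n) (lam ψ) ρ

lemma E_van (g x y : GL (Fin n) F) (hx : x ∈ UG F n) (hy : y ∈ UG F n) (h : g * x = y * g)
    (hne : lam ψ x ≠ lam ψ y) : EE * ρ g * EE = 0 := by
  have e1 : EE * ρ (g * x) * EE = lam ψ x⁻¹ • (EE * ρ g * EE) := by
    rw [map_mul, mul_assoc, mul_assoc, rho_E _ _ ρ (lam_one ψ) (lam_mul ψ) x hx, mul_smul_comm, mul_smul_comm, mul_assoc]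
  have e2 : EE * ρ (y * g) * EE = lam ψ y⁻¹ • (EE * ρ g * EE) := by
    rw [map_mul, ← mul_assoc, E_rho _ _ ρ (lam_one ψ) (lam_mul ψ) y hy, smul_mul_assoc, smul_mul_assoc]
  rw [h, e2] at e1
  by_contra h0
  have h3 := smul_left_injective ℂ h0 e1
  have hx1 := l_inv _ _ (lam_one ψ) (lam_mul ψ) x hx
  have hy1 := l_inv _ _ (lam_one ψ) (lam_mul ψ) y hy
  apply hne
  rw [h3] at hy1
  have h4 : lam ψ x⁻¹ ≠ 0 := fun e => by rw [e] at hx1; simp at hx1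
  exact mul_right_cancel₀ h4 (hx1.trans hy1.symm)

lemma E_mono (hψ : ψ ≠ 1) (g : GL (Fin n) F) (hg : MonTo n g.1) : EE * ρ g * EE = EE * ρ (tau g) * EE := by
  choose r hr using fun c : Fin n => hg c c.2
  have hinj : Function.Injective r := by
    intro a b hab
    by_contra hne
    have := (hr a).2.2 b (Ne.symm hne)
    rw [hab] at this
    exact (hr b).1 this
  let σ : Equiv.Perm (Fin n) := Equiv.ofBijective r (Finite.injective_iff_bijective.1 hinj)
  let π : Equiv.Perm (Fin n) := σ.trans Fin.revPerm
  have hπ : ∀ j, (π j : ℕ) = n - 1 - r j := fun j => by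
    simp only [π, σ, Equiv.trans_apply, Equiv.ofBijective_apply, Fin.revPerm_apply, Fin.val_rev]; omega
  have hπ' : ∀ j, π j = (r j).rev := fun j => rfl
  let t : Fin n → F := fun j => g.1 (r j) j
  by_cases h : ∀ j k : Fin n, (k : ℕ) = j + 1 → (π j : ℕ) ≤ π k + 1 ∧ ((π j : ℕ) = π k + 1 → t j = t k)
  · have hlay := layered π t h
    have : tau g = g := by
      apply Units.ext
      show tA g.1 = g.1
      ext i j
      unfold tA
      by_cases e : i = r j
      · subst e
        obtain ⟨h1, h2⟩ := hlay j
        rw [hπ' j] at h1 h2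
        have h3 : j.rev = r (r j).rev := by
          have := congrArg Fin.rev h1
          rw [hπ', Fin.rev_rev] at this
          exact this.symm
        rw [h3]; exact h2
      · rw [(hr j).2.1 i e]
        apply (hr i.rev).2.1
        intro h1
        apply e
        have h2 := (hlay i.rev).1
        rw [hπ' i.rev, ← h1, Fin.rev_rev, hπ' j] at h2
        simpa using h2.symm
    rw [this]
  · push Not at h
    obtain ⟨j, k, hjk, h⟩ := h
    have hr1 := (r j).2
    have hr2 := (r k).2
    have hlt : r j < r k := by
      rw [Fin.lt_def]
      rw [hπ, hπ] at h
      by_cases h0 : n - 1 - (r j : ℕ) ≤ n - 1 - (r k : ℕ) + 1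
      · have := (h h0).1; omega
      · omega
    have hjk' : j < k := by rw [Fin.lt_def]; omega
    have hrjk : j ≠ k := hjk'.ne
    have htk : t k ≠ 0 := (hr k).1
    obtain ⟨b, hb⟩ := (AddChar.ne_one_iff).1 hψ
    -- the parameter
    obtain ⟨a, ha⟩ : ∃ a : F, ψ a ≠ ψ (if (r k : ℕ) = r j + 1 then a * (t j / t k) else 0) := by
      by_cases e : (r k : ℕ) = r j + 1
      · have hne : t j ≠ t k := by
          rw [hπ, hπ] at h
          exact (h (by omega)).2
        have hne' : 1 - t j / t k ≠ 0 := by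
          rw [sub_ne_zero]; intro h1; apply hne; field_simp at h1; exact h1.symm
        refine ⟨b / (1 - t j / t k), fun h1 => hb ?_⟩
        rw [if_pos e] at h1
        have e2 : b / (1 - t j / t k) = b + b / (1 - t j / t k) * (t j / t k) := by
          generalize t j / t k = s at *
          field_simp; ring
        rw [e2, AddChar.map_add_eq_mul, ← e2] at h1
        have h5 : ψ (b / (1 - t j / t k) * (t j / t k)) ≠ 0 := fun h6 => by
          have := AddChar.map_add_eq_mul ψ (b / (1 - t j / t k) * (t j / t k)) (-(b / (1 - t j / t k) * (t j / t k)))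
          rw [h6] at this; simp at this
        exact mul_right_cancel₀ h5 (h1.trans (one_mul _).symm)
      · refine ⟨b, ?_⟩
        rw [if_neg e, AddChar.map_zero_eq_one]; exact hb
    obtain ⟨x, hx⟩ := UT_gl (UT_transv hjk' a)
    obtain ⟨y, hy⟩ := UT_gl (UT_transv hlt (a * (t j / t k)))
    have hxU : x ∈ UG F n := by rw [mem_UG, hx]; exact UT_transv hjk' a
    have hyU : y ∈ UG F n := by rw [mem_UG, hy]; exact UT_transv hlt _
    have hcom : g * x = y * g := by
      apply Units.ext
      rw [Units.val_mul, Units.val_mul, hx, hy]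
      ext i c
      by_cases hc : c = k
      · subst hc
        rw [mul_transvection_apply_same]
        by_cases hi : i = r j
        · subst hi
          rw [transvection_mul_apply_same]
          have : g.1 (r c) c = t c := rfl
          have h7 : g.1 (r j) j = t j := rfl
          rw [this, h7]; field_simp
        · rw [transvection_mul_apply_of_ne _ _ _ _ hi, (hr j).2.1 i hi]; simp
      · rw [mul_transvection_apply_of_ne _ _ _ _ hc]
        by_cases hi : i = r j
        · subst hi
          rw [transvection_mul_apply_same, (hr k).2.2 c hc]; simp
        · rw [transvection_mul_apply_of_ne _ _ _ _ hi]
    have hlne : lam ψ x ≠ lam ψ y := by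
      unfold lam
      rw [hx, hy, sd_transv, sd_transv, if_pos hjk]
      exact ha
    rw [E_van ρ ψ g x y hxU hyU hcom hlne, E_van ρ ψ (tau g) (tau y) (tau x) (tau_mem _ hyU) (tau_mem _ hxU)
      (by rw [← tau_mul, ← tau_mul, hcom]) (by rw [lam_tau, lam_tau]; exact hlne.symm)]

lemma E_tau (hψ : ψ ≠ 1) (g : GL (Fin n) F) : EE * ρ g * EE = EE * ρ (tau g) * EE := by
  obtain ⟨B, C, hB, hC, hM, -⟩ := bruhat g.1 g.isUnit n le_rfl
  obtain ⟨b, rfl⟩ := UT_gl hB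
  obtain ⟨c, rfl⟩ := UT_gl hC
  have key := E_mono ρ ψ hψ (b * g * c) hM
  have e1 : ∀ (b g c : GL (Fin n) F), b ∈ UG F n → c ∈ UG F n →
      EE * ρ (b * g * c) * EE = (lam ψ b⁻¹ * lam ψ c⁻¹) • (EE * ρ g * EE) := by
    intro b g c hb hc
    have : EE * ρ (b * g * c) * EE = EE * ρ b * ρ g * (ρ c * EE) := by simp only [map_mul, mul_assoc]
    rw [this, rho_E _ _ ρ (lam_one ψ) (lam_mul ψ) c hc, E_rho _ _ ρ (lam_one ψ) (lam_mul ψ) b hb,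
      mul_smul_comm, smul_mul_assoc, smul_mul_assoc, smul_smul, mul_comm (lam ψ c⁻¹)]
  have hne : ∀ x ∈ UG F n, lam ψ x⁻¹ ≠ 0 := fun x hx e => by
    have := l_inv _ _ (lam_one ψ) (lam_mul ψ) x hx
    rw [e] at this; simp at this
  have hlt : ∀ x ∈ UG F n, lam ψ (tau x)⁻¹ = lam ψ x⁻¹ := by
    intro x hx
    have h1 := l_inv _ _ (lam_one ψ) (lam_mul ψ) x hx
    have h2 := l_inv _ _ (lam_one ψ) (lam_mul ψ) _ (tau_mem x hx)
    rw [lam_tau] at h2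
    have h3 : lam ψ x ≠ 0 := fun e => by rw [e] at h1; simp at h1
    exact mul_left_cancel₀ h3 (h2.trans h1.symm)
  rw [tau_mul, tau_mul, ← mul_assoc, e1 _ _ _ hB hC, e1 _ _ _ (tau_mem _ hC) (tau_mem _ hB), hlt _ hB, hlt _ hC,
    mul_comm (lam ψ c⁻¹)] at key
  exact smul_right_injective _ (mul_ne_zero (hne _ hB) (hne _ hC)) key

lemma E_trace [FiniteDimensional ℂ V] (hρ : ρ.IsIrreducible) (hψ : ψ ≠ 1) :
    LinearMap.trace ℂ V EE = 0 ∨ LinearMap.trace ℂ V EE = 1 :=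
  gelf _ _ ρ (lam_one ψ) (lam_mul ψ) hρ tau tau_mul tau_tau tau_mem (fun u _ => lam_tau ψ u) (E_tau ρ ψ hψ)
end rep
end PartF3

section PartF4
open Matrix
attribute [local instance 10] Fintype.ofFinite
attribute [local instance 10] Classical.propDecidable
set_option linter.unusedSectionVars false
variable {F : Type} [Field F] [Finite F] {n : ℕ}

noncomputable def Cn (F : Type) [Field F] [Finite F] (n : ℕ) : ℂ :=
  ∏ i : Fin n, ∏ j : Fin n, if i < j then (Nat.card F : ℂ)⁻¹ else 1

noncomputable def Xw (w : ℕ → F → ℂ) (A : Matrix (Fin n) (Fin n) F) : ℂ :=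
  ∏ i : Fin n, ∏ j : Fin n, if (j : ℕ) = i + 1 then w i (A i j) else 1

lemma weight (w : ℕ → F → ℂ) (A : Matrix (Fin n) (Fin n) F) :
    ∏ i : Fin n, ∏ j : Fin n, tw' w i j (A i j) = if UT A then Cn F n * Xw w A else 0 := by
  by_cases h : UT A
  · rw [if_pos h]
    unfold Cn Xw
    rw [← Finset.prod_mul_distrib]
    refine Finset.prod_congr rfl fun i _ => ?_
    rw [← Finset.prod_mul_distrib]
    refine Finset.prod_congr rfl fun j _ => ?_
    unfold tw'
    rcases lt_trichotomy i j with hij | hij | hij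
    · have h1 := Fin.lt_def.1 hij
      rw [if_neg (by omega), if_neg (by omega), if_pos hij]
      split_ifs <;> ring
    · subst hij
      simp [h i i le_rfl]
    · have h1 := Fin.lt_def.1 hij
      rw [if_pos h1, h i j hij.le, if_neg hij.ne, if_neg (not_lt.2 hij.le), if_neg (show ¬ ((j : ℕ) = i + 1) by omega)]; simp
  · rw [if_neg h]
    unfold UT at h
    push Not at h
    obtain ⟨i, j, hij, h⟩ := h
    refine Finset.prod_eq_zero (Finset.mem_univ i) (Finset.prod_eq_zero (Finset.mem_univ j) ?_)
    unfold tw'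
    by_cases e : j = i
    · subst e
      rw [if_pos rfl] at h; simp [h]
    · rw [if_neg e] at h
      rw [if_pos (Fin.lt_def.1 (lt_of_le_of_ne hij e)), if_neg h]

lemma sum_UT (f : Matrix (Fin n) (Fin n) F → ℂ) :
    ∑ A : Matrix (Fin n) (Fin n) F, (if UT A then f A else 0) = ∑ u : UG F n, f u.1.1 := by
  rw [← Finset.sum_filter]
  symm
  refine Finset.sum_bij (fun u _ => u.1.1) ?_ ?_ ?_ ?_
  · intro u _; rw [Finset.mem_filter]; exact ⟨Finset.mem_univ _, u.2⟩
  · intro u _ v _ h; exact Subtype.ext (Units.ext h)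
  · intro A hA
    have hA : UT A := by simpa using hA
    obtain ⟨g, rfl⟩ := UT_gl hA
    exact ⟨⟨g, hA⟩, Finset.mem_univ _, rfl⟩
  · intro u _; rfl

lemma Cn_eq : Cn F n = (Nat.card (UG F n) : ℂ)⁻¹ := by
  have h := sum_prod_one (fun (i j : Fin n) => tw' (F := F) (fun _ _ => 1) i j) (by
    intro i j
    unfold tw'
    split_ifs
    · simp
    · simp
    · simp [Finset.card_univ, ← Nat.card_eq_fintype_card, cardF_ne]
    · simp [Finset.card_univ, ← Nat.card_eq_fintype_card, cardF_ne])
  simp_rw [weight] at h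
  rw [sum_UT] at h
  have : ∀ A : Matrix (Fin n) (Fin n) F, Xw (fun _ _ => 1) A = 1 := fun A => by unfold Xw; simp
  simp only [this, mul_one, Finset.sum_const, Finset.card_univ, ← Nat.card_eq_fintype_card, nsmul_eq_mul] at h
  exact eq_inv_of_mul_eq_one_right h

lemma In_UG (w : ℕ → F → ℂ) (χ : GL (Fin n) F → ℂ) (hχ : IsCl χ) :
    In n w (extn χ) = Cn F n * ∑ u : UG F n, Xw w u.1.1 * χ u := by
  unfold In IW
  simp_rw [weight, ite_mul, zero_mul]
  rw [sum_UT (fun A => Cn F n * Xw w A * extn χ (cl (toLin' A))), Finset.mul_sum]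
  refine Finset.sum_congr rfl fun u _ => ?_
  rw [mul_assoc]
  congr 2
  exact extn_clG hχ u.1

lemma exists_psi : ∃ ψ : AddChar F ℂ, ψ ≠ 1 ∧ ∀ x : F, psit x = ((Nat.card F : ℂ) - 1)⁻¹ * ∑ c : Fˣ, ψ (c * x) := by
  have hp := AddChar.FiniteField.primitiveChar_to_Complex_isPrimitive F
  set ψ := AddChar.FiniteField.primitiveChar_to_Complex F
  have h1 : ψ ≠ 1 := by
    have := hp one_ne_zero
    rwa [AddChar.mulShift_one] at this
  refine ⟨ψ, h1, fun x => ?_⟩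
  have h2 : ∑ c : F, ψ (c * x) = 1 + ∑ c : Fˣ, ψ (c * x) := by
    rw [← Finset.add_sum_erase _ _ (Finset.mem_univ (0 : F))]
    congr 1
    · simp
    · symm
      refine Finset.sum_bij (fun u _ => u.1) ?_ ?_ ?_ ?_
      · intro u _; simp
      · intro u _ v _ h; exact Units.ext h
      · intro b hb; exact ⟨Units.mk0 b (by simpa using hb), Finset.mem_univ _, rfl⟩
      · intro u _; rfl
  have h3 : ∑ c : F, ψ (c * x) = if x = 0 then (Nat.card F : ℂ) else 0 := by
    rw [AddChar.sum_mulShift x hp, Nat.card_eq_fintype_card]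
    simp
  have h4 : ∑ c : Fˣ, ψ (c * x) = (if x = 0 then (Nat.card F : ℂ) else 0) - 1 := by
    rw [← h3, h2]; ring
  rw [h4]
  unfold psit nu
  have := cardF_sub_ne (F := F)
  split_ifs
  · field_simp; ring
  · field_simp; ring

def dG (d : Fin n → Fˣ) : GL (Fin n) F :=
  ⟨Matrix.diagonal fun i => (d i : F), Matrix.diagonal fun i => ((d i)⁻¹ : Fˣ).1, by
    rw [Matrix.diagonal_mul_diagonal]; simp, by rw [Matrix.diagonal_mul_diagonal]; simp⟩

lemma dG_conj (d : Fin n → Fˣ) (g : GL (Fin n) F) (i j : Fin n) :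
    (dG d * g * (dG d)⁻¹).1 i j = d i * g.1 i j * ((d j)⁻¹ : Fˣ).1 := by
  have : (dG d * g * (dG d)⁻¹).1 = Matrix.diagonal (fun i => (d i : F)) * g.1 * Matrix.diagonal fun i => ((d i)⁻¹ : Fˣ).1 := rfl
  rw [this, Matrix.mul_diagonal, Matrix.diagonal_mul]

lemma Xw_psi (ψ : AddChar F ℂ) (w : Fin n → F → F) (A : Matrix (Fin n) (Fin n) F) :
    ∏ i : Fin n, ∏ j : Fin n, (if (j : ℕ) = i + 1 then ψ (w i (A i j)) else 1) =
    ψ (∑ i : Fin n, ∑ j : Fin n, if (j : ℕ) = i + 1 then w i (A i j) else 0) := by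
  have h : ∀ (s : Finset (Fin n)) (f : Fin n → F), ψ (∑ i ∈ s, f i) = ∏ i ∈ s, ψ (f i) := by
    intro s f
    induction s using Finset.induction_on with
    | empty => simp
    | insert a s ha ih => rw [Finset.sum_insert ha, Finset.prod_insert ha, AddChar.map_add_eq_mul, ih]
  rw [h]
  refine Finset.prod_congr rfl fun i _ => ?_
  rw [h]
  refine Finset.prod_congr rfl fun j _ => ?_
  split_ifs <;> simp

lemma Xw_psit (ψ : AddChar F ℂ) (hψ : ∀ x : F, psit x = ((Nat.card F : ℂ) - 1)⁻¹ * ∑ c : Fˣ, ψ (c * x))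
    (g : GL (Fin n) F) : Xw (fun _ => psit) g.1 = (((Nat.card F : ℂ) - 1)⁻¹) ^ n *
      ∑ c : Fin n → Fˣ, lam ψ (dG (fun i => ∏ k ∈ Finset.Ici i, c k) * g * (dG (fun i => ∏ k ∈ Finset.Ici i, c k))⁻¹) := by
  have h1 : ∀ i : Fin n, (∏ j : Fin n, if (j : ℕ) = i + 1 then psit (g.1 i j) else 1) =
      ((Nat.card F : ℂ) - 1)⁻¹ * ∑ c : Fˣ, ∏ j : Fin n, if (j : ℕ) = i + 1 then ψ (c * g.1 i j) else 1 := by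
    intro i
    by_cases hi : (i : ℕ) + 1 < n
    · have e : ∀ f : Fin n → ℂ, (∏ j : Fin n, if (j : ℕ) = i + 1 then f j else 1) = f ⟨i + 1, hi⟩ := by
        intro f
        rw [Finset.prod_eq_single ⟨i + 1, hi⟩]
        · simp
        · intro b _ hb
          rw [if_neg]; intro h; exact hb (Fin.ext h)
        · simp
      rw [e, hψ]
      congr 1
      exact Finset.sum_congr rfl fun c _ => (e fun j => ψ (c * g.1 i j)).symm
    · have e : ∀ f : Fin n → ℂ, (∏ j : Fin n, if (j : ℕ) = i + 1 then f j else 1) = 1 := by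
        intro f
        refine Finset.prod_eq_one fun j _ => ?_
        rw [if_neg (by omega)]
      rw [e, Finset.sum_congr rfl fun (c : Fˣ) _ => (e fun j => ψ (c * g.1 i j)), Finset.sum_const, Finset.card_univ,
        ← Nat.card_eq_fintype_card, Nat.card_units]
      have h2 : 1 ≤ Nat.card F := Nat.card_pos
      simp only [nsmul_eq_mul, mul_one, Nat.cast_sub h2, Nat.cast_one]
      rw [inv_mul_cancel₀ cardF_sub_ne]
  unfold Xw
  rw [Finset.prod_congr rfl fun i _ => h1 i, Finset.prod_mul_distrib, Fintype.prod_sum]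
  simp only [Finset.prod_const, Finset.card_univ, Fintype.card_fin]
  congr 1
  refine Finset.sum_congr rfl fun c _ => ?_
  rw [Xw_psi ψ (fun i x => c i * x)]
  unfold lam sd
  congr 1
  refine Finset.sum_congr rfl fun i _ => Finset.sum_congr rfl fun j _ => ?_
  split_ifs with h
  · rw [dG_conj]
    have h2 : Finset.Ici i = insert i (Finset.Ici j) := by
      ext x
      simp only [Finset.mem_Ici, Finset.mem_insert, Fin.le_def, Fin.ext_iff]
      omega
    rw [h2, Finset.prod_insert (by simp only [Finset.mem_Ici, Fin.le_def]; omega), Units.val_mul]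
    generalize ∏ k ∈ Finset.Ici j, c k = s
    have : (s : F) * (s⁻¹ : Fˣ).1 = 1 := by simp
    linear_combination (-(c i : F) * g.1 i j) * this
  · rfl

lemma In_psit (χ : Irr (GL (Fin n) F)) :
    In n (fun _ => psit) (extn χ.1) = 0 ∨ In n (fun _ => psit) (extn χ.1) = 1 := by
  obtain ⟨ψ, hψ1, hψ⟩ := exists_psi (F := F)
  have e : In n (fun _ => psit) (extn χ.1) = (Nat.card (UG F n) : ℂ)⁻¹ * ∑ u : UG F n, lam ψ u.1 * χ.1 u := by
    rw [In_UG _ _ (irr_isCl χ), Cn_eq]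
    congr 1
    simp_rw [Xw_psit ψ hψ, mul_assoc, Finset.sum_mul]
    rw [← Finset.mul_sum, Finset.sum_comm]
    have : ∀ c : Fin n → Fˣ, ∑ u : UG F n, lam ψ (dG (fun i => ∏ k ∈ Finset.Ici i, c k) * u.1 *
        (dG (fun i => ∏ k ∈ Finset.Ici i, c k))⁻¹) * χ.1 u = ∑ u : UG F n, lam ψ u.1 * χ.1 u := by
      intro c
      generalize (fun i => ∏ k ∈ Finset.Ici i, c k) = d
      have hU : ∀ (d : Fin n → Fˣ) (u : GL (Fin n) F), u ∈ UG F n → dG d * u * (dG d)⁻¹ ∈ UG F n := by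
        intro d u hu i j hij
        rw [dG_conj, hu i j hij]
        split_ifs with h
        · subst h; simp
        · simp
      have hinv : dG (fun i => (d i)⁻¹) = (dG d)⁻¹ := by
        apply Units.ext
        show Matrix.diagonal _ = Matrix.diagonal _
        rfl
      refine Fintype.sum_equiv ⟨fun u : UG F n => ⟨dG d * u.1 * (dG d)⁻¹, hU d u.1 u.2⟩,
        fun u : UG F n => ⟨(dG d)⁻¹ * u.1 * (dG d), by have := hU (fun i => (d i)⁻¹) u.1 u.2; rwa [hinv, inv_inv] at this⟩,
        fun u => Subtype.ext (by simp [mul_assoc]), fun u => Subtype.ext (by simp [mul_assoc])⟩ _ _ fun u => ?_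
      simp only [Equiv.coe_fn_mk]
      rw [irr_class χ.2]
    simp only [mul_assoc] at this
    simp_rw [this]
    rw [Finset.sum_const, Finset.card_univ, ← Nat.card_eq_fintype_card,
      Nat.card_fun, Nat.card_units, Nat.card_eq_fintype_card (α := Fin n), Fintype.card_fin, nsmul_eq_mul, ← mul_assoc]
    have h2 : 1 ≤ Nat.card F := Nat.card_pos
    rw [Nat.cast_pow, Nat.cast_sub h2, Nat.cast_one, ← mul_pow, inv_mul_cancel₀ cardF_sub_ne, one_pow, one_mul]
  obtain ⟨V, _, _, _, ρ, hρ, hc⟩ := (isIrrChar_iff χ.1).1 χ.2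
  have e2 : LinearMap.trace ℂ V (Eop (UG F n) (lam ψ) ρ) = In n (fun _ => psit) (extn χ.1) := by
    rw [e]
    unfold Eop
    rw [map_smul, map_sum, smul_eq_mul]
    congr 1
    refine Finset.sum_congr (by ext; simp) fun u _ => ?_
    rw [map_smul, smul_eq_mul, ← hc]
    rfl
  rw [← e2]
  exact E_trace ρ ψ hρ hψ1
end PartF4

section PartG
open Matrix ComplexConjugate
attribute [local instance 10] Fintype.ofFinite
attribute [local instance 10] Classical.propDecidable
set_option linter.unusedSectionVars false

lemma rat_int (m d : ℕ) (hd : d ≠ 0) (h : IsIntegral ℤ ((m : ℂ) / (d : ℂ))) : d ∣ m := by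
  have e : ((m : ℂ) / (d : ℂ)) = algebraMap ℚ ℂ ((m : ℚ) / d) := by simp
  rw [e, isIntegral_algebraMap_iff (algebraMap ℚ ℂ).injective, IsIntegrallyClosed.isIntegral_iff] at h
  obtain ⟨y, hy⟩ := h
  have hd' : (d : ℚ) ≠ 0 := by exact_mod_cast hd
  rw [eq_div_iff hd', eq_intCast] at hy
  have : y * (d : ℤ) = m := by exact_mod_cast hy
  exact Int.natCast_dvd_natCast.1 ⟨y, by rw [← this]; ring⟩

lemma trace_mod {V : Type} [AddCommGroup V] [Module ℂ V] [FiniteDimensional ℂ V] (f : Module.End ℂ V)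
    (p k : ℕ) (hp : p.Prime) (hf : f ^ p ^ k = 1) (hdvd : p ∣ Module.finrank ℂ V)
    (ht : LinearMap.trace ℂ V f = 1 ∨ LinearMap.trace ℂ V f = -1) : False := by
  have : Fact p.Prime := ⟨hp⟩
  let A := integralClosure ℤ ℂ
  have hpn : (p : A) ∈ nonunits A := by
    intro hu
    obtain ⟨y, hy⟩ := hu.exists_right_inv
    have h1 : (p : ℂ) * (y : ℂ) = 1 := by
      have := congrArg (Subtype.val) hy
      simpa using this
    have h2 : (y : ℂ) = ((1 : ℕ) : ℂ) / (p : ℂ) := by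
      rw [Nat.cast_one, eq_div_iff (by exact_mod_cast hp.ne_zero), mul_comm]; exact h1
    have h3 := rat_int 1 p hp.ne_zero (by rw [← h2]; exact y.2)
    exact hp.one_lt.ne' (Nat.dvd_one.1 h3)
  have : CharP (A ⧸ Ideal.span {(p : A)}) p := CharP.quotient A p hpn
  have hroot : ∀ x ∈ f.charpoly.roots, x ^ p ^ k = 1 := by
    intro x hx
    rw [Polynomial.mem_roots f.charpoly_monic.ne_zero, ← Module.End.hasEigenvalue_iff_isRoot_charpoly] at hx
    obtain ⟨v, hv⟩ := hx.exists_hasEigenvector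
    have := hv.pow_apply (p ^ k)
    rw [hf, Module.End.one_apply] at this
    have h1 : (x ^ p ^ k - 1) • v = 0 := by rw [sub_smul, one_smul, ← this, sub_self]
    rcases smul_eq_zero.1 h1 with h | h
    · exact sub_eq_zero.1 h
    · exact absurd h hv.2
  have htr : LinearMap.trace ℂ V f = f.charpoly.roots.sum := by
    let b := Module.finBasis ℂ V
    rw [LinearMap.trace_eq_matrix_trace ℂ b, Matrix.trace_eq_sum_roots_charpoly, LinearMap.charpoly_toMatrix]
  have hcard : Multiset.card f.charpoly.roots = Module.finrank ℂ V := by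
    rw [← LinearMap.charpoly_natDegree f]
    exact (Polynomial.splits_iff_card_roots.1 (IsAlgClosed.splits _))
  have hmem : ∀ x ∈ f.charpoly.roots, x ∈ A := by
    intro x hx
    refine IsIntegral.of_pow (n := p ^ k) (pow_pos hp.pos k) ?_
    rw [hroot x hx]; exact isIntegral_one
  generalize f.charpoly.roots = s at *
  let s' : Multiset A := s.attach.map fun x => ⟨x.1, hmem x.1 x.2⟩
  have hs' : Multiset.map (fun x : A => x.1) s' = s := by
    simp only [s', Multiset.map_map, Function.comp_def]
    exact Multiset.attach_map_val s
  have hsum : ((s'.sum : A) : ℂ) = s.sum := by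
    rw [← hs']
    exact map_multiset_sum A.val.toRingHom s'
  have hpow : ∀ x ∈ s', x ^ p ^ k = 1 := by
    intro x hx
    apply Subtype.ext
    have : (x : ℂ) ∈ s := by rw [← hs']; exact Multiset.mem_map_of_mem _ hx
    simpa using hroot _ this
  have hcard' : Multiset.card s' = Module.finrank ℂ V := by rw [← hcard]; simp [s']
  let π := Ideal.Quotient.mk (Ideal.span {(p : A)})
  have h1 : π s'.sum ^ p ^ k = 0 := by
    rw [map_multiset_sum, multiset_sum_pow_char_pow, Multiset.map_map]
    have : s'.map ((fun x => x ^ p ^ k) ∘ ⇑π) = s'.map fun _ => 1 := by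
      refine Multiset.map_congr rfl fun x hx => ?_
      simp only [Function.comp_apply]
      rw [← map_pow, hpow x hx, map_one]
    rw [this, Multiset.map_const', Multiset.sum_replicate, hcard', nsmul_eq_mul, mul_one]
    exact (CharP.cast_eq_zero_iff _ p _).2 hdvd
  have h2 : s'.sum = 1 ∨ s'.sum = -1 := by
    rw [htr, ← hsum] at ht
    rcases ht with h | h
    · left; exact Subtype.ext h
    · right; exact Subtype.ext (by simpa using h)
  have : Nontrivial (A ⧸ Ideal.span {(p : A)}) := CharP.nontrivial_of_char_ne_one hp.ne_one
  rcases h2 with h | h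
  · rw [h] at h1; simp at h1
  · rw [h] at h1
    exact ((isUnit_one.neg.map π).pow _).ne_zero h1

variable {F : Type} [Field F] [Finite F] {n : ℕ}

lemma uM_UT : UT (uM n : Matrix (Fin n) (Fin n) F) := by
  intro i j hij
  rw [Fin.le_def] at hij
  simp only [uM, Matrix.of_apply]
  by_cases h : j = i
  · simp [h]
  · rw [if_neg (Ne.symm h), if_neg (by omega), if_neg h]

noncomputable def uG (F : Type) [Field F] [Finite F] (n : ℕ) : GL (Fin n) F := (UT_gl (uM_UT (F := F) (n := n))).choose
lemma uG_val : (uG F n).1 = uM n := (UT_gl (uM_UT (F := F) (n := n))).choose_spec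

lemma irr_u (χ : Irr (GL (Fin n) F)) : χ.1 (uG F n) = 0 ∨ χ.1 (uG F n) = 1 ∨ χ.1 (uG F n) = -1 := by
  obtain ⟨χ', ε, hε, h⟩ := Sf_irr χ
  have : clG (uG F n) = u F n := by unfold clG u; rw [uG_val]
  rw [h, this, Sf_u]
  rcases In_psit χ' with h1 | h1 <;> rw [h1]
  · left; ring
  · right
    rcases hε with rfl | rfl <;> rcases neg_one_pow_eq_or ℂ n with h2 | h2 <;> rw [h2] <;> simp

lemma card_UG : ∃ M, Nat.card (UG F n) = Nat.card F ^ M := by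
  have h := Cn_eq (F := F) (n := n)
  unfold Cn at h
  refine ⟨∑ i : Fin n, ∑ j : Fin n, if i < j then 1 else 0, ?_⟩
  have h2 : ∀ i j : Fin n, (if i < j then (Nat.card F : ℂ)⁻¹ else 1) = (Nat.card F : ℂ)⁻¹ ^ (if i < j then 1 else 0) := by
    intro i j; split_ifs <;> simp
  simp_rw [h2, Finset.prod_pow_eq_pow_sum] at h
  rw [inv_pow, _root_.inv_inj] at h
  exact_mod_cast h.symm

lemma u_pow (p r : ℕ) (hF : Nat.card F = p ^ r) : ∃ k, uG F n ^ p ^ k = 1 := by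
  obtain ⟨M, hM⟩ := card_UG (F := F) (n := n)
  have hu : uG F n ∈ UG F n := by rw [mem_UG, uG_val]; exact uM_UT
  refine ⟨r * M, ?_⟩
  have := pow_card_eq_one' (x := (⟨uG F n, hu⟩ : UG F n))
  rw [hM, hF, ← pow_mul] at this
  exact congrArg Subtype.val this

lemma irr_u_dvd (χ : Irr (GL (Fin n) F)) (p r : ℕ) (hp : p.Prime) (hF : Nat.card F = p ^ r) (d : ℕ) (hd : 0 < d)
    (hpd : p ∣ d) (h : NatDvdAlg d (χ.1 1)) : χ.1 (uG F n) = 0 := by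
  rcases irr_u χ with h0 | h1
  · exact h0
  exfalso
  obtain ⟨V, _, _, _, ρ, hρ, hc⟩ := (isIrrChar_iff χ.1).1 χ.2
  have e1 : χ.1 1 = (Module.finrank ℂ V : ℂ) := by
    rw [← hc]; exact Representation.char_one ρ
  unfold NatDvdAlg at h
  rw [e1] at h
  have h2 := hpd.trans (rat_int _ _ hd.ne' h)
  obtain ⟨k, hk⟩ := u_pow (F := F) (n := n) p r hF
  rw [← hc] at h1
  exact trace_mod (ρ (uG F n)) p k hp (by rw [← map_pow, hk, map_one]) h2 h1

/-- lower bound of the centralizer -/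
lemma cent_u (m : ℕ) : (Nat.card F - 1) * Nat.card F ^ m ≤ Nat.card (Subgroup.centralizer {uG F (m + 1)}) := by
  let N : Matrix (Fin (m + 1)) (Fin (m + 1)) F := uM (m + 1) - 1
  have hN : ∀ i j, N i j = if (j : ℕ) = i + 1 then 1 else 0 := by
    intro i j
    simp only [N, Matrix.sub_apply, uM, Matrix.of_apply, Matrix.one_apply]
    by_cases h : i = j
    · subst h; simp
    · simp [h]
  have hNk : ∀ k i j, (N ^ k) i j = if (j : ℕ) = i + k then 1 else 0 := by
    intro k
    induction k with
    | zero => intro i j; simp [Matrix.one_apply, Fin.ext_iff, eq_comm]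
    | succ k ih =>
      intro i j
      rw [pow_succ, Matrix.mul_apply]
      simp_rw [ih, hN]
      by_cases h : (j : ℕ) = i + (k + 1)
      · rw [if_pos h, Finset.sum_eq_single ⟨i + k, by omega⟩]
        · simp; omega
        · intro b _ hb
          rw [if_neg (fun e => hb (Fin.ext e)), zero_mul]
        · simp
      · rw [if_neg h]
        refine Finset.sum_eq_zero fun b _ => ?_
        by_cases h1 : (b : ℕ) = i + k
        · rw [if_neg (show ¬ ((j : ℕ) = b + 1) by omega), mul_zero]
        · rw [if_neg h1, zero_mul]
  let T : Fˣ × (Fin m → F) → Matrix (Fin (m + 1)) (Fin (m + 1)) F := fun c => (c.1 : F) • (1 : Matrix _ _ F) + ∑ k : Fin m, c.2 k • N ^ (k.1 + 1)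
  have hT : ∀ c i j, T c i j = (if j = i then (c.1 : F) else 0) + ∑ k : Fin m, if (j : ℕ) = i + (k + 1) then c.2 k else 0 := by
    intro c i j
    simp only [T, Matrix.add_apply, Matrix.smul_apply, Matrix.sum_apply, hNk, Matrix.one_apply, smul_eq_mul, mul_ite,
      mul_one, mul_zero]
    congr 1
    simp [eq_comm]
  have hTu : ∀ c, IsUnit (T c) := by
    intro c
    have hle : ∀ i j, j ≤ i → T c i j = if j = i then (c.1 : F) else 0 := by
      intro i j hij
      rw [hT, Finset.sum_eq_zero, add_zero]
      intro k _
      rw [Fin.le_def] at hij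
      rw [if_neg (by omega)]
    rw [Matrix.isUnit_iff_isUnit_det, Matrix.det_of_isUpperTriangular]
    · simp [hle _ _ le_rfl]
    · intro a b hab
      have hab : b < a := hab
      rw [hle a b (le_of_lt hab), if_neg (ne_of_lt hab)]
  have hcomm : ∀ c, uM (m + 1) * T c = T c * uM (m + 1) := by
    intro c
    have e : uM (m + 1) = N + 1 := by simp [N]
    have : Commute (uM (m + 1)) (T c) := by
      rw [e]
      refine Commute.add_left ?_ (Commute.one_left _)
      refine Commute.add_right ((Commute.one_right N).smul_right _) (Commute.sum_right _ _ _ fun k _ => ?_)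
      exact ((Commute.refl N).pow_right _).smul_right _
    exact this
  choose g hg using hTu
  have hmem : ∀ c, g c ∈ Subgroup.centralizer {uG F (m + 1)} := by
    intro c
    rw [Subgroup.mem_centralizer_singleton_iff]
    apply Units.ext
    rw [Units.val_mul, Units.val_mul, uG_val, hg, hcomm]
  have hinj : Function.Injective (fun c => (⟨g c, hmem c⟩ : Subgroup.centralizer {uG F (m + 1)})) := by
    intro c c' h
    have h1 : T c = T c' := by
      rw [← hg, ← hg, show g c = g c' from congrArg Subtype.val h]
    have h2 : ∀ j, T c 0 j = T c' 0 j := fun j => by rw [h1]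
    apply Prod.ext
    · have := h2 0
      rw [hT, hT] at this
      simp at this
      exact Units.ext this
    · funext k
      have := h2 k.succ
      rw [hT, hT] at this
      simpa [Fin.ext_iff, ← Fin.ext_iff, Fin.val_inj] using this
  have := Nat.card_le_card_of_injective _ hinj
  rwa [Nat.card_prod, Nat.card_units, Nat.card_fun, Nat.card_eq_fintype_card (α := Fin m), Fintype.card_fin] at this
end PartG

section PartH
open Polynomial
attribute [local instance 10] Fintype.ofFinite
attribute [local instance 10] Classical.propDecidable
set_option linter.unusedSectionVars false
variable {F : Type} [Field F] [Finite F]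

def avn (q m : ℕ) : ℕ := if m = 0 then 1 else (q - 1) * q ^ (m - 1)

lemma exists_P (m : ℕ) : ∃ P : Finset F[X], P.card ≤ avn (Nat.card F) m ∧
    ∀ g : F[X], g.Monic → g.natDegree = m → g.eval 0 ≠ 0 → g ∈ P := by
  rcases m with _ | m
  · refine ⟨{1}, by simp [avn], fun g hg hd _ => ?_⟩
    rw [Finset.mem_singleton]; exact hg.natDegree_eq_zero.1 hd
  · let mk : Fˣ × (Fin m → F) → F[X] := fun c => X ^ (m + 1) + (C (c.1 : F) + ∑ i : Fin m, C (c.2 i) * X ^ (i.1 + 1))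
    refine ⟨Finset.univ.image mk, ?_, fun g hg hd h0 => ?_⟩
    · refine Finset.card_image_le.trans (le_of_eq ?_)
      rw [Finset.card_univ, ← Nat.card_eq_fintype_card, Nat.card_prod, Nat.card_units, Nat.card_fun,
        Nat.card_eq_fintype_card (α := Fin m), Fintype.card_fin]
      simp [avn]
    · rw [Finset.mem_image]
      refine ⟨(Units.mk0 (g.eval 0) h0, fun i => g.coeff (i + 1)), Finset.mem_univ _, ?_⟩
      conv_rhs => rw [hg.as_sum, hd, Finset.sum_range_succ']
      simp only [mk, Units.val_mk0, pow_zero, mul_one, ← coeff_zero_eq_eval_zero]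
      rw [← Fin.sum_univ_eq_sum_range (fun i => C (g.coeff (i + 1)) * X ^ (i + 1)), add_comm (C _)]

noncomputable def PS (F : Type) [Field F] [Finite F] (m : ℕ) : Finset F[X] := (exists_P (F := F) m).choose

noncomputable def TS (F : Type) [Field F] [Finite F] : ℕ → ℕ → Finset (ℕ → F[X])
  | 0, n => if n = 0 then {fun _ => 1} else ∅
  | J + 1, n => (Finset.range (n + 1)).biUnion fun m => if (J + 1) * m ≤ n then
      (PS F m ×ˢ TS F J (n - (J + 1) * m)).image (fun x => Function.update x.2 J x.1) else ∅

def dv (q : ℕ) : ℕ → ℕ → ℕ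
  | 0, n => if n = 0 then 1 else 0
  | J + 1, n => ∑ m ∈ Finset.range (n + 1), if (J + 1) * m ≤ n then avn q m * dv q J (n - (J + 1) * m) else 0

lemma TS_card (J n : ℕ) : (TS F J n).card ≤ dv (Nat.card F) J n := by
  induction J generalizing n with
  | zero => unfold TS dv; split_ifs <;> simp [*]
  | succ J ih =>
    unfold TS dv
    refine Finset.card_biUnion_le.trans (Finset.sum_le_sum fun m _ => ?_)
    split_ifs
    · refine Finset.card_image_le.trans ?_
      rw [Finset.card_product]
      exact Nat.mul_le_mul (exists_P (F := F) m).choose_spec.1 (ih _)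
    · simp

lemma TS_mem (J n : ℕ) (G : ℕ → F[X]) (h1 : ∀ j, (G j).Monic ∧ (G j).eval 0 ≠ 0) (h2 : ∀ j, J ≤ j → G j = 1)
    (h3 : ∑ j ∈ Finset.range J, (j + 1) * (G j).natDegree = n) : G ∈ TS F J n := by
  induction J generalizing n G with
  | zero =>
    simp at h3
    unfold TS
    rw [if_pos h3.symm, Finset.mem_singleton]
    funext j; exact h2 j (Nat.zero_le _)
  | succ J ih =>
    unfold TS
    rw [Finset.sum_range_succ] at h3
    rw [Finset.mem_biUnion]
    refine ⟨(G J).natDegree, ?_, ?_⟩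
    · rw [Finset.mem_range, ← h3, add_mul, one_mul]; omega
    · rw [if_pos (by omega), Finset.mem_image]
      refine ⟨(G J, Function.update G J 1), ?_, by simp⟩
      rw [Finset.mem_product]
      refine ⟨(exists_P (F := F) _).choose_spec.2 _ (h1 J).1 rfl (h1 J).2, ih _ _ ?_ ?_ ?_⟩
      · intro j
        by_cases h : j = J
        · subst h; simp
        · simpa [h] using h1 j
      · intro j hj
        by_cases h : j = J
        · subst h; simp
        · simpa [h] using h2 j (by omega)
      · rw [← h3, Nat.add_sub_cancel]
        refine Finset.sum_congr rfl fun j hj => ?_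
        simp [(Finset.mem_range.1 hj).ne]

lemma dv_zero (q J : ℕ) : dv q J 0 = 1 := by
  induction J with
  | zero => simp [dv]
  | succ J ih => simp [dv, ih, avn]

lemma dv_le (q : ℕ) (hq : 2 ≤ q) (J n : ℕ) (hn : n ≠ 0) : (dv q J n : ℝ) ≤ (q : ℝ) ^ n * (1 - (q : ℝ)⁻¹ ^ J) := by
  induction J generalizing n with
  | zero => simp [dv, hn]
  | succ J ih =>
    have hq0 : (q : ℝ) ≠ 0 := by positivity
    set x : ℝ := (q : ℝ)⁻¹ with hx
    have hqx : (q : ℝ) * x = 1 := mul_inv_cancel₀ hq0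
    have hx0 : 0 ≤ x := by positivity
    have hx1 : x ≤ 1 := inv_le_one_of_one_le₀ (by exact_mod_cast (by omega : 1 ≤ q))
    set y : ℝ := x ^ J with hy
    have hy0 : 0 ≤ y := by positivity
    have hy1 : y ≤ 1 := pow_le_one₀ hx0 hx1
    let c : ℕ → ℝ := fun m => if (J + 1) * m ≤ n then y ^ m else 0
    have hterm : ∀ m, ((if (J + 1) * (m + 1) ≤ n then avn q (m + 1) * dv q J (n - (J + 1) * (m + 1)) else 0 : ℕ) : ℝ)
        ≤ (q : ℝ) ^ n * (1 - x) * (c (m + 1) - c (m + 1 + 1)) := by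
      intro m
      have hav : (avn q (m + 1) : ℝ) = (q : ℝ) ^ (m + 1) * (1 - x) := by
        simp only [avn, Nat.add_eq_zero_iff, one_ne_zero, and_false, if_false, Nat.add_sub_cancel]
        rw [Nat.cast_mul, Nat.cast_sub (by omega), Nat.cast_pow, Nat.cast_one, pow_succ]
        linear_combination (q : ℝ) ^ m * (hqx)
      have key : ∀ l, (J + 1) * (m + 1) + l = n → (q : ℝ) ^ (m + 1) * (q : ℝ) ^ l = (q : ℝ) ^ n * y ^ (m + 1) := by
        intro l hl
        rw [hy, ← pow_mul, ← hl, pow_add, add_mul, one_mul, pow_add]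
        have : (q : ℝ) ^ (J * (m + 1)) * x ^ (J * (m + 1)) = 1 := by rw [← mul_pow, hqx, one_pow]
        linear_combination (-(q : ℝ) ^ (m + 1) * q ^ l) * this
      have hnn : 0 ≤ (q : ℝ) ^ n * (1 - x) := mul_nonneg (by positivity) (by linarith)
      by_cases h : (J + 1) * (m + 1) ≤ n
      · obtain ⟨l, hl⟩ := Nat.exists_eq_add_of_le h
        have hk := key l hl.symm
        rw [if_pos h, hl, Nat.add_sub_cancel_left, ← hl, Nat.cast_mul, hav]
        have hc : c (m + 1) = y ^ (m + 1) := if_pos h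
        rcases Nat.eq_zero_or_pos l with h0 | h0
        · subst h0
          have hc' : c (m + 1 + 1) = 0 := if_neg (by rw [hl]; nlinarith)
          rw [hc, hc', dv_zero]
          rw [pow_zero, mul_one] at hk
          rw [hk]; simp; linarith
        · have hc' : c (m + 1 + 1) ≤ y ^ (m + 1) * y := by
            rw [← pow_succ]
            simp only [c]; split_ifs
            · exact le_rfl
            · positivity
          calc _ ≤ (q : ℝ) ^ (m + 1) * (1 - x) * (q ^ l * (1 - y)) :=
                mul_le_mul_of_nonneg_left (ih l h0.ne') (mul_nonneg (by positivity) (by linarith))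
            _ = (q : ℝ) ^ n * (1 - x) * (y ^ (m + 1) - y ^ (m + 1) * y) := by linear_combination (1 - x) * (1 - y) * hk
            _ ≤ _ := mul_le_mul_of_nonneg_left (by rw [hc]; linarith) hnn
      · rw [if_neg h]
        have hc : c (m + 1) = 0 := if_neg h
        have hc' : c (m + 1 + 1) = 0 := if_neg (by nlinarith)
        rw [hc, hc']; simp
    have hs : ∑ m ∈ Finset.range n, (c (m + 1) - c (m + 1 + 1)) ≤ y := by
      rw [Finset.sum_range_sub' (fun m => c (m + 1))]
      have h1 : c (0 + 1) ≤ y := by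
        simp only [c]; split_ifs
        · simp
        · exact hy0
      have h2 : 0 ≤ c (n + 1) := by
        simp only [c]; split_ifs
        · positivity
        · exact le_rfl
      linarith
    unfold dv
    rw [Finset.sum_range_succ', Nat.cast_add, Nat.cast_sum]
    have h0 : ((if (J + 1) * 0 ≤ n then avn q 0 * dv q J (n - (J + 1) * 0) else 0 : ℕ) : ℝ) ≤ q ^ n * (1 - y) := by
      simpa [avn] using ih n hn
    have h1 := Finset.sum_le_sum (s := Finset.range n) fun m _ => hterm m
    rw [← Finset.mul_sum] at h1
    have h2 := mul_le_mul_of_nonneg_left hs (mul_nonneg (by positivity : 0 ≤ (q : ℝ) ^ n) (by linarith : 0 ≤ 1 - x))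
    rw [pow_succ, ← hy]
    linarith
end PartH

section PartH2
open Polynomial
attribute [local instance 10] Fintype.ofFinite
attribute [local instance 10] Classical.propDecidable
set_option linter.unusedSectionVars false
variable {F : Type} [Field F] [Finite F]

lemma fib_equiv {α β γ : Type} [Fintype α] [Fintype β] (f : α → γ) (g : β → γ)
    (h : Finset.univ.val.map f = Finset.univ.val.map g) : ∃ σ : α ≃ β, ∀ a, g (σ a) = f a := by
  have hc : ∀ y, Nonempty ({a // f a = y} ≃ {b // g b = y}) := by
    intro y
    have := congrArg (Multiset.count y) h
    rw [Multiset.count_map, Multiset.count_map] at this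
    rw [← Fintype.card_eq, Fintype.card_subtype, Fintype.card_subtype]
    simpa [Finset.card_def, Finset.filter_val, eq_comm] using this
  let τ := fun y => (hc y).some
  refine ⟨(Equiv.sigmaFiberEquiv f).symm.trans ((Equiv.sigmaCongrRight τ).trans (Equiv.sigmaFiberEquiv g)), fun a => ?_⟩
  exact (τ (f a) ⟨a, rfl⟩).2

variable {V : Type} [AddCommGroup V] [Module F V] [Finite V]

def Dat (f : V →ₗ[F] V) (ι : Type) [Fintype ι] (p : ι → F[X]) (e : ι → ℕ) : Prop :=
  (∀ i, Irreducible (p i) ∧ (p i).Monic ∧ (p i).eval 0 ≠ 0 ∧ e i ≠ 0) ∧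
  ∑ i, e i * (p i).natDegree = Module.finrank F V ∧
  Nonempty (Module.AEval' f ≃ₗ[F[X]] ∀ i, F[X] ⧸ Ideal.span {p i ^ e i})

lemma exists_dat (f : V →ₗ[F] V) (hf : Function.Injective f) : ∃ (ι : Type) (_ : Fintype ι) (p : ι → F[X]) (e : ι → ℕ),
    Dat f ι p e := by
  have htor : Module.IsTorsion F[X] (Module.AEval' f) := by
    intro m
    refine ⟨⟨f.charpoly, mem_nonZeroDivisors_of_ne_zero f.charpoly_monic.ne_zero⟩, ?_⟩
    obtain ⟨v, rfl⟩ := (Module.AEval'.of f).surjective m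
    change f.charpoly • (Module.AEval.of F V f) v = 0
    rw [← Module.AEval.of_aeval_smul, LinearMap.aeval_self_charpoly, zero_smul, map_zero]
  obtain ⟨ι, _, p, hp, e, ⟨E⟩⟩ := Module.equiv_directSum_of_isTorsion htor
  let E1 := E.trans (DirectSum.linearEquivFunOnFintype F[X] ι _)
  let κ := {i : ι // e i ≠ 0}
  let R : (∀ i, F[X] ⧸ (Submodule.span F[X] {p i ^ e i})) →ₗ[F[X]] (∀ i : κ, F[X] ⧸ (Submodule.span F[X] {p i ^ e i})) :=
    LinearMap.pi fun i => LinearMap.proj i.1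
  have hR : Function.Bijective R := by
    constructor
    · intro a b hab
      funext i
      by_cases h : e i = 0
      · have : Subsingleton (F[X] ⧸ (Submodule.span F[X] {p i ^ e i})) := by
          rw [Submodule.Quotient.subsingleton_iff, h, pow_zero]; exact Ideal.span_singleton_one
        exact Subsingleton.elim _ _
      · exact congrFun hab ⟨i, h⟩
    · intro b
      refine ⟨fun i => if h : e i ≠ 0 then b ⟨i, h⟩ else 0, ?_⟩
      funext i
      exact dif_pos i.2
  let p' : κ → F[X] := fun i => normalize (p i)
  have hspan : ∀ i : κ, Submodule.span F[X] {p i ^ e i} = Ideal.span {p' i ^ e i} := by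
    intro i
    exact Ideal.span_singleton_eq_span_singleton.2 ((associated_normalize _).pow_pow)
  let E2 := (E1.trans (LinearEquiv.ofBijective R hR)).trans (LinearEquiv.piCongrRight fun i : κ => Submodule.quotEquivOfEq _ _ (hspan i))
  have hirr : ∀ i, Irreducible (p' i) := fun i => (associated_normalize _).irreducible (hp i)
  have hmon : ∀ i, (p' i).Monic := fun i => monic_normalize (hp i).ne_zero
  refine ⟨κ, inferInstance, p', fun i => e i, fun i => ⟨hirr i, hmon i, ?_, i.2⟩, ?_, ⟨E2⟩⟩
  · intro h0
    have hX : X ∣ p' i := by rw [X_dvd_iff, coeff_zero_eq_eval_zero, h0]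
    obtain ⟨r, hr⟩ := hX
    obtain ⟨k, hk⟩ := Nat.exists_eq_succ_of_ne_zero i.2
    let b : ∀ i : κ, F[X] ⧸ Ideal.span {p' i ^ e i} := Pi.single i (Ideal.Quotient.mk _ (p' i ^ k * r))
    have hb : (X : F[X]) • b = 0 := by
      rw [← Pi.single_smul, Pi.single_eq_zero_iff]
      change Ideal.Quotient.mk _ (X * (p' i ^ k * r)) = 0
      rw [Ideal.Quotient.eq_zero_iff_mem, Ideal.mem_span_singleton, hk, pow_succ]
      exact ⟨1, by rw [mul_one]; nth_rw 3 [hr]; ring⟩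
    have hb2 : b = 0 := by
      clear_value b
      obtain ⟨m, rfl⟩ := E2.surjective b
      rw [← map_smul, E2.map_eq_zero_iff] at hb
      obtain ⟨v, rfl⟩ := (Module.AEval'.of f).surjective m
      rw [Module.AEval'.X_smul_of, LinearEquiv.map_eq_zero_iff] at hb
      rw [(map_eq_zero_iff f hf).1 hb, map_zero, map_zero]
    simp only [b] at hb2
    rw [Pi.single_eq_zero_iff, Ideal.Quotient.eq_zero_iff_mem, Ideal.mem_span_singleton, hk, pow_succ] at hb2
    have h1 := (mul_dvd_mul_iff_left (pow_ne_zero k (hirr i).ne_zero)).1 hb2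
    have hr0 : r ≠ 0 := by rintro rfl; exact (hirr i).ne_zero (by rw [hr, mul_zero])
    rw [hr] at h1
    have h2 : X ∣ (1 : F[X]) := by
      rw [← mul_dvd_mul_iff_right hr0, one_mul]; exact h1
    exact not_isUnit_X (isUnit_of_dvd_one h2)
  · have h1 := (E2.restrictScalars F).finrank_eq
    have h2 := (Module.AEval'.of f).finrank_eq
    have hfin : ∀ i : κ, Module.Finite F (F[X] ⧸ Ideal.span {p' i ^ e i}) := fun i =>
      (Polynomial.Monic.pow (hmon i) (e i)).finite_quotient
    rw [h2, h1, Module.finrank_pi_fintype]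
    refine Finset.sum_congr rfl fun i _ => ?_
    rw [finrank_quotient_span_eq_natDegree, natDegree_pow]

noncomputable def GG {ι : Type} [Fintype ι] (p : ι → F[X]) (e : ι → ℕ) (j : ℕ) : F[X] := ∏ i with e i = j + 1, p i

lemma GG_eq {f : V →ₗ[F] V} {ι : Type} [Fintype ι] {p : ι → F[X]} {e : ι → ℕ} (h : Dat f ι p e) (P : F[X]) (j : ℕ) :
    Multiset.count (P, j + 1) (Finset.univ.val.map fun i => (p i, e i)) =
      Multiset.count P (UniqueFactorizationMonoid.normalizedFactors (GG p e j)) := by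
  have : UniqueFactorizationMonoid.normalizedFactors (GG p e j) = (Finset.univ.filter fun i => e i = j + 1).val.map p := by
    unfold GG
    rw [Finset.prod_eq_multiset_prod, UniqueFactorizationMonoid.normalizedFactors_prod_eq, Multiset.map_map]
    · exact Multiset.map_congr rfl fun i _ => (h.1 i).2.1.normalize_eq_self
    · intro a ha
      obtain ⟨i, _, rfl⟩ := Multiset.mem_map.1 ha
      exact (h.1 i).1
  rw [this, Multiset.count_map, Multiset.count_map, Finset.filter_val, Multiset.filter_filter]
  simp only [Prod.mk.injEq, eq_comm (a := j + 1)]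

lemma dat_conj {f f' : V →ₗ[F] V} {ι ι' : Type} [Fintype ι] [Fintype ι'] {p : ι → F[X]} {e : ι → ℕ} {p' : ι' → F[X]} {e' : ι' → ℕ}
    (h : Dat f ι p e) (h' : Dat f' ι' p' e') (hG : GG p e = GG p' e') : cl f = cl f' := by
  have hm : (Finset.univ.val.map fun i => (p i, e i)) = (Finset.univ.val.map fun i => (p' i, e' i)) := by
    ext ⟨P, j⟩
    rcases j with _ | j
    · rw [Multiset.count_eq_zero_of_notMem, Multiset.count_eq_zero_of_notMem]
      · intro hh
        obtain ⟨i, _, hi⟩ := Multiset.mem_map.1 hh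
        exact (h'.1 i).2.2.2 (congrArg Prod.snd hi)
      · intro hh
        obtain ⟨i, _, hi⟩ := Multiset.mem_map.1 hh
        exact (h.1 i).2.2.2 (congrArg Prod.snd hi)
    · rw [GG_eq h, GG_eq h', hG]
  obtain ⟨σ, hσ⟩ := fib_equiv _ _ hm
  obtain ⟨E⟩ := h.2.2
  obtain ⟨E'⟩ := h'.2.2
  have hs : ∀ i, Ideal.span {p i ^ e i} = Ideal.span {p' (σ i) ^ e' (σ i)} := by
    intro i
    have := hσ i
    simp only [Prod.mk.injEq] at this
    rw [this.1, this.2]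
  let T : Module.AEval' f ≃ₗ[F[X]] Module.AEval' f' :=
    (E.trans (LinearEquiv.piCongrRight fun i => Submodule.quotEquivOfEq _ _ (hs i))).trans
      ((LinearEquiv.piCongrLeft F[X] (fun i => F[X] ⧸ Ideal.span {p' i ^ e' i}) σ).trans E'.symm)
  refine cl_eq ((Module.AEval'.of f).trans ((T.restrictScalars F).trans (Module.AEval'.of f').symm)) fun x => ?_
  simp only [LinearEquiv.trans_apply, LinearEquiv.restrictScalars_apply]
  rw [← Module.AEval'.X_smul_of, map_smul, LinearEquiv.symm_apply_eq, ← Module.AEval'.X_smul_of, LinearEquiv.apply_symm_apply]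

lemma dat_mem {f : V →ₗ[F] V} {ι : Type} [Fintype ι] {p : ι → F[X]} {e : ι → ℕ} (h : Dat f ι p e) {n : ℕ}
    (hn : Module.finrank F V = n) : GG p e ∈ TS F n n := by
  have hle : ∀ i, e i ≤ n := by
    intro i
    rw [← hn, ← h.2.1]
    refine le_trans ?_ (Finset.single_le_sum (f := fun i => e i * (p i).natDegree) (fun _ _ => Nat.zero_le _) (Finset.mem_univ i))
    exact Nat.le_mul_of_pos_right _ (h.1 i).1.natDegree_pos
  refine TS_mem _ _ _ (fun j => ⟨monic_prod_of_monic _ _ fun i _ => (h.1 i).2.1, ?_⟩) ?_ ?_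
  · unfold GG
    rw [eval_prod]
    exact Finset.prod_ne_zero_iff.2 fun i _ => (h.1 i).2.2.1
  · intro j hj
    unfold GG
    refine Finset.prod_eq_one fun i hi => ?_
    have := hle i
    rw [Finset.mem_filter] at hi
    omega
  · have h4 := h.2.1.trans hn
    rw [← Finset.sum_fiberwise_of_maps_to (t := Finset.range n) (g := fun i => e i - 1)] at h4
    · refine Eq.trans ?_ h4
      refine Finset.sum_congr rfl fun j _ => ?_
      unfold GG
      rw [natDegree_prod_of_monic _ _ fun i _ => (h.1 i).2.1, Finset.mul_sum]
      refine Finset.sum_congr ?_ ?_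
      · ext i
        have := (h.1 i).2.2.2
        simp only [Finset.mem_filter, Finset.mem_univ, true_and]
        omega
      · intro i hi
        have := (h.1 i).2.2.2
        rw [Finset.mem_filter] at hi
        rw [show e i = j + 1 by omega]
    · intro i _
      have := (h.1 i).2.2.2
      have := hle i
      rw [Finset.mem_range]; omega

lemma card_conj (n : ℕ) (hn : n ≠ 0) : Nat.card (ConjClasses (GL (Fin n) F)) ≤ Nat.card F ^ n := by
  choose ι fι p e hD using fun g : GL (Fin n) F => exists_dat (Matrix.toLin' g.1) (gl_inj g)
  have hmem := fun g => dat_mem (hD g) (n := n) (by simp)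
  let Φ : ConjClasses (GL (Fin n) F) → TS F n n := fun c => ⟨GG (p c.out) (e c.out), hmem _⟩
  have hΦ : Function.Injective Φ := by
    intro c c' h
    have h1 := dat_conj (hD c.out) (hD c'.out) (congrArg Subtype.val h)
    obtain ⟨x, hx⟩ := clG_conj h1
    rw [← Quotient.out_eq c, ← Quotient.out_eq c']
    exact Quotient.sound (isConj_iff.2 ⟨x, hx⟩)
  have h1 := Nat.card_le_card_of_injective Φ hΦ
  rw [Nat.card_eq_fintype_card (α := TS F n n), Fintype.card_coe] at h1
  refine h1.trans ((TS_card n n).trans ?_)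
  have hq : 2 ≤ Nat.card F := Finite.one_lt_card
  have h2 := dv_le (Nat.card F) hq n n hn
  have h3 : (dv (Nat.card F) n n : ℝ) ≤ (Nat.card F : ℝ) ^ n :=
    h2.trans (mul_le_of_le_one_right (by positivity) (by
      have : 0 ≤ ((Nat.card F : ℝ))⁻¹ ^ n := by positivity
      linarith))
  exact_mod_cast h3
end PartH2

section PartZ
open Matrix ComplexConjugate
attribute [local instance 10] Fintype.ofFinite
attribute [local instance 10] Classical.propDecidable

lemma final_aux {F : Type} [Field F] [Finite F] (p r : ℕ) (hp : p.Prime) (hF : Nat.card F = p ^ r) (d : ℕ) (hd : 0 < d)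
    (hpd : p ∣ d) (m : ℕ) :
    Nat.card {χ : GL (Fin (m + 1)) F → ℂ // IsIrrChar _ χ ∧ NatDvdAlg d (χ 1)} + (Nat.card F - 1) * Nat.card F ^ m
      ≤ Nat.card {χ : GL (Fin (m + 1)) F → ℂ // IsIrrChar _ χ} := by
  let I := Irr (GL (Fin (m + 1)) F)
  have h1 : Nat.card {χ : GL (Fin (m + 1)) F → ℂ // IsIrrChar _ χ ∧ NatDvdAlg d (χ 1)} ≤
      Nat.card {χ : I // χ.1 (uG F (m + 1)) = 0} := by
    refine Nat.card_le_card_of_injective (fun χ => ⟨⟨χ.1, χ.2.1⟩, irr_u_dvd ⟨χ.1, χ.2.1⟩ p r hp hF d hd hpd χ.2.2⟩) ?_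
    intro a b h
    exact Subtype.ext (congrArg (fun x => x.1.1) h)
  have h2 : (Nat.card F - 1) * Nat.card F ^ m ≤ Nat.card {χ : I // ¬ χ.1 (uG F (m + 1)) = 0} := by
    refine (cent_u m).trans (le_of_eq ?_)
    have hc := col_ortho (uG F (m + 1))
    have : ∀ χ : I, χ.1 (uG F (m + 1)) * conj (χ.1 (uG F (m + 1))) = if χ.1 (uG F (m + 1)) = 0 then 0 else 1 := by
      intro χ
      rcases irr_u χ with h | h | h <;> rw [h] <;> simp
    rw [Finset.sum_congr rfl fun χ _ => this χ] at hc
    rw [Nat.card_eq_fintype_card (α := {χ : I // ¬ χ.1 (uG F (m + 1)) = 0}), Fintype.card_subtype]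
    have h3 : (∑ χ : I, if χ.1 (uG F (m + 1)) = 0 then (0 : ℂ) else 1) =
      ((Finset.univ.filter fun χ : I => ¬ χ.1 (uG F (m + 1)) = 0).card : ℂ) := by
      rw [Finset.card_filter, Nat.cast_sum]
      refine Finset.sum_congr rfl fun χ _ => ?_
      split_ifs <;> simp_all
    rw [h3] at hc
    exact_mod_cast hc.symm
  refine (Nat.add_le_add h1 h2).trans (le_of_eq ?_)
  have := Fintype.card_subtype_compl (fun χ : I => χ.1 (uG F (m + 1)) = 0)
  have h4 := Fintype.card_subtype_le (fun χ : I => χ.1 (uG F (m + 1)) = 0)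
  rw [Nat.card_eq_fintype_card, Nat.card_eq_fintype_card, Nat.card_eq_fintype_card (α := I), this]
  omega
end PartZ

theorem low_divisibility_of_degrees
    (q : ℕ) (hq : IsPrimePow q)
    (F : Type) [Field F] [Fintype F] (hFq : Fintype.card F = q)
    (d : ℕ) (hd : 0 < d) (hdq : ¬ Nat.Coprime d q) (n : ℕ) (hn : 0 < n) :
    (Nat.card {χ : GL (Fin n) F → ℂ // IsIrrChar _ χ ∧ NatDvdAlg d (χ 1)} : ℝ)
      / (Nat.card {χ : GL (Fin n) F → ℂ // IsIrrChar _ χ} : ℝ) ≤ 1 / (q : ℝ) := by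
  obtain ⟨m, rfl⟩ := Nat.exists_eq_succ_of_ne_zero hn.ne'
  obtain ⟨p, r, hp, hr, hpr⟩ := hq
  have hp' := hp.nat_prime
  have hFc : Nat.card F = q := by rw [Nat.card_eq_fintype_card, hFq]
  have hpd : p ∣ d := by
    by_contra h
    apply hdq
    rw [← hpr]
    exact (((Nat.Prime.coprime_iff_not_dvd hp').2 h).symm).pow_right r
  have h1 := final_aux p r hp' (hFc.trans hpr.symm) d hd hpd m
  have h2 : Nat.card (Irr (GL (Fin (m + 1)) F)) ≤ q ^ (m + 1) := by
    have := Fintype.ofFinite (GL (Fin (m + 1)) F)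
    rw [← hFc]; exact (card_irr_le).trans (card_conj (m + 1) (by omega))
  have hq1 : 1 < q := by rw [← hFc]; exact Finite.one_lt_card
  rw [hFc] at h1
  change Nat.card {χ : GL (Fin (m + 1)) F → ℂ // IsIrrChar _ χ ∧ NatDvdAlg d (χ 1)} + _ ≤ Nat.card (Irr (GL (Fin (m + 1)) F)) at h1
  change (Nat.card {χ : GL (Fin (m + 1)) F → ℂ // IsIrrChar _ χ ∧ NatDvdAlg d (χ 1)} : ℝ) / (Nat.card (Irr (GL (Fin (m + 1)) F)) : ℝ) ≤ _
  generalize Nat.card (Irr (GL (Fin (m + 1)) F)) = k at *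
  generalize Nat.card {χ : GL (Fin (m + 1)) F → ℂ // IsIrrChar _ χ ∧ NatDvdAlg d (χ 1)} = b at *
  have hN : 0 < (q - 1) * q ^ m := Nat.mul_pos (by omega) (by positivity)
  have hk : 0 < k := by omega
  rw [div_le_div_iff₀ (by exact_mod_cast hk) (by exact_mod_cast (by omega : 0 < q)), one_mul]
  obtain ⟨t, rfl⟩ : ∃ t, q = t + 1 := ⟨q - 1, by omega⟩
  rw [Nat.add_sub_cancel] at h1
  have : b * (t + 1) ≤ k := by
    have e1 := Nat.mul_le_mul_right (t + 1) h1
    have e2 := Nat.mul_le_mul_left t h2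
    rw [pow_succ] at e2
    nlinarith
  exact_mod_cast this
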